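/- arXiv:1203.0846 — 2 statements merged into one kernel-verified Lean document; each statement's English description precedes it below -/
import Mathlib

section
/- Let w be a real-valued Schwartz function on ℝ². Then Λw = 0 everywhere on ℝ² if and only if there exist β₁, β₂ ∈ ℝ such that the function w − β₁ ∂₁G − β₂ ∂₂G is radially symmetric (i.e. its value at ξ depends only on |ξ|). -/
open MeasureTheory Filter Real
open scoped ENNReal Topology

noncomputable section

abbrev R2 := EuclideanSpace ℝ (Fin 2)

/-- `x^⊥ = (-x₂, x₁)`. -/
def perp (x : R2) : R2 := (WithLp.equiv 2 (Fin 2 → ℝ)).symm ![-x 1, x 0]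

/-- Biot–Savart velocity `u = K * ω`. -/
def biotSavart (ω : R2 → ℝ) (x : R2) : R2 :=
  (2 * π)⁻¹ • ∫ y : R2, (ω y / ‖x - y‖ ^ 2) • perp (x - y)

/-- Gaussian Oseen vorticity profile `G(ξ) = (4π)⁻¹ e^{-|ξ|²/4}`. -/
def Gv (ξ : R2) : ℝ := (4 * π)⁻¹ * Real.exp (-‖ξ‖ ^ 2 / 4)

/-- Oseen velocity profile `v^G(ξ) = (2π)⁻¹ (ξ^⊥/|ξ|²)(1 - e^{-|ξ|²/4})`. -/
def vG (ξ : R2) : R2 :=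
  ((2 * π)⁻¹ * (1 - Real.exp (-‖ξ‖ ^ 2 / 4)) / ‖ξ‖ ^ 2) • perp ξ

/-- The operator `(Λw)(ξ) = v^G(ξ)·∇w(ξ) + (K*w)(ξ)·∇G(ξ)`. -/
def Lam (w : R2 → ℝ) (ξ : R2) : ℝ :=
  fderiv ℝ w ξ (vG ξ) + fderiv ℝ Gv ξ (biotSavart w ξ)

/-- Partial derivative `∂ᵢ f` of a scalar function on `ℝ²`. -/
def pd (i : Fin 2) (f : R2 → ℝ) (x : R2) : ℝ := fderiv ℝ f x (EuclideanSpace.single i 1)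

open Set

/-- The angular Biot–Savart kernel `x · K(x - y) · 2π` in polar coordinates, `α` being the angle
from `x` to `y`. -/
def angKer (r ρ α : ℝ) : ℝ := r * ρ * Real.sin α / (r ^ 2 + ρ ^ 2 - 2 * r * ρ * Real.cos α)

/-- The ratio `min (r, ρ) / max (r, ρ)`. -/
def ratio (r ρ : ℝ) : ℝ := min r ρ / max r ρ

/-- The radial factor `r e^{-r²/4}` of the kernel elements `∂ᵢG`. -/
def prof (r : ℝ) : ℝ := r * Real.exp (-r ^ 2 / 4)

/-- The multiplier `8 (1 - e^{-r²/4}) / r`, proportional to `r` times the Oseen angular velocity. -/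
def mult (r : ℝ) : ℝ := 8 * (1 - Real.exp (-r ^ 2 / 4)) / r

theorem integral_exp_int_mul_I (n : ℤ) :
    ∫ α in (-π)..π, Complex.exp (n * α * Complex.I) = if n = 0 then 2 * π else 0 := by
  split_ifs with h
  · subst h
    simp
    ring
  · have hc : (n * Complex.I : ℂ) ≠ 0 := by simp [h]
    have := integral_exp_mul_complex (a := -π) (b := π) hc
    have e : (fun α : ℝ => Complex.exp (n * α * Complex.I))
        = fun α : ℝ => Complex.exp (n * Complex.I * α) := by
      funext α; ring_nf
    rw [e, this]
    have : Complex.exp (n * Complex.I * π) = Complex.exp (n * Complex.I * (-π : ℝ)) := by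
      rw [Complex.exp_eq_exp_iff_exists_int]
      exact ⟨n, by push_cast; ring⟩
    rw [this]; simp

theorem angKer_eq_im {r ρ : ℝ} (hr : 0 < r) (hρ : 0 < ρ) (α : ℝ) :
    (angKer r ρ α : ℂ) = ((ratio r ρ * Complex.exp (α * Complex.I)) /
      (1 - ratio r ρ * Complex.exp (α * Complex.I))).im := by
  have hM : 0 < max r ρ := lt_max_of_lt_left hr
  have h1 : r * ρ = max r ρ ^ 2 * ratio r ρ := by
    rw [ratio, ← min_mul_max r ρ]; field_simp
  have h2 : r ^ 2 + ρ ^ 2 = max r ρ ^ 2 * (1 + ratio r ρ ^ 2) := by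
    rw [ratio]; field_simp
    rcases le_total r ρ with h | h <;> simp [h]
    ring
  congr 1
  have h3 : r ^ 2 + ρ ^ 2 - 2 * r * ρ * Real.cos α
      = max r ρ ^ 2 * (1 + ratio r ρ ^ 2 - 2 * ratio r ρ * Real.cos α) := by
    rw [h2, mul_assoc 2 r ρ, h1]; ring
  rw [angKer, h3, h1, mul_assoc (max r ρ ^ 2), mul_div_mul_left _ _ (by positivity)]
  rw [Complex.exp_mul_I, ← Complex.ofReal_cos, ← Complex.ofReal_sin]
  simp only [Complex.div_im, Complex.mul_re, Complex.mul_im, Complex.add_re, Complex.add_im,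
    Complex.sub_re, Complex.sub_im, Complex.ofReal_re, Complex.ofReal_im, Complex.I_re,
    Complex.I_im, Complex.one_re, Complex.one_im, Complex.normSq_apply]
  have h4 : 1 + ratio r ρ ^ 2 - 2 * ratio r ρ * Real.cos α =
      (1 - ratio r ρ * Real.cos α) * (1 - ratio r ρ * Real.cos α)
        + ratio r ρ * Real.sin α * (ratio r ρ * Real.sin α) := by
    linear_combination (-ratio r ρ ^ 2) * Real.sin_sq_add_cos_sq α
  simp only [mul_zero, mul_one, sub_zero, add_zero, zero_mul, zero_add, zero_sub]
  rw [h4, div_sub_div_same]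
  ring_nf

theorem ratio_nonneg {r ρ : ℝ} (hr : 0 < r) (hρ : 0 < ρ) : 0 ≤ ratio r ρ := by
  unfold ratio; positivity

theorem ratio_pos {r ρ : ℝ} (hr : 0 < r) (hρ : 0 < ρ) : 0 < ratio r ρ :=
  div_pos (lt_min hr hρ) (lt_max_of_lt_left hr)

theorem ratio_le_one {r ρ : ℝ} (hr : 0 < r) : ratio r ρ ≤ 1 :=
  div_le_one_of_le₀ min_le_max (lt_max_of_lt_left hr).le

theorem ratio_lt_one {r ρ : ℝ} (hr : 0 < r) (h : r ≠ ρ) : ratio r ρ < 1 :=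
  (div_lt_one (lt_max_of_lt_left hr)).2 (min_lt_max.2 h)

theorem ratio_comm (r ρ : ℝ) : ratio r ρ = ratio ρ r := by
  rw [ratio, ratio, min_comm, max_comm]

theorem measurable_ratio : Measurable (fun p : ℝ × ℝ => ratio p.1 p.2) := by
  unfold ratio; fun_prop

theorem integral_angKer_mul_exp {r ρ : ℝ} (hr : 0 < r) (hρ : 0 < ρ) (h : r ≠ ρ) (n : ℕ) :
    ∫ α in (-π)..π, (angKer r ρ α : ℂ) * Complex.exp (n * α * Complex.I)
      = if n = 0 then 0 else π * Complex.I * ratio r ρ ^ n := by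
  set q := ratio r ρ with hq
  have q0 : 0 ≤ q := ratio_nonneg hr hρ
  have q1 : q < 1 := ratio_lt_one hr h
  let F : ℕ → ℝ → ℂ := fun k α => (q : ℂ) ^ k / (2 * Complex.I) *
    (Complex.exp ((n + k : ℤ) * α * Complex.I) - Complex.exp ((n - k : ℤ) * α * Complex.I))
  have hsum : ∀ α : ℝ, HasSum (fun k => F k α)
      ((angKer r ρ α : ℂ) * Complex.exp (n * α * Complex.I)) := by
    intro α
    set z : ℂ := q * Complex.exp (α * Complex.I) with hz
    have nz : ‖z‖ < 1 := by
      rw [hz, norm_mul, Complex.norm_exp_ofReal_mul_I]; simpa [abs_of_nonneg q0] using q1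
    have s1 := hasSum_geometric_of_norm_lt_one nz
    have nz' : ‖(starRingEnd ℂ) z‖ < 1 := by rwa [Complex.norm_conj]
    have s2 := hasSum_geometric_of_norm_lt_one nz'
    have z1 : 1 - z ≠ 0 := fun h0 => by
      rw [← sub_eq_zero.1 h0] at nz; simp at nz
    have z2 : 1 - (starRingEnd ℂ) z ≠ 0 := fun h0 => by
      rw [← sub_eq_zero.1 h0] at nz'; simp at nz'
    have s3 := ((s1.sub s2).div_const (2 * Complex.I)).mul_right (Complex.exp (n * α * Complex.I))
    have hF : (fun k => F k α) = fun k => (z ^ k - (starRingEnd ℂ) z ^ k) / (2 * Complex.I) *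
        Complex.exp (n * α * Complex.I) := by
      funext k
      have e1 : z ^ k = q ^ k * Complex.exp (k * α * Complex.I) := by
        rw [hz, mul_pow, ← Complex.exp_nat_mul]; ring_nf
      have e2 : (starRingEnd ℂ) z ^ k = q ^ k * Complex.exp (-(k * α * Complex.I)) := by
        rw [← map_pow, e1, map_mul, ← Complex.exp_conj]; simp
      simp only [F]
      rw [e1, e2]
      push_cast
      rw [show ((n:ℂ) + k) * α * Complex.I = k * α * Complex.I + n * α * Complex.I by ring,
        show ((n:ℂ) - k) * α * Complex.I = -(k * α * Complex.I) + n * α * Complex.I by ring,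
        Complex.exp_add, Complex.exp_add]
      ring
    have hA : (angKer r ρ α : ℂ)
        = ((1 - z)⁻¹ - (1 - (starRingEnd ℂ) z)⁻¹) / (2 * Complex.I) := by
      rw [angKer_eq_im hr hρ, ← hq, ← hz, Complex.im_eq_sub_conj]
      rw [map_div₀, map_sub, map_one]
      field_simp
      ring
    rw [hF, hA]
    exact s3
  have h_int : HasSum (fun k => ∫ α in (-π)..π, F k α)
      (∫ α in (-π)..π, (angKer r ρ α : ℂ) * Complex.exp (n * α * Complex.I)) := by
    refine intervalIntegral.hasSum_integral_of_dominated_convergence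
      (fun k _ => q ^ k) ?_ ?_ ?_ ?_ ?_
    · intro k
      apply Continuous.aestronglyMeasurable
      simp only [F]; fun_prop
    · intro k
      refine ae_of_all _ fun α _ => ?_
      simp only [F]
      rw [norm_mul, norm_div, norm_pow]
      have a1 : ‖Complex.exp ((n + k : ℤ) * α * Complex.I)‖ = 1 := by
        have := Complex.norm_exp_ofReal_mul_I (((n + k : ℤ) : ℝ) * α)
        push_cast at this ⊢; exact this
      have a2 : ‖Complex.exp ((n - k : ℤ) * α * Complex.I)‖ = 1 := by
        have := Complex.norm_exp_ofReal_mul_I (((n - k : ℤ) : ℝ) * α)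
        push_cast at this ⊢; exact this
      have a3 := norm_sub_le (Complex.exp ((n + k : ℤ) * α * Complex.I))
        (Complex.exp ((n - k : ℤ) * α * Complex.I))
      rw [a1, a2] at a3
      have a4 : ‖(q : ℂ)‖ = q := by simp [abs_of_nonneg q0]
      have a5 : ‖2 * Complex.I‖ = 2 := by simp
      rw [a4, a5]
      calc q ^ k / 2 * _ ≤ q ^ k / 2 * (1 + 1) := by gcongr
        _ = q ^ k := by ring
    · exact ae_of_all _ fun α _ => summable_geometric_of_lt_one q0 q1
    · exact intervalIntegrable_const
    · exact ae_of_all _ fun α _ => hsum α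
  have hval : ∀ k, ∫ α in (-π)..π, F k α
      = if k = n then (if n = 0 then 0 else π * Complex.I * q ^ n) else 0 := by
    intro k
    simp only [F]
    rw [intervalIntegral.integral_const_mul, intervalIntegral.integral_sub
      (Continuous.intervalIntegrable (by fun_prop) _ _)
      (Continuous.intervalIntegrable (by fun_prop) _ _),
      integral_exp_int_mul_I, integral_exp_int_mul_I]
    by_cases hk : k = n
    · subst hk
      by_cases k0 : k = 0
      · simp [k0]
      · have : ¬ ((k : ℤ) + k = 0) := by omega
        simp only [this, k0, sub_self, if_true, if_false]
        push_cast
        field_simp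
        linear_combination (-2 * (π : ℂ) * (q : ℂ) ^ k) * Complex.I_sq
    · have h1 : ¬ ((n : ℤ) + k = 0) := by omega
      have h2 : ¬ ((n : ℤ) - k = 0) := by omega
      simp [h1, h2, hk]
  simp only [hval] at h_int
  exact h_int.unique (hasSum_ite_eq n _)

theorem prof_pos {r : ℝ} (hr : 0 < r) : 0 < prof r := by unfold prof; positivity

theorem mult_pos {r : ℝ} (hr : 0 < r) : 0 < mult r := by
  have : Real.exp (-r ^ 2 / 4) < 1 := by
    rw [Real.exp_lt_one_iff]
    have : 0 < r ^ 2 := by positivity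
    linarith
  unfold mult
  have : 0 < 1 - Real.exp (-r ^ 2 / 4) := by linarith
  positivity

theorem continuous_prof : Continuous prof := by unfold prof; fun_prop

theorem integrableOn_pow_mul_prof (k : ℕ) : IntegrableOn (fun r => r ^ k * prof r) (Ioi 0) := by
  have := integrable_rpow_mul_exp_neg_mul_sq (b := 1 / 4) (by norm_num) (s := (k + 1 : ℕ))
    (lt_of_lt_of_le (by norm_num) (Nat.cast_nonneg _))
  refine (this.integrableOn (s := Ioi 0)).congr_fun (fun x hx => ?_) measurableSet_Ioi
  simp only [prof, Real.rpow_natCast]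
  rw [show -(1 / 4) * x ^ 2 = -x ^ 2 / 4 by ring]
  ring

theorem integral_ratio_mul_prof {r : ℝ} (hr : 0 < r) :
    ∫ ρ in Ioi 0, ratio r ρ * (prof ρ * ρ) = mult r := by
  have hd : ∀ x : ℝ, HasDerivAt (fun x : ℝ => Real.exp (-x ^ 2 / 4))
      (-(x / 2) * Real.exp (-x ^ 2 / 4)) x := by
    intro x
    have := (((hasDerivAt_pow 2 x).neg).div_const 4).exp
    convert! this using 1
    simp; ring
  have hi : IntegrableOn (fun ρ => ratio r ρ * (prof ρ * ρ)) (Ioi 0) := by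
    refine Integrable.mono' (integrableOn_pow_mul_prof 1) ?_ ?_
    · exact ((measurable_ratio.comp (measurable_const.prodMk measurable_id)).mul
        (continuous_prof.mul continuous_id).measurable).aestronglyMeasurable
    · refine (ae_restrict_iff' measurableSet_Ioi).2 (ae_of_all _ fun ρ hρ => ?_)
      have hρ : 0 < ρ := hρ
      have := prof_pos hρ
      have h1 := ratio_nonneg hr hρ
      rw [Real.norm_of_nonneg (by positivity)]
      nlinarith [ratio_le_one (ρ := ρ) hr, mul_pos this hρ]
  rw [← Ioc_union_Ioi_eq_Ioi hr.le, setIntegral_union Ioc_disjoint_Ioi_same measurableSet_Ioi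
    (hi.mono_set Ioc_subset_Ioi_self) (hi.mono_set (Ioi_subset_Ioi hr.le))]
  have e1 : ∫ ρ in Ioc 0 r, ratio r ρ * (prof ρ * ρ)
      = (8 - (2 * r ^ 2 + 8) * Real.exp (-r ^ 2 / 4)) / r := by
    rw [setIntegral_congr_fun (g := fun ρ => ρ ^ 3 * Real.exp (-ρ ^ 2 / 4) / r) measurableSet_Ioc]
    · rw [← intervalIntegral.integral_of_le hr.le,
        intervalIntegral.integral_eq_sub_of_hasDerivAt
          (f := fun x => -(2 * x ^ 2 + 8) * Real.exp (-x ^ 2 / 4) / r)]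
      · simp; ring
      · intro x _
        have := (((((hasDerivAt_pow 2 x).const_mul 2).add_const 8).neg).mul (hd x)).div_const r
        convert! this using 1
        simp; ring
      · exact Continuous.intervalIntegrable (by fun_prop) _ _
    · intro ρ hρ
      simp only [ratio, prof, min_eq_right hρ.2, max_eq_left hρ.2]
      ring
  have e2 : ∫ ρ in Ioi r, ratio r ρ * (prof ρ * ρ) = 2 * r * Real.exp (-r ^ 2 / 4) := by
    rw [setIntegral_congr_fun (g := fun ρ => r * prof ρ) measurableSet_Ioi]
    · rw [integral_Ioi_of_hasDerivAt_of_tendsto' (f := fun x => -2 * r * Real.exp (-x ^ 2 / 4))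
        (m := 0)]
      · ring
      · intro x _
        have := (hd x).const_mul (-2 * r)
        convert! this using 1
        simp only [prof]; ring
      · have := (integrableOn_pow_mul_prof 0).mono_set (Ioi_subset_Ioi hr.le)
        have h2 := this.const_mul r
        simp only [pow_zero, one_mul] at h2
        exact h2
      · rw [show (0 : ℝ) = -2 * r * 0 by ring]
        refine Tendsto.const_mul _ (Real.tendsto_exp_atBot.comp ?_)
        have := (tendsto_pow_atTop (α := ℝ) (n := 2) (by norm_num)).atTop_mul_const
          (show (0 : ℝ) < 1 / 4 by norm_num)
        refine (tendsto_neg_atTop_atBot.comp this).congr fun x => ?_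
        simp only [Function.comp]; ring
    · intro ρ hρ
      have hρ : r < ρ := hρ
      have : ρ ≠ 0 := (hr.trans hρ).ne'
      simp only [ratio, min_eq_left hρ.le, max_eq_right hρ.le]
      field_simp
  rw [e1, e2, mult]
  field_simp
  ring

theorem integrableOn_ratio_pow_mul {f : ℝ → ℝ} (h1 : IntegrableOn (fun ρ => f ρ * ρ) (Ioi 0))
    (n : ℕ) {r : ℝ} (hr : 0 < r) :
    IntegrableOn (fun ρ => ratio r ρ ^ n * (f ρ * ρ)) (Ioi 0) := by
  refine Integrable.bdd_mul (c := 1) h1 ?_ ?_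
  · exact ((measurable_ratio.comp (measurable_const.prodMk measurable_id)).pow_const
      n).aestronglyMeasurable
  · refine (ae_restrict_iff' measurableSet_Ioi).2 (ae_of_all _ fun ρ hρ => ?_)
    have h := ratio_nonneg hr hρ
    rw [norm_pow, Real.norm_of_nonneg h]
    exact pow_le_one₀ h (ratio_le_one hr)

section Pairing

variable {f : ℝ → ℝ} (h0 : IntegrableOn f (Ioi 0)) (h1 : IntegrableOn (fun ρ => f ρ * ρ) (Ioi 0))

include h1 in
theorem integrableOn_abs_mul_self : IntegrableOn (fun ρ => |f ρ| * ρ) (Ioi 0) := by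
  refine IntegrableOn.congr_fun h1.abs (fun ρ hρ => ?_) measurableSet_Ioi
  have hρ : 0 < ρ := hρ
  simp [abs_mul, abs_of_pos hρ]

include h1 in
theorem integrable_pairing_kernel :
    Integrable (fun p : ℝ × ℝ => ratio p.1 p.2 * (p.1 ^ 1 * prof p.1 * (|f p.2| * p.2)))
      ((volume.restrict (Ioi 0)).prod (volume.restrict (Ioi 0))) := by
  refine Integrable.bdd_mul (c := 1)
    (Integrable.mul_prod (integrableOn_pow_mul_prof 1) (integrableOn_abs_mul_self h1))
    measurable_ratio.aestronglyMeasurable ?_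
  rw [Measure.prod_restrict]
  refine (ae_restrict_iff' (measurableSet_Ioi.prod measurableSet_Ioi)).2
    (ae_of_all _ fun p hp => ?_)
  rw [Real.norm_of_nonneg (ratio_nonneg hp.1 hp.2)]
  exact ratio_le_one hp.1

include h1 in
theorem integrableOn_pairing :
    IntegrableOn (fun r => r * (prof r * ∫ ρ in Ioi 0, ratio r ρ * (|f ρ| * ρ))) (Ioi 0) := by
  refine (integrable_pairing_kernel h1).integral_prod_left.congr (ae_of_all _ fun r => ?_)
  simp only
  rw [← integral_const_mul, ← integral_const_mul]
  congr 1; ext ρ; ring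

include h1 in
theorem integral_pairing :
    ∫ r in Ioi 0, r * (prof r * ∫ ρ in Ioi 0, ratio r ρ * (|f ρ| * ρ))
      = ∫ r in Ioi 0, r * (mult r * |f r|) := by
  have hs := integral_integral_swap
    (f := fun r ρ => ratio r ρ * (r ^ 1 * prof r * (|f ρ| * ρ))) (integrable_pairing_kernel h1)
  have e1 : ∀ r, r * (prof r * ∫ ρ in Ioi 0, ratio r ρ * (|f ρ| * ρ))
      = ∫ ρ in Ioi 0, ratio r ρ * (r ^ 1 * prof r * (|f ρ| * ρ)) := by
    intro r
    rw [← integral_const_mul, ← integral_const_mul]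
    congr 1; ext ρ; ring
  simp_rw [e1]
  rw [hs]
  refine setIntegral_congr_fun measurableSet_Ioi fun ρ hρ => ?_
  rw [← integral_ratio_mul_prof hρ, ← integral_mul_const, ← integral_const_mul]
  congr 1; ext r; rw [ratio_comm]; ring

include h0 in
theorem integrableOn_mult_mul_abs : IntegrableOn (fun r => r * (mult r * |f r|)) (Ioi 0) := by
  have : IntegrableOn (fun r => (8 * (1 - Real.exp (-r ^ 2 / 4))) * |f r|) (Ioi 0) := by
    refine Integrable.bdd_mul (c := 8) h0.abs ?_ (ae_of_all _ fun r => ?_)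
    · apply Continuous.aestronglyMeasurable; fun_prop
    · have h2 : Real.exp (-r ^ 2 / 4) ≤ 1 := by
        rw [Real.exp_le_one_iff]; nlinarith [sq_nonneg r]
      rw [Real.norm_of_nonneg (by linarith)]
      linarith [Real.exp_pos (-r ^ 2 / 4)]
  refine this.congr_fun (fun r hr => ?_) measurableSet_Ioi
  have hr : 0 < r := hr
  simp only [mult]
  field_simp

variable {n : ℕ} (hE : ∀ r, 0 < r →
  n * mult r * f r = prof r * ∫ ρ in Ioi 0, ratio r ρ ^ n * (f ρ * ρ))

include h1 hE in
theorem mode_abs_le (hn : 1 ≤ n) {r : ℝ} (hr : 0 < r) :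
    n * (r * (mult r * |f r|)) ≤ r * (prof r * ∫ ρ in Ioi 0, ratio r ρ * (|f ρ| * ρ)) := by
  have hm := mult_pos hr
  have hp := prof_pos hr
  have e : n * (r * (mult r * |f r|))
      = r * (prof r * |∫ ρ in Ioi 0, ratio r ρ ^ n * (f ρ * ρ)|) := by
    have := congrArg abs (hE r hr)
    rw [abs_mul, abs_mul, abs_mul, abs_of_pos hm, abs_of_pos hp, Nat.abs_cast] at this
    rw [← this]; ring
  rw [e]
  gcongr
  refine (abs_integral_le_integral_abs).trans ?_
  refine setIntegral_mono_on (integrableOn_ratio_pow_mul h1 n hr).abs ?_ measurableSet_Ioi ?_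
  · simpa using integrableOn_ratio_pow_mul (integrableOn_abs_mul_self h1) 1 hr
  · intro ρ hρ
    have hρ : 0 < ρ := hρ
    have hq := ratio_nonneg hr hρ
    rw [abs_mul, abs_mul, abs_pow, abs_of_nonneg hq, abs_of_pos hρ]
    gcongr
    calc ratio r ρ ^ n ≤ ratio r ρ ^ 1 := pow_le_pow_of_le_one hq (ratio_le_one hr) hn
      _ = _ := pow_one _

include hE in
theorem mode_eq_zero_of_ae (hn : 1 ≤ n) (ha : ∀ᵐ ρ ∂(volume.restrict (Ioi 0)), f ρ = 0)
    {r : ℝ} (hr : 0 < r) : f r = 0 := by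
  have h := hE r hr
  rw [integral_eq_zero_of_ae (by filter_upwards [ha] with ρ hρ; simp [hρ]), mul_zero] at h
  have hm := mult_pos hr
  have hn' : (0 : ℝ) < n := by exact_mod_cast hn
  have : n * mult r ≠ 0 := by positivity
  exact (mul_eq_zero.1 h).resolve_left this

include h0 h1 hE in
/-- The higher angular modes of an element of the kernel vanish. -/
theorem mode_eq_zero (hn : 2 ≤ n) {r : ℝ} (hr : 0 < r) : f r = 0 := by
  refine mode_eq_zero_of_ae hE (by omega) ?_ hr
  have hi := integrableOn_mult_mul_abs h0
  have hle : n * ∫ r in Ioi 0, r * (mult r * |f r|) ≤ ∫ r in Ioi 0, r * (mult r * |f r|) := by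
    rw [← integral_const_mul, ← integral_pairing h1]
    exact setIntegral_mono_on (hi.const_mul _) (integrableOn_pairing h1) measurableSet_Ioi
      fun r hr => mode_abs_le h1 hE (by omega) hr
  have hnn : 0 ≤ᵐ[volume.restrict (Ioi 0)] fun r => r * (mult r * |f r|) := by
    refine (ae_restrict_iff' measurableSet_Ioi).2 (ae_of_all _ fun r hr => ?_)
    have := mult_pos hr
    have hr : 0 < r := hr
    simp only [Pi.zero_apply]; positivity
  have hpos := integral_nonneg_of_ae hnn
  have hn' : (2 : ℝ) ≤ n := by exact_mod_cast hn
  have hz : ∫ r in Ioi 0, r * (mult r * |f r|) = 0 := by nlinarith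
  have := (integral_eq_zero_iff_of_nonneg_ae hnn hi).1 hz
  filter_upwards [this, ae_restrict_mem measurableSet_Ioi] with r h hr
  have h1 := mult_pos hr
  have hr : 0 < r := hr
  simpa [hr.ne', h1.ne'] using h

end Pairing

theorem ae_eq_zero_of_integral_ratio_abs_eq_zero {f : ℝ → ℝ} {r : ℝ} (hr : 0 < r)
    (h1 : IntegrableOn (fun ρ => f ρ * ρ) (Ioi 0))
    (h : ∫ ρ in Ioi 0, ratio r ρ * (|f ρ| * ρ) = 0) :
    ∀ᵐ ρ ∂(volume.restrict (Ioi 0)), f ρ = 0 := by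
  have hi := integrableOn_ratio_pow_mul (integrableOn_abs_mul_self h1) 1 hr
  simp only [pow_one] at hi
  have hnn : 0 ≤ᵐ[volume.restrict (Ioi 0)] fun ρ => ratio r ρ * (|f ρ| * ρ) := by
    refine (ae_restrict_iff' measurableSet_Ioi).2 (ae_of_all _ fun ρ hρ => ?_)
    have hρ : 0 < ρ := hρ
    have := ratio_nonneg hr hρ
    simp only [Pi.zero_apply]; positivity
  filter_upwards [(integral_eq_zero_iff_of_nonneg_ae hnn hi).1 h,
    ae_restrict_mem measurableSet_Ioi] with ρ h hρ
  have hρ : 0 < ρ := hρ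
  simpa [hρ.ne', (ratio_pos hr hρ).ne'] using h

theorem ae_abs_eq_of_integral_ratio_eq {f : ℝ → ℝ} {r : ℝ} (hr : 0 < r)
    (h1 : IntegrableOn (fun ρ => f ρ * ρ) (Ioi 0))
    (h : ∫ ρ in Ioi 0, ratio r ρ * (|f ρ| * ρ) = ∫ ρ in Ioi 0, ratio r ρ * (f ρ * ρ)) :
    ∀ᵐ ρ ∂(volume.restrict (Ioi 0)), |f ρ| = f ρ := by
  have hi := integrableOn_ratio_pow_mul (integrableOn_abs_mul_self h1) 1 hr
  have hi' := integrableOn_ratio_pow_mul h1 1 hr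
  simp only [pow_one] at hi hi'
  have hz : ∫ ρ in Ioi 0, (ratio r ρ * (|f ρ| * ρ) - ratio r ρ * (f ρ * ρ)) = 0 := by
    rw [integral_sub hi hi', h, sub_self]
  have hnn : 0 ≤ᵐ[volume.restrict (Ioi 0)]
      fun ρ => ratio r ρ * (|f ρ| * ρ) - ratio r ρ * (f ρ * ρ) := by
    refine (ae_restrict_iff' measurableSet_Ioi).2 (ae_of_all _ fun ρ hρ => ?_)
    have hρ : 0 < ρ := hρ
    have := ratio_nonneg hr hρ
    simp only [Pi.zero_apply, sub_nonneg]
    gcongr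
    exact le_abs_self _
  filter_upwards [(integral_eq_zero_iff_of_nonneg_ae hnn (hi.sub hi')).1 hz,
    ae_restrict_mem measurableSet_Ioi] with ρ h hρ
  have hρ : 0 < ρ := hρ
  have hq := ratio_pos hr hρ
  have h2 : ratio r ρ * ρ * (|f ρ| - f ρ) = 0 := by
    simp only [Pi.zero_apply] at h
    linear_combination h
  exact sub_eq_zero.1 ((mul_eq_zero.1 h2).resolve_left (by positivity))

/-- A first angular mode of an element of the kernel vanishes if it vanishes somewhere. -/
theorem first_mode_eq_zero {f : ℝ → ℝ} (h0 : IntegrableOn f (Ioi 0))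
    (h1 : IntegrableOn (fun ρ => f ρ * ρ) (Ioi 0))
    (hE : ∀ r, 0 < r → mult r * f r = prof r * ∫ ρ in Ioi 0, ratio r ρ * (f ρ * ρ))
    {s : ℝ} (hs : 0 < s) (hfs : f s = 0) {r : ℝ} (hr : 0 < r) : f r = 0 := by
  have hE' : ∀ r, 0 < r →
      (1 : ℕ) * mult r * f r = prof r * ∫ ρ in Ioi 0, ratio r ρ ^ 1 * (f ρ * ρ) := by
    simpa using hE
  have hzero : ∀ r, 0 < r → f r = 0 → ∫ ρ in Ioi 0, ratio r ρ * (f ρ * ρ) = 0 := by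
    intro r hr h
    have := hE r hr
    rw [h, mul_zero] at this
    exact (mul_eq_zero.1 this.symm).resolve_left (prof_pos hr).ne'
  have hle : ∀ r, 0 < r → r * (mult r * |f r|)
      ≤ r * (prof r * ∫ ρ in Ioi 0, ratio r ρ * (|f ρ| * ρ)) := by
    intro r hr
    simpa using mode_abs_le h1 hE' le_rfl hr
  have hnn : 0 ≤ᵐ[volume.restrict (Ioi 0)] fun r =>
      r * (prof r * ∫ ρ in Ioi 0, ratio r ρ * (|f ρ| * ρ)) - r * (mult r * |f r|) :=
    (ae_restrict_iff' measurableSet_Ioi).2 (ae_of_all _ fun r hr => sub_nonneg.2 (hle r hr))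
  have hz : ∫ r in Ioi 0, (r * (prof r * ∫ ρ in Ioi 0, ratio r ρ * (|f ρ| * ρ))
      - r * (mult r * |f r|)) = 0 := by
    rw [integral_sub (integrableOn_pairing h1) (integrableOn_mult_mul_abs h0),
      integral_pairing h1, sub_self]
  have hae := (integral_eq_zero_iff_of_nonneg_ae hnn
    ((integrableOn_pairing h1).sub (integrableOn_mult_mul_abs h0))).1 hz
  have : (ae (volume.restrict (Ioi (0 : ℝ)))).NeBot := by
    rw [ae_neBot]
    intro h
    have := congrArg (fun μ => μ univ) h
    simp at this
  obtain ⟨t, ht, ht0⟩ := (hae.and (ae_restrict_mem measurableSet_Ioi)).exists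
  have ht0 : 0 < t := ht0
  have hp := prof_pos ht0
  have heq : ∫ ρ in Ioi 0, ratio t ρ * (|f ρ| * ρ) = |∫ ρ in Ioi 0, ratio t ρ * (f ρ * ρ)| := by
    have e := congrArg abs (hE t ht0)
    rw [abs_mul, abs_mul, abs_of_pos (mult_pos ht0), abs_of_pos hp] at e
    simp only [Pi.zero_apply] at ht
    rw [e] at ht
    have : t * prof t * ((∫ ρ in Ioi 0, ratio t ρ * (|f ρ| * ρ))
      - |∫ ρ in Ioi 0, ratio t ρ * (f ρ * ρ)|) = 0 := by linear_combination ht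
    exact sub_eq_zero.1 ((mul_eq_zero.1 this).resolve_left (by positivity))
  refine mode_eq_zero_of_ae hE' le_rfl
    (ae_eq_zero_of_integral_ratio_abs_eq_zero hs h1 ?_) hr
  rcases abs_choice (∫ ρ in Ioi 0, ratio t ρ * (f ρ * ρ)) with h | h
  · rw [h] at heq
    have := ae_abs_eq_of_integral_ratio_eq ht0 h1 heq
    refine (integral_congr_ae ?_).trans (hzero s hs hfs)
    filter_upwards [this] with ρ hρ
    rw [hρ]
  · rw [h] at heq
    have := ae_abs_eq_of_integral_ratio_eq (f := fun ρ => -f ρ) ht0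
      (by simpa using h1.neg) (by
        simp only [abs_neg]
        rw [heq, ← integral_neg]
        congr 1; ext ρ; ring)
    have hz0 : ∫ ρ in Ioi 0, -(ratio s ρ * (f ρ * ρ)) = 0 := by
      rw [integral_neg, hzero s hs hfs, neg_zero]
    refine (integral_congr_ae ?_).trans hz0
    filter_upwards [this] with ρ hρ
    rw [abs_neg] at hρ
    rw [hρ]; ring

/-- The first angular modes of elements of the kernel are multiples of `r e^{-r²/4}`. -/
theorem first_mode_eq {f : ℝ → ℝ} (h0 : IntegrableOn f (Ioi 0))
    (h1 : IntegrableOn (fun ρ => f ρ * ρ) (Ioi 0))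
    (hE : ∀ r, 0 < r → mult r * f r = prof r * ∫ ρ in Ioi 0, ratio r ρ * (f ρ * ρ)) :
    ∃ c, ∀ r, 0 < r → f r = c * prof r := by
  refine ⟨f 1 / prof 1, fun r hr => ?_⟩
  set c := f 1 / prof 1 with hc
  have p0 : IntegrableOn prof (Ioi 0) := by simpa using integrableOn_pow_mul_prof 0
  have p1 : IntegrableOn (fun ρ => prof ρ * ρ) (Ioi 0) := by
    simpa [mul_comm] using integrableOn_pow_mul_prof 1
  have g1 : IntegrableOn (fun ρ => (f ρ - c * prof ρ) * ρ) (Ioi 0) := by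
    refine (h1.sub (p1.const_mul c)).congr (ae_of_all _ fun ρ => ?_)
    simp only [Pi.sub_apply]; ring
  have := first_mode_eq_zero (f := fun ρ => f ρ - c * prof ρ) (h0.sub (p0.const_mul c)) g1 ?_
    one_pos ?_ hr
  · linarith
  · intro r hr
    have i1 := integrableOn_ratio_pow_mul h1 1 hr
    have i2 := integrableOn_ratio_pow_mul p1 1 hr
    simp only [pow_one] at i1 i2
    have : ∫ ρ in Ioi 0, ratio r ρ * ((f ρ - c * prof ρ) * ρ)
        = (∫ ρ in Ioi 0, ratio r ρ * (f ρ * ρ)) - c * ∫ ρ in Ioi 0, ratio r ρ * (prof ρ * ρ) := by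
      rw [← integral_const_mul, ← integral_sub i1 (i2.const_mul c)]
      congr 1; ext ρ; ring
    rw [this, integral_ratio_mul_prof hr, mul_sub, mul_sub, hE r hr]
    ring
  · have := (prof_pos one_pos).ne'
    rw [hc, div_mul_cancel₀ _ this, sub_self]

theorem integrable_inv_norm_sub_mul (ζ : ℂ) :
    Integrable (fun z : ℂ => ‖ζ - z‖⁻¹ * (1 + ‖z‖) ^ (-3 : ℝ)) := by
  have hB : Integrable (fun z : ℂ => (1 + ‖z‖) ^ (-3 : ℝ)) :=
    integrable_one_add_norm (by rw [Complex.finrank_real_complex]; norm_num)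
  have hK : Integrable (fun z : ℂ => (Iio (1 : ℝ)).indicator (fun y => y⁻¹) ‖z‖) := by
    rw [integrable_fun_norm_addHaar, Complex.finrank_real_complex]
    have : IntegrableOn (fun _ : ℝ => (1 : ℝ)) (Ioo 0 1) := by simp
    have h2 := (integrable_indicator_iff measurableSet_Ioo).2 this
    refine (h2.integrableOn (s := Ioi 0)).congr_fun (fun y hy => ?_) measurableSet_Ioi
    have hy : 0 < y := hy
    by_cases h : y < 1
    · simp [h, hy, hy.ne']
    · simp [h]
  have hK' := hK.comp_sub_left ζ
  refine (hK'.add hB).mono' ?_ (ae_of_all _ fun z => ?_)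
  · exact Measurable.aestronglyMeasurable (by fun_prop)
  · have h1 : (0 : ℝ) ≤ (1 + ‖z‖) ^ (-3 : ℝ) := by positivity
    have h2 : (1 + ‖z‖) ^ (-3 : ℝ) ≤ 1 :=
      Real.rpow_le_one_of_one_le_of_nonpos (by linarith [norm_nonneg z]) (by norm_num)
    have h3 : 0 ≤ ‖ζ - z‖⁻¹ := by positivity
    rw [Real.norm_of_nonneg (by positivity)]
    change _ ≤ (Iio (1 : ℝ)).indicator (fun y => y⁻¹) ‖ζ - z‖ + (1 + ‖z‖) ^ (-3 : ℝ)
    by_cases h : ‖ζ - z‖ < 1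
    · rw [indicator_of_mem (by exact h)]
      nlinarith
    · rw [indicator_of_notMem (by exact h)]
      have : ‖ζ - z‖⁻¹ ≤ 1 := inv_le_one_of_one_le₀ (not_lt.1 h)
      nlinarith

theorem integrableOn_polarCoord_symm {f : ℂ → ℝ} (hf : Integrable f) (hm : Measurable f) :
    IntegrableOn (fun p : ℝ × ℝ => p.1 * f (Complex.polarCoord.symm p)) polarCoord.target := by
  have hc : Measurable (fun p : ℝ × ℝ => f (Complex.polarCoord.symm p)) := by
    refine hm.comp (g := f) (f := fun p => Complex.polarCoord.symm p) ?_
    simp only [Complex.polarCoord_symm_apply]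
    fun_prop
  refine ⟨(measurable_fst.mul hc).aestronglyMeasurable, ?_⟩
  have h := hf.2
  unfold HasFiniteIntegral at h ⊢
  rw [← Complex.lintegral_comp_polarCoord_symm] at h
  refine lt_of_le_of_lt (lintegral_mono_ae ?_) h
  filter_upwards [ae_restrict_mem polarCoord.open_target.measurableSet] with p hp
  have hp : 0 < p.1 := hp.1
  rw [enorm_mul, smul_eq_mul, Real.enorm_of_nonneg hp.le]

/-- The parameter domain of polar coordinates. -/
def polarDom : Set (ℝ × ℝ) := Ioi 0 ×ˢ Ioo (-π) π

theorem measurableSet_polarDom : MeasurableSet polarDom :=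
  measurableSet_Ioi.prod measurableSet_Ioo

theorem volume_restrict_polarDom : (volume : Measure (ℝ × ℝ)).restrict polarDom
    = (volume.restrict (Ioi 0)).prod (volume.restrict (Ioo (-π) π)) := by
  rw [polarDom, Measure.prod_restrict, Measure.volume_eq_prod]

theorem measurable_angKer (r : ℝ) : Measurable (fun p : ℝ × ℝ => angKer r p.1 p.2) := by
  unfold angKer; fun_prop

theorem angKer_eq (r : ℝ) (p : ℝ × ℝ) :
    angKer r p.1 p.2 = (r * Complex.polarCoord.symm p).im
      / ‖(r : ℂ) - Complex.polarCoord.symm p‖ ^ 2 := by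
  rw [Complex.sq_norm, Complex.normSq_apply, Complex.polarCoord_symm_apply,
    angKer]
  simp only [Complex.mul_re, Complex.mul_im, Complex.add_re, Complex.add_im,
    Complex.sub_re, Complex.sub_im, Complex.ofReal_re, Complex.ofReal_im, Complex.I_re,
    Complex.I_im]
  congr 1
  · ring
  · linear_combination (p.1 ^ 2) * (- Real.sin_sq_add_cos_sq p.2)

theorem abs_im_div_sq_le (r : ℝ) (z : ℂ) :
    |((r : ℂ) * z).im / ‖(r : ℂ) - z‖ ^ 2| ≤ |r| * ‖(r : ℂ) - z‖⁻¹ := by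
  rcases eq_or_ne ‖(r : ℂ) - z‖ 0 with h | h
  · simp [h]
  · have h1 : ((r : ℂ) * z).im = r * (z - r).im := by simp
    have h2 := Complex.abs_im_le_norm (z - r)
    rw [norm_sub_rev] at h2
    rw [h1, abs_div, abs_mul, abs_pow, abs_norm, div_le_iff₀ (by positivity)]
    calc |r| * |(z - r).im| ≤ |r| * ‖(r : ℂ) - z‖ := by gcongr
      _ = _ := by field_simp

theorem integrableOn_angKer_mul {E : Type*} [NormedAddCommGroup E] [NormedSpace ℝ E] (r C : ℝ)
    {g : ℝ × ℝ → E} (hg : AEStronglyMeasurable g (volume.restrict polarDom))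
    (hb : ∀ p ∈ polarDom, ‖g p‖ ≤ C * (1 + p.1) ^ (-3 : ℝ)) :
    IntegrableOn (fun p => (p.1 * angKer r p.1 p.2) • g p) polarDom := by
  have h := integrableOn_polarCoord_symm
    ((integrable_inv_norm_sub_mul (r : ℂ)).const_mul (|r| * C)) (by fun_prop)
  refine Integrable.mono' h ?_ ?_
  · exact (measurable_fst.mul (measurable_angKer r)).aestronglyMeasurable.smul hg
  · filter_upwards [ae_restrict_mem measurableSet_polarDom] with p hp
    have hp1 : 0 < p.1 := hp.1
    have e : ‖Complex.polarCoord.symm p‖ = p.1 := by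
      rw [Complex.norm_polarCoord_symm, abs_of_pos hp1]
    rw [norm_smul, norm_mul, Real.norm_of_nonneg hp1.le, Real.norm_eq_abs, angKer_eq, e]
    have h1 := abs_im_div_sq_le r (Complex.polarCoord.symm p)
    calc _ ≤ p.1 * (|r| * ‖(r : ℂ) - Complex.polarCoord.symm p‖⁻¹)
          * (C * (1 + p.1) ^ (-3 : ℝ)) := by gcongr; exact hb p hp
      _ = _ := by ring

theorem integral_polarDom_eq {E : Type*} [NormedAddCommGroup E] [NormedSpace ℝ E] (r C : ℝ)
    {g : ℝ × ℝ → E} (hg : AEStronglyMeasurable g (volume.restrict polarDom))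
    (hb : ∀ p ∈ polarDom, ‖g p‖ ≤ C * (1 + p.1) ^ (-3 : ℝ)) :
    ∫ p in polarDom, (p.1 * angKer r p.1 p.2) • g p
      = ∫ ρ in Ioi 0, ρ • ∫ α in (-π)..π, angKer r ρ α • g (ρ, α) := by
  have hi := integrableOn_angKer_mul r C hg hb
  rw [IntegrableOn, volume_restrict_polarDom] at hi
  rw [volume_restrict_polarDom, integral_prod _ hi]
  congr 1; ext ρ
  rw [intervalIntegral.integral_of_le (by linarith [Real.pi_pos]), integral_Ioc_eq_integral_Ioo,
    ← integral_smul]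
  simp only [mul_smul]

theorem ae_ne_restrict_Ioi (r : ℝ) : ∀ᵐ ρ ∂(volume.restrict (Ioi (0 : ℝ))), r ≠ ρ := by
  refine ae_restrict_of_ae ?_
  have : (volume : Measure ℝ) {r} = 0 := by simp
  filter_upwards [compl_mem_ae_iff.2 this] with ρ h heq
  exact h heq.symm

/-- The `n`-th (unnormalized) angular Fourier mode of a function in polar coordinates. -/
def angMode (P : ℝ → ℝ → ℝ) (n : ℤ) (r : ℝ) : ℂ :=
  ∫ θ in (-π)..π, Complex.exp (-(n * θ * Complex.I)) * P r θ

theorem integral_angKer {r ρ : ℝ} (hr : 0 < r) (hρ : 0 < ρ) (h : r ≠ ρ) :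
    ∫ α in (-π)..π, angKer r ρ α = 0 := by
  have := integral_angKer_mul_exp hr hρ h 0
  simp only [Nat.cast_zero, zero_mul, Complex.exp_zero, mul_one, if_true] at this
  rw [intervalIntegral.integral_ofReal] at this
  exact_mod_cast this

section Modes

variable {P : ℝ → ℝ → ℝ} {C : ℝ} (hP : Continuous (Function.uncurry P))
  (hper : ∀ ρ, Function.Periodic (P ρ) (2 * π))
  (hdec : ∀ ρ, 0 ≤ ρ → ∀ θ, |P ρ θ| ≤ C * (1 + ρ) ^ (-3 : ℝ))

include hP in
theorem continuous_angMode (n : ℤ) : Continuous (angMode P n) := by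
  unfold angMode
  apply intervalIntegral.continuous_parametric_intervalIntegral_of_continuous'
  have : Continuous fun p : ℝ × ℝ => P p.1 p.2 := hP
  simp only [Function.uncurry_def]
  fun_prop

include hdec in
theorem norm_angMode_le (n : ℤ) {ρ : ℝ} (hρ : 0 ≤ ρ) :
    ‖angMode P n ρ‖ ≤ (2 * π * C) * (1 + ρ) ^ (-3 : ℝ) := by
  have := intervalIntegral.norm_integral_le_of_norm_le_const (a := -π) (b := π)
    (f := fun θ : ℝ => Complex.exp (-(n * θ * Complex.I)) * P ρ θ)
    (C := C * (1 + ρ) ^ (-3 : ℝ)) fun θ _ => by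
      have h := Complex.norm_exp_ofReal_mul_I (-(n * θ))
      push_cast at h
      rw [norm_mul, ← neg_mul, h, one_mul, Complex.norm_real]
      exact hdec ρ hρ θ
  refine this.trans (le_of_eq ?_)
  rw [abs_of_pos (by linarith [Real.pi_pos])]; ring

include hP hdec in
theorem integrableOn_angMode (n : ℤ) : IntegrableOn (angMode P n) (Ioi 0) := by
  have h : IntegrableOn (fun x : ℝ => (2 * π * C) * (1 + ‖x‖) ^ (-3 : ℝ)) (Ioi 0) :=
    ((integrable_one_add_norm (by simp)).const_mul _).integrableOn
  refine Integrable.mono' h (continuous_angMode hP n).aestronglyMeasurable ?_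
  filter_upwards [ae_restrict_mem measurableSet_Ioi] with ρ hρ
  have hρ : 0 < ρ := hρ
  rw [Real.norm_of_nonneg hρ.le]
  exact norm_angMode_le hdec n hρ.le

include hP hdec in
theorem integrableOn_angMode_mul_self (n : ℤ) :
    IntegrableOn (fun ρ => angMode P n ρ * ρ) (Ioi 0) := by
  have h : IntegrableOn (fun x : ℝ => (2 * π * C) * (1 + ‖x‖) ^ (-2 : ℝ)) (Ioi 0) :=
    ((integrable_one_add_norm (by simp)).const_mul _).integrableOn
  have hC : 0 ≤ C := by simpa using (abs_nonneg _).trans (hdec 0 le_rfl 0)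
  refine Integrable.mono' h
    ((continuous_angMode hP n).mul Complex.continuous_ofReal).aestronglyMeasurable ?_
  filter_upwards [ae_restrict_mem measurableSet_Ioi] with ρ hρ
  have hρ : 0 < ρ := hρ
  rw [norm_mul, Complex.norm_real, Real.norm_of_nonneg hρ.le]
  have h3 : (1 + ρ) ^ (-2 : ℝ) = (1 + ρ) ^ (-3 : ℝ) * (1 + ρ) := by
    rw [← Real.rpow_add_one (by positivity)]; norm_num
  have hpi := Real.pi_pos
  calc _ ≤ ((2 * π * C) * (1 + ρ) ^ (-3 : ℝ)) * (1 + ρ) := by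
        gcongr
        · exact norm_angMode_le hdec n hρ.le
        · linarith
    _ = _ := by rw [h3]; ring

include hper in
theorem integral_exp_mul_shift (n : ℤ) (ρ α : ℝ) :
    ∫ θ in (-π)..π, Complex.exp (-(n * θ * Complex.I)) * P ρ (θ + α)
      = Complex.exp (n * α * Complex.I) * angMode P n ρ := by
  have h1 : ∀ θ : ℝ, Complex.exp (-(n * θ * Complex.I)) * P ρ (θ + α)
      = Complex.exp (n * α * Complex.I) *
        (Complex.exp (-(n * (θ + α : ℝ) * Complex.I)) * P ρ (θ + α)) := by
    intro θ
    rw [← mul_assoc, ← Complex.exp_add]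
    congr 2; push_cast; ring
  simp_rw [h1]
  rw [intervalIntegral.integral_const_mul, angMode]
  congr 1
  rw [intervalIntegral.integral_comp_add_right
    (fun θ : ℝ => Complex.exp (-(n * θ * Complex.I)) * P ρ θ)]
  have hp : Function.Periodic
      (fun θ : ℝ => Complex.exp (-(n * θ * Complex.I)) * P ρ θ) (2 * π) := by
    intro θ
    simp only [hper ρ θ]
    congr 1
    rw [Complex.exp_eq_exp_iff_exists_int]
    exact ⟨-n, by push_cast; ring⟩
  have := hp.intervalIntegral_add_eq (-π + α) (-π)
  convert this using 2 <;> ring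

include hP hper hdec in
theorem integral_exp_mul_kernel {r : ℝ} (hr : 0 < r) {n : ℕ} (hn : 1 ≤ n) :
    ∫ θ in (-π)..π, Complex.exp (-((n : ℤ) * θ * Complex.I)) *
        ((∫ p in polarDom, (p.1 * angKer r p.1 p.2) • P p.1 (θ + p.2) : ℝ) : ℂ)
      = π * Complex.I * ∫ ρ in Ioi 0, (ratio r ρ : ℂ) ^ n * (angMode P n ρ * ρ) := by
  have hP' : Continuous fun p : ℝ × ℝ => P p.1 p.2 := hP
  have h_int : Integrable (fun q : ℝ × (ℝ × ℝ) => (q.2.1 * angKer r q.2.1 q.2.2) •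
      (Complex.exp (-((n : ℤ) * q.1 * Complex.I)) * P q.2.1 (q.1 + q.2.2)))
      ((volume.restrict (Ioc (-π) π)).prod (volume.restrict polarDom)) := by
    have hd : IntegrableOn (fun p : ℝ × ℝ => (p.1 * angKer r p.1 p.2) • (C * (1 + p.1) ^ (-3 : ℝ)))
        polarDom := by
      have hm : Measurable fun p : ℝ × ℝ => C * (1 + p.1) ^ (-3 : ℝ) := by fun_prop
      refine integrableOn_angKer_mul r |C| hm.aestronglyMeasurable fun p hp => ?_
      have hp1 : 0 < p.1 := hp.1
      rw [norm_mul, Real.norm_eq_abs, Real.norm_of_nonneg (by positivity)]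
    have hd' := hd.comp_snd (volume.restrict (Ioc (-π) π))
    refine Integrable.mono hd' ?_ ?_
    · refine AEStronglyMeasurable.smul (f := fun q : ℝ × (ℝ × ℝ) => q.2.1 * angKer r q.2.1 q.2.2)
        (g := fun q : ℝ × (ℝ × ℝ) =>
          Complex.exp (-((n : ℤ) * q.1 * Complex.I)) * P q.2.1 (q.1 + q.2.2)) ?_ ?_
      · exact (((measurable_fst.mul (measurable_angKer r)).comp
          measurable_snd)).aestronglyMeasurable
      · apply Continuous.aestronglyMeasurable
        have : Continuous fun q : ℝ × (ℝ × ℝ) => P q.2.1 (q.1 + q.2.2) :=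
          hP'.comp (f := fun q : ℝ × (ℝ × ℝ) => (q.2.1, q.1 + q.2.2)) (by fun_prop)
        fun_prop
    · have hmem : ∀ᵐ q ∂((volume.restrict (Ioc (-π) π)).prod (volume.restrict polarDom)),
          q.2 ∈ polarDom :=
        Measure.quasiMeasurePreserving_snd.ae (ae_restrict_mem measurableSet_polarDom)
      filter_upwards [hmem] with q hq
      have hq1 : 0 < q.2.1 := hq.1
      have h := Complex.norm_exp_ofReal_mul_I (-(n * q.1))
      push_cast at h
      have h2 := hdec q.2.1 hq1.le (q.1 + q.2.2)
      rw [norm_smul, norm_smul, norm_mul (Complex.exp _), ← neg_mul, Int.cast_natCast, h, one_mul,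
        Complex.norm_real]
      gcongr
      exact h2.trans (le_abs_self _)
  have hswap := integral_integral_swap (f := fun (θ : ℝ) (p : ℝ × ℝ) => (p.1 * angKer r p.1 p.2) •
      (Complex.exp (-((n : ℤ) * θ * Complex.I)) * P p.1 (θ + p.2))) h_int
  have hle : -π ≤ π := by linarith [Real.pi_pos]
  have e1 : ∀ θ : ℝ, Complex.exp (-((n : ℤ) * θ * Complex.I)) *
        ((∫ p in polarDom, (p.1 * angKer r p.1 p.2) • P p.1 (θ + p.2) : ℝ) : ℂ)
      = ∫ p in polarDom, (p.1 * angKer r p.1 p.2) •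
      (Complex.exp (-((n : ℤ) * θ * Complex.I)) * P p.1 (θ + p.2)) := by
    intro θ
    rw [← integral_complex_ofReal, ← integral_const_mul]
    congr 1; ext p
    simp only [smul_eq_mul, Complex.real_smul]; push_cast; ring
  simp_rw [e1]
  rw [intervalIntegral.integral_of_le hle]
  refine hswap.trans ?_
  have e2 : ∀ p : ℝ × ℝ, ∫ θ in Ioc (-π) π, (p.1 * angKer r p.1 p.2) •
      (Complex.exp (-((n : ℤ) * θ * Complex.I)) * P p.1 (θ + p.2))
      = (p.1 * angKer r p.1 p.2) • (Complex.exp ((n : ℤ) * p.2 * Complex.I) * angMode P n p.1) := by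
    intro p
    rw [integral_smul, ← intervalIntegral.integral_of_le hle, integral_exp_mul_shift hper]
  simp_rw [e2]
  have hc := continuous_angMode hP n
  rw [integral_polarDom_eq r (2 * π * C)
    (g := fun p => Complex.exp ((n : ℤ) * p.2 * Complex.I) * angMode P n p.1)]
  · rw [← integral_const_mul]
    refine integral_congr_ae ?_
    filter_upwards [ae_restrict_mem measurableSet_Ioi, ae_ne_restrict_Ioi r] with ρ hρ hne
    have hk := integral_angKer_mul_exp hr hρ hne n
    rw [if_neg (by omega)] at hk
    have : ∀ α : ℝ, angKer r ρ α • (Complex.exp ((n : ℤ) * α * Complex.I) * angMode P n ρ)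
        = ((angKer r ρ α : ℂ) * Complex.exp (n * α * Complex.I)) * angMode P n ρ := by
      intro α
      rw [Complex.real_smul, Int.cast_natCast]; ring
    simp_rw [this]
    rw [intervalIntegral.integral_mul_const, hk, Complex.real_smul]
    ring
  · apply Continuous.aestronglyMeasurable; fun_prop
  · intro p hp
    have hp1 : 0 < p.1 := hp.1
    have h := Complex.norm_exp_ofReal_mul_I (n * p.2)
    push_cast at h
    rw [norm_mul, Int.cast_natCast, h, one_mul]
    exact norm_angMode_le hdec n hp1.le

end Modes

section Kernel

variable {P D : ℝ → ℝ → ℝ} {C : ℝ} (hP : Continuous (Function.uncurry P))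
  (hper : ∀ ρ, Function.Periodic (P ρ) (2 * π))
  (hdec : ∀ ρ, 0 ≤ ρ → ∀ θ, |P ρ θ| ≤ C * (1 + ρ) ^ (-3 : ℝ))

include hper in
theorem integral_exp_mul_deriv (hD : ∀ r θ, HasDerivAt (P r) (D r θ) θ)
    (hDc : ∀ r, Continuous (D r)) (n : ℤ) (r : ℝ) :
    ∫ θ in (-π)..π, Complex.exp (-(n * θ * Complex.I)) * D r θ
      = n * Complex.I * angMode P n r := by
  have hexp : ∀ θ : ℝ, HasDerivAt (fun θ : ℝ => Complex.exp (-(n * θ * Complex.I)))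
      (-(n * Complex.I) * Complex.exp (-(n * θ * Complex.I))) θ := by
    intro θ
    have h1 : HasDerivAt (fun θ : ℝ => -((n : ℂ) * θ * Complex.I)) (-(n * 1 * Complex.I)) θ :=
      (((hasDerivAt_id θ).ofReal_comp.const_mul (n : ℂ)).mul_const Complex.I).neg
    convert! h1.cexp using 1
    ring
  have := intervalIntegral.integral_mul_deriv_eq_deriv_mul (a := -π) (b := π)
    (fun θ _ => hexp θ) (fun θ _ => (hD r θ).ofReal_comp)
    (Continuous.intervalIntegrable (by fun_prop) _ _)
    (Continuous.intervalIntegrable (Complex.continuous_ofReal.comp (hDc r)) _ _)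
  rw [this, angMode]
  have hb : Complex.exp (-(n * (π : ℝ) * Complex.I)) * (P r π : ℂ)
      = Complex.exp (-(n * ((-π : ℝ) : ℂ) * Complex.I)) * (P r (-π) : ℂ) := by
    have h1 : P r π = P r (-π) := by
      rw [← hper r (-π)]; congr 1; ring
    rw [h1]
    congr 1
    rw [Complex.exp_eq_exp_iff_exists_int]
    exact ⟨-n, by push_cast; ring⟩
  rw [hb, sub_self, zero_sub, ← intervalIntegral.integral_const_mul,
    ← intervalIntegral.integral_neg]
  congr 1; ext θ; ring

include hP hper hdec in
theorem angMode_equation (hD : ∀ r θ, HasDerivAt (P r) (D r θ) θ)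
    (hDc : ∀ r, Continuous (D r))
    (heq : ∀ r, 0 < r → ∀ θ, mult r * D r θ
      = prof r / π * ∫ p in polarDom, (p.1 * angKer r p.1 p.2) • P p.1 (θ + p.2))
    {n : ℕ} (hn : 1 ≤ n) {r : ℝ} (hr : 0 < r) :
    (n : ℂ) * mult r * angMode P n r
      = prof r * ∫ ρ in Ioi 0, (ratio r ρ : ℂ) ^ n * (angMode P n ρ * ρ) := by
  have h1 := integral_exp_mul_deriv hper hD hDc n r
  have h2 := integral_exp_mul_kernel hP hper hdec hr hn
  have h3 : (mult r : ℂ) * ∫ θ in (-π)..π, Complex.exp (-((n : ℤ) * θ * Complex.I)) * D r θ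
      = (prof r / π : ℝ) * ∫ θ in (-π)..π, Complex.exp (-((n : ℤ) * θ * Complex.I)) *
        ((∫ p in polarDom, (p.1 * angKer r p.1 p.2) • P p.1 (θ + p.2) : ℝ) : ℂ) := by
    rw [← intervalIntegral.integral_const_mul, ← intervalIntegral.integral_const_mul]
    congr 1; ext θ
    have := congrArg (fun x : ℝ => (x : ℂ)) (heq r hr θ)
    simp only [Complex.ofReal_mul] at this
    linear_combination Complex.exp (-((n : ℤ) * θ * Complex.I)) * this
  rw [h1, h2] at h3
  have hpi : (π : ℂ) ≠ 0 := by exact_mod_cast Real.pi_ne_zero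
  push_cast at h3
  have hI : Complex.I ≠ 0 := Complex.I_ne_zero
  generalize (∫ ρ in Ioi 0, (ratio r ρ : ℂ) ^ n * (angMode P n ρ * ρ)) = J at h3 ⊢
  field_simp at h3
  linear_combination h3

include hP hdec in
theorem integral_ratio_pow_mul_angMode_re (n : ℕ) {r : ℝ} (hr : 0 < r) :
    (∫ ρ in Ioi 0, (ratio r ρ : ℂ) ^ n * (angMode P n ρ * ρ)).re
        = ∫ ρ in Ioi 0, ratio r ρ ^ n * ((angMode P n ρ).re * ρ) ∧
      (∫ ρ in Ioi 0, (ratio r ρ : ℂ) ^ n * (angMode P n ρ * ρ)).im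
        = ∫ ρ in Ioi 0, ratio r ρ ^ n * ((angMode P n ρ).im * ρ) := by
  have hi : Integrable (fun ρ => (ratio r ρ : ℂ) ^ n * (angMode P n ρ * ρ))
      (volume.restrict (Ioi 0)) := by
    refine Integrable.bdd_mul (c := 1) (integrableOn_angMode_mul_self hP hdec n) ?_ ?_
    · exact ((Complex.measurable_ofReal.comp (measurable_ratio.comp
        (measurable_const.prodMk measurable_id))).pow_const n).aestronglyMeasurable
    · refine (ae_restrict_iff' measurableSet_Ioi).2 (ae_of_all _ fun ρ hρ => ?_)
      have h := ratio_nonneg hr hρ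
      rw [norm_pow, Complex.norm_real, Real.norm_of_nonneg h]
      exact pow_le_one₀ h (ratio_le_one hr)
  constructor
  · rw [← Complex.reCLM_apply, ← Complex.reCLM.integral_comp_comm hi]
    congr 1; ext ρ
    rw [Complex.reCLM_apply, ← Complex.ofReal_pow, Complex.re_ofReal_mul, Complex.re_mul_ofReal]
  · rw [← Complex.imCLM_apply, ← Complex.imCLM.integral_comp_comm hi]
    congr 1; ext ρ
    rw [Complex.imCLM_apply, ← Complex.ofReal_pow, Complex.im_ofReal_mul, Complex.im_mul_ofReal]

theorem angMode_neg (n : ℤ) (r : ℝ) : angMode P (-n) r = (starRingEnd ℂ) (angMode P n r) := by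
  rw [angMode, angMode, ← intervalIntegral.intervalIntegral_conj]
  congr 1; ext θ
  rw [map_mul, Complex.conj_ofReal, ← Complex.exp_conj]
  simp

include hP hper in
theorem fourier_reconstruction {r : ℝ} (hz : ∀ n : ℕ, 2 ≤ n → angMode P n r = 0) (θ : ℝ) :
    2 * π * P r θ = (angMode P 0 r).re
      + 2 * (angMode P 1 r * Complex.exp (θ * Complex.I)).re := by
  have : Fact (0 < 2 * π) := ⟨Real.two_pi_pos⟩
  have hPr : Continuous (P r) := hP.comp (f := fun θ => (r, θ)) (by fun_prop)
  have hp : Function.Periodic (fun θ => (P r θ : ℂ)) (2 * π) := fun θ => by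
    simp only [hper r θ]
  let f : C(AddCircle (2 * π), ℂ) := ⟨hp.lift, by
    apply continuous_coinduced_dom.mpr
    exact Complex.continuous_ofReal.comp hPr⟩
  have hf : ∀ x : ℝ, f x = P r x := fun x => rfl
  have hc : ∀ n : ℤ, fourierCoeff f n = (1 / (2 * π) : ℝ) • angMode P n r := by
    intro n
    rw [fourierCoeff_eq_intervalIntegral f n (-π), angMode, show -π + 2 * π = π by ring]
    congr 1
    congr 1; ext x
    rw [hf, fourier_coe_apply, smul_eq_mul]
    congr 2
    have hpi : (π : ℂ) ≠ 0 := by exact_mod_cast Real.pi_ne_zero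
    push_cast; field_simp
  have hz' : ∀ n : ℤ, n ∉ ({-1, 0, 1} : Finset ℤ) → fourierCoeff f n = 0 := by
    intro n hn
    simp only [Finset.mem_insert, Finset.mem_singleton, not_or] at hn
    rw [hc]
    obtain ⟨m, rfl | rfl⟩ := n.eq_nat_or_neg
    · rw [hz m (by omega), smul_zero]
    · rw [angMode_neg, hz m (by omega), map_zero, smul_zero]
  have hs := has_pointwise_sum_fourier_series_of_summable
    (summable_of_ne_finset_zero hz') (θ : AddCircle (2 * π))
  have hs' := hs.unique (hasSum_sum_of_ne_finset_zero (s := {-1, 0, 1})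
    fun n hn => by rw [hz' n hn, zero_smul])
  rw [hf] at hs'
  have hpi : (π : ℂ) ≠ 0 := by exact_mod_cast Real.pi_ne_zero
  have e0 : angMode P (-1) r = _ := angMode_neg 1 r
  have e1 : ∀ n : ℤ, fourier n (θ : AddCircle (2 * π)) = Complex.exp (n * θ * Complex.I) := by
    intro n
    rw [fourier_coe_apply]; congr 1; push_cast; field_simp
  have e2 : Complex.exp (-(θ * Complex.I)) = (starRingEnd ℂ) (Complex.exp (θ * Complex.I)) := by
    rw [← Complex.exp_conj]; simp
  rw [Finset.sum_insert (by simp), Finset.sum_insert (by simp), Finset.sum_singleton, hc, hc, hc,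
    e0, e1, e1, e1] at hs'
  have := congrArg Complex.re hs'
  simp only [Int.cast_neg, Int.cast_one, Int.cast_zero, neg_mul, one_mul, zero_mul,
    Complex.exp_zero, e2] at this
  simp only [Complex.ofReal_re, Complex.add_re, Complex.real_smul, smul_eq_mul, Complex.mul_re,
    Complex.mul_im, Complex.ofReal_im, Complex.conj_re, Complex.conj_im, Complex.one_re,
    Complex.one_im] at this
  rw [this, Complex.mul_re]
  have := Real.pi_ne_zero
  field_simp
  ring

include hP hper hdec in
/-- A solution of the kernel equation is radial up to a first mode with profile `r e^{-r²/4}`. -/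
theorem exists_eq_radial_add_first_mode (hD : ∀ r θ, HasDerivAt (P r) (D r θ) θ)
    (hDc : ∀ r, Continuous (D r))
    (heq : ∀ r, 0 < r → ∀ θ, mult r * D r θ
      = prof r / π * ∫ p in polarDom, (p.1 * angKer r p.1 p.2) • P p.1 (θ + p.2)) :
    ∃ (A : ℝ → ℝ) (c d : ℝ), ∀ r, 0 < r → ∀ θ,
      P r θ = A r + (c * Real.cos θ + d * Real.sin θ) * prof r := by
  have hE := fun {n : ℕ} (hn : 1 ≤ n) {r : ℝ} (hr : 0 < r) =>
    angMode_equation hP hper hdec hD hDc heq hn hr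
  have hre : ∀ {n : ℕ}, 1 ≤ n → ∀ r, 0 < r → n * mult r * (angMode P n r).re
      = prof r * ∫ ρ in Ioi 0, ratio r ρ ^ n * ((angMode P n ρ).re * ρ) := by
    intro n hn r hr
    have := congrArg Complex.re (hE hn hr)
    rw [Complex.re_ofReal_mul, (integral_ratio_pow_mul_angMode_re hP hdec n hr).1] at this
    rw [← this, ← Complex.ofReal_natCast, ← Complex.ofReal_mul, Complex.re_ofReal_mul]
  have him : ∀ {n : ℕ}, 1 ≤ n → ∀ r, 0 < r → n * mult r * (angMode P n r).im
      = prof r * ∫ ρ in Ioi 0, ratio r ρ ^ n * ((angMode P n ρ).im * ρ) := by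
    intro n hn r hr
    have := congrArg Complex.im (hE hn hr)
    rw [Complex.im_ofReal_mul, (integral_ratio_pow_mul_angMode_re hP hdec n hr).2] at this
    rw [← this, ← Complex.ofReal_natCast, ← Complex.ofReal_mul, Complex.im_ofReal_mul]
  have i0 : ∀ n : ℤ, IntegrableOn (fun ρ => (angMode P n ρ).re) (Ioi 0) ∧
      IntegrableOn (fun ρ => (angMode P n ρ).im) (Ioi 0) := fun n =>
    ⟨(integrableOn_angMode hP hdec n).re, (integrableOn_angMode hP hdec n).im⟩
  have i1 : ∀ n : ℤ, IntegrableOn (fun ρ => (angMode P n ρ).re * ρ) (Ioi 0) ∧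
      IntegrableOn (fun ρ => (angMode P n ρ).im * ρ) (Ioi 0) := by
    intro n
    have h := integrableOn_angMode_mul_self hP hdec n
    refine ⟨h.re.congr (ae_of_all _ fun ρ => ?_), h.im.congr (ae_of_all _ fun ρ => ?_)⟩
    · exact Complex.re_mul_ofReal _ _
    · exact Complex.im_mul_ofReal _ _
  have hz : ∀ r, 0 < r → ∀ n : ℕ, 2 ≤ n → angMode P n r = 0 := by
    intro r hr n hn
    apply Complex.ext
    · exact mode_eq_zero (i0 n).1 (i1 n).1 (hre (by omega)) hn hr
    · exact mode_eq_zero (i0 n).2 (i1 n).2 (him (by omega)) hn hr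
  obtain ⟨a, ha⟩ := first_mode_eq (i0 1).1 (i1 1).1 (by simpa using hre le_rfl)
  obtain ⟨b, hb⟩ := first_mode_eq (i0 1).2 (i1 1).2 (by simpa using him le_rfl)
  refine ⟨fun r => (angMode P 0 r).re / (2 * π), a / π, -b / π, fun r hr θ => ?_⟩
  have h := fourier_reconstruction hP hper (hz r hr) θ
  rw [Complex.mul_re, Complex.exp_ofReal_mul_I_re, Complex.exp_ofReal_mul_I_im, ha r hr,
    hb r hr] at h
  have hpi := Real.pi_ne_zero
  field_simp
  linear_combination h

include hP hdec in
/-- A radial function plus a first mode with profile `r e^{-r²/4}` solves the kernel equation. -/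
theorem integral_kernel_of_radial_add_first_mode {A : ℝ → ℝ} {c d : ℝ}
    (h : ∀ r, 0 < r → ∀ θ, P r θ = A r + (c * Real.cos θ + d * Real.sin θ) * prof r)
    {r : ℝ} (hr : 0 < r) (θ : ℝ) :
    ∫ p in polarDom, (p.1 * angKer r p.1 p.2) • P p.1 (θ + p.2)
      = π * mult r * (d * Real.cos θ - c * Real.sin θ) := by
  have hP' : Continuous fun p : ℝ × ℝ => P p.1 p.2 := hP
  have hc : Continuous fun p : ℝ × ℝ => P p.1 (θ + p.2) :=
    hP'.comp (f := fun p : ℝ × ℝ => (p.1, θ + p.2)) (by fun_prop)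
  rw [integral_polarDom_eq r C (g := fun p => P p.1 (θ + p.2)) hc.aestronglyMeasurable
    fun p hp => hdec p.1 (le_of_lt hp.1) _]
  have hin : ∀ᵐ ρ ∂(volume.restrict (Ioi (0 : ℝ))),
      ρ • ∫ α in (-π)..π, angKer r ρ α • P ρ (θ + α)
        = π * (d * Real.cos θ - c * Real.sin θ) * (ratio r ρ * (prof ρ * ρ)) := by
    filter_upwards [ae_restrict_mem measurableSet_Ioi, ae_ne_restrict_Ioi r] with ρ hρ hne
    have hρ : 0 < ρ := hρ
    have k0 := integral_angKer hr hρ hne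
    have k1 := integral_angKer_mul_exp hr hρ hne 1
    have hcont : Continuous (angKer r ρ) := by
      unfold angKer
      refine Continuous.div (by fun_prop) (by fun_prop) fun α => ?_
      have h1 := Real.cos_le_one α
      have h2 : 0 < (r - ρ) ^ 2 := by
        have := sub_ne_zero.2 hne
        positivity
      have h3 : 0 < r * ρ := mul_pos hr hρ
      nlinarith
    have hii : IntervalIntegrable (fun α : ℝ => (angKer r ρ α : ℂ)
        * Complex.exp ((1 : ℕ) * α * Complex.I)) volume (-π) π :=
      Continuous.intervalIntegrable (by fun_prop) _ _
    rw [if_neg one_ne_zero, pow_one] at k1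
    have e : ∀ α : ℝ, angKer r ρ α • P ρ (θ + α)
        = A ρ * angKer r ρ α + prof ρ * (((c - d * Complex.I) * Complex.exp (θ * Complex.I)) *
          ((angKer r ρ α : ℂ) * Complex.exp ((1 : ℕ) * α * Complex.I))).re := by
      intro α
      have : ((c - d * Complex.I) * Complex.exp (θ * Complex.I)) *
          ((angKer r ρ α : ℂ) * Complex.exp ((1 : ℕ) * α * Complex.I))
          = angKer r ρ α * ((c - d * Complex.I) * Complex.exp ((θ + α : ℝ) * Complex.I)) := by
        push_cast
        rw [add_mul, Complex.exp_add, one_mul]; ring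
      rw [this, Complex.re_ofReal_mul, Complex.mul_re, Complex.exp_ofReal_mul_I_re,
        Complex.exp_ofReal_mul_I_im, h ρ hρ, smul_eq_mul]
      simp
      ring
    simp_rw [e]
    have hre : ∫ α in (-π)..π, (((c - d * Complex.I) * Complex.exp (θ * Complex.I)) *
          ((angKer r ρ α : ℂ) * Complex.exp ((1 : ℕ) * α * Complex.I))).re
        = (((c - d * Complex.I) * Complex.exp (θ * Complex.I)) * (π * Complex.I * ratio r ρ)).re := by
      rw [← k1, ← intervalIntegral.integral_const_mul, ← Complex.reCLM_apply,
        ← Complex.reCLM.intervalIntegral_comp_comm (hii.const_mul _)]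
      rfl
    rw [intervalIntegral.integral_add, intervalIntegral.integral_const_mul,
      intervalIntegral.integral_const_mul, k0, hre]
    · simp only [Complex.mul_re, Complex.mul_im, Complex.exp_ofReal_mul_I_re,
        Complex.exp_ofReal_mul_I_im, Complex.sub_re, Complex.sub_im, Complex.ofReal_re,
        Complex.ofReal_im, Complex.I_re, Complex.I_im, smul_eq_mul]
      ring
    · exact Continuous.intervalIntegrable (by fun_prop) _ _
    · exact Continuous.intervalIntegrable (by fun_prop) _ _
  rw [integral_congr_ae hin, integral_const_mul, integral_ratio_mul_prof hr]
  ring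

end Kernel

/-- The standard identification of `ℂ` with the Euclidean plane. -/
def toR2 : ℂ ≃ₗᵢ[ℝ] R2 := Complex.orthonormalBasisOneI.repr

theorem toR2_apply_zero (z : ℂ) : toR2 z 0 = z.re := rfl

theorem toR2_apply_one (z : ℂ) : toR2 z 1 = z.im := rfl

theorem perp_toR2 (z : ℂ) : perp (toR2 z) = toR2 (Complex.I * z) := by
  ext i
  fin_cases i
  · change -toR2 z 1 = toR2 (Complex.I * z) 0
    simp [toR2_apply_zero, toR2_apply_one]
  · change toR2 z 0 = toR2 (Complex.I * z) 1
    simp [toR2_apply_zero, toR2_apply_one]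

theorem inner_toR2_I_mul_sub (ζ z : ℂ) :
    inner ℝ (toR2 ζ) (toR2 (Complex.I * (ζ - z))) = ((starRingEnd ℂ) ζ * z).im := by
  rw [LinearIsometryEquiv.inner_map_map, Complex.inner]
  simp
  ring

theorem measurePreserving_toR2 : MeasurePreserving toR2 :=
  Complex.orthonormalBasisOneI.measurePreserving_repr

theorem measurableEmbedding_toR2 : MeasurableEmbedding toR2 :=
  toR2.toHomeomorph.measurableEmbedding

theorem fderiv_Gv_apply (ξ v : R2) : fderiv ℝ Gv ξ v = -(1 / 2) * Gv ξ * inner ℝ ξ v := by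
  have h := ((((hasStrictFDerivAt_norm_sq ξ).hasFDerivAt.neg).mul_const (1 / 4)).exp).const_mul
    ((4 * π)⁻¹)
  have h' : HasFDerivAt Gv _ ξ :=
    h.congr_of_eventuallyEq (Eventually.of_forall fun x => by
      simp only [Gv, Pi.neg_apply]; congr 2; ring)
  rw [h'.fderiv, Gv]
  simp
  ring_nf

theorem pd_zero_Gv (z : ℂ) : pd 0 Gv (toR2 z) = -(1 / 2) * Gv (toR2 z) * z.re := by
  rw [pd, fderiv_Gv_apply, EuclideanSpace.inner_single_right]
  simp [toR2_apply_zero]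

theorem pd_one_Gv (z : ℂ) : pd 1 Gv (toR2 z) = -(1 / 2) * Gv (toR2 z) * z.im := by
  rw [pd, fderiv_Gv_apply, EuclideanSpace.inner_single_right]
  simp [toR2_apply_one]

theorem Gv_toR2 (z : ℂ) : Gv (toR2 z) = (4 * π)⁻¹ * Real.exp (-‖z‖ ^ 2 / 4) := by
  rw [Gv, LinearIsometryEquiv.norm_map]

theorem vG_toR2 (z : ℂ) : vG (toR2 z)
    = ((2 * π)⁻¹ * (1 - Real.exp (-‖z‖ ^ 2 / 4)) / ‖z‖ ^ 2) • toR2 (Complex.I * z) := by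
  rw [vG, LinearIsometryEquiv.norm_map, perp_toR2]

theorem SchwartzMap.exists_abs_le_one_add_norm_rpow (w : SchwartzMap R2 ℝ) :
    ∃ C, ∀ x, |w x| ≤ C * (1 + ‖x‖) ^ (-3 : ℝ) := by
  refine ⟨2 ^ 3 * (Finset.Iic ((3, 0) : ℕ × ℕ)).sup
    (fun m => SchwartzMap.seminorm ℝ m.1 m.2) w, fun x => ?_⟩
  have h := SchwartzMap.one_add_le_sup_seminorm_apply (𝕜 := ℝ) (m := (3, 0)) (k := 3) (n := 0)
    le_rfl le_rfl w x
  rw [norm_iteratedFDeriv_zero, Real.norm_eq_abs] at h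
  rw [Real.rpow_neg (by positivity), ← div_eq_mul_inv, le_div_iff₀ (by positivity), mul_comm]
  exact_mod_cast h

theorem integrable_biotSavart_integrand (w : SchwartzMap R2 ℝ) (ζ : ℂ) :
    Integrable fun z : ℂ => (w (toR2 z) / ‖ζ - z‖ ^ 2) • toR2 (Complex.I * (ζ - z)) := by
  obtain ⟨C, hC⟩ := w.exists_abs_le_one_add_norm_rpow
  refine ((integrable_inv_norm_sub_mul ζ).const_mul C).mono' ?_ (ae_of_all _ fun z => ?_)
  · have h1 : Measurable fun z : ℂ => w (toR2 z) / ‖ζ - z‖ ^ 2 :=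
      (w.continuous.comp toR2.continuous).measurable.div (by fun_prop)
    have h2 : Continuous fun z : ℂ => toR2 (Complex.I * (ζ - z)) :=
      toR2.continuous.comp (by fun_prop)
    exact h1.aestronglyMeasurable.smul h2.aestronglyMeasurable
  · have h := hC (toR2 z)
    rw [LinearIsometryEquiv.norm_map] at h
    rw [norm_smul, LinearIsometryEquiv.norm_map, norm_mul, Complex.norm_I, one_mul, norm_div,
      norm_pow, norm_norm, Real.norm_eq_abs]
    rcases eq_or_ne ‖ζ - z‖ 0 with h0 | h0
    · simp [h0]
    · calc _ = |w (toR2 z)| * ‖ζ - z‖⁻¹ := by field_simp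
        _ ≤ C * (1 + ‖z‖) ^ (-3 : ℝ) * ‖ζ - z‖⁻¹ := by gcongr
        _ = _ := by ring

theorem inner_biotSavart (w : SchwartzMap R2 ℝ) (ζ : ℂ) :
    inner ℝ (toR2 ζ) (biotSavart w (toR2 ζ))
      = (2 * π)⁻¹ * ∫ z : ℂ, ((starRingEnd ℂ) ζ * z).im / ‖ζ - z‖ ^ 2 * w (toR2 z) := by
  rw [biotSavart, inner_smul_right,
    ← measurePreserving_toR2.integral_comp measurableEmbedding_toR2]
  simp only [← map_sub, perp_toR2, LinearIsometryEquiv.norm_map]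
  rw [← integral_inner (integrable_biotSavart_integrand w ζ)]
  congr 2; ext z
  rw [inner_smul_right, inner_toR2_I_mul_sub]
  ring

/-- A function on the plane in polar coordinates. -/
def polarRep (w : R2 → ℝ) (r θ : ℝ) : ℝ := w (toR2 (r * Complex.exp (θ * Complex.I)))

/-- The angular derivative of a function on the plane in polar coordinates. -/
def polarDeriv (w : R2 → ℝ) (r θ : ℝ) : ℝ :=
  fderiv ℝ w (toR2 (r * Complex.exp (θ * Complex.I)))
    (toR2 (Complex.I * (r * Complex.exp (θ * Complex.I))))

theorem integral_rotated_kernel (w : R2 → ℝ) (r θ : ℝ) :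
    ∫ z : ℂ, ((starRingEnd ℂ) (r * Complex.exp (θ * Complex.I)) * z).im
        / ‖r * Complex.exp (θ * Complex.I) - z‖ ^ 2 * w (toR2 z)
      = ∫ p in polarDom, (p.1 * angKer r p.1 p.2) • polarRep w p.1 (θ + p.2) := by
  rw [← (rotation (Circle.exp θ)).measurePreserving.integral_comp
    (rotation (Circle.exp θ)).toHomeomorph.measurableEmbedding,
    ← Complex.integral_comp_polarCoord_symm]
  refine setIntegral_congr_fun measurableSet_polarDom fun p _ => ?_
  have h1 : (starRingEnd ℂ) (Complex.exp (θ * Complex.I)) * Complex.exp (θ * Complex.I) = 1 := by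
    rw [← Complex.exp_conj, ← Complex.exp_add]; simp
  have h2 : ∀ z : ℂ, (starRingEnd ℂ) (r * Complex.exp (θ * Complex.I))
      * (Complex.exp (θ * Complex.I) * z) = r * z := by
    intro z
    rw [map_mul, Complex.conj_ofReal]
    linear_combination (r * z) * h1
  have h3 : ∀ z : ℂ, ‖r * Complex.exp (θ * Complex.I) - Complex.exp (θ * Complex.I) * z‖
      = ‖(r : ℂ) - z‖ := by
    intro z
    rw [mul_comm (r : ℂ), ← mul_sub, norm_mul, Complex.norm_exp_ofReal_mul_I, one_mul]
  have h4 : Complex.exp (θ * Complex.I) * Complex.polarCoord.symm p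
      = p.1 * Complex.exp ((θ + p.2 : ℝ) * Complex.I) := by
    rw [Complex.polarCoord_symm_apply]
    push_cast
    rw [add_mul, Complex.exp_add, Complex.exp_mul_I (p.2 : ℂ)]
    ring
  simp only [rotation_apply, Circle.coe_exp, h2, h3, angKer_eq, polarRep, smul_eq_mul, mul_assoc]
  rw [h4]

theorem Lam_polar (w : SchwartzMap R2 ℝ) {r : ℝ} (hr : 0 < r) (θ : ℝ) :
    16 * π * r * Lam w (toR2 (r * Complex.exp (θ * Complex.I)))
      = mult r * polarDeriv w r θ - prof r / π *
        ∫ p in polarDom, (p.1 * angKer r p.1 p.2) • polarRep w p.1 (θ + p.2) := by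
  have hn : ‖r * Complex.exp (θ * Complex.I)‖ = r := by
    rw [norm_mul, Complex.norm_exp_ofReal_mul_I, mul_one, Complex.norm_of_nonneg hr.le]
  rw [Lam, fderiv_Gv_apply, inner_biotSavart, integral_rotated_kernel, vG_toR2, map_smul, Gv_toR2,
    hn, smul_eq_mul, ← polarDeriv, mult, prof]
  have := Real.pi_ne_zero
  field_simp
  ring

theorem Lam_zero (w : R2 → ℝ) : Lam w 0 = 0 := by
  rw [Lam, fderiv_Gv_apply, vG]
  simp

theorem continuous_polarRep (w : SchwartzMap R2 ℝ) :
    Continuous (Function.uncurry (polarRep w)) :=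
  w.continuous.comp (toR2.continuous.comp (by fun_prop))

theorem periodic_polarRep (w : R2 → ℝ) (r : ℝ) : Function.Periodic (polarRep w r) (2 * π) := by
  intro θ
  simp only [polarRep]
  congr 3
  rw [Complex.exp_eq_exp_iff_exists_int]
  exact ⟨1, by push_cast; ring⟩

theorem hasDerivAt_polarRep (w : SchwartzMap R2 ℝ) (r θ : ℝ) :
    HasDerivAt (polarRep w r) (polarDeriv w r θ) θ := by
  have h1 : HasDerivAt (fun θ : ℝ => r * Complex.exp (θ * Complex.I))
      (Complex.I * (r * Complex.exp (θ * Complex.I))) θ := by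
    convert! ((Complex.ofRealCLM.hasDerivAt (x := θ)).mul_const Complex.I).cexp.const_mul (r : ℂ)
      using 1
    simp; ring
  have h2 : HasDerivAt (fun θ : ℝ => toR2 (r * Complex.exp (θ * Complex.I)))
      (toR2 (Complex.I * (r * Complex.exp (θ * Complex.I)))) θ :=
    toR2.toContinuousLinearEquiv.hasFDerivAt.comp_hasDerivAt θ h1
  exact w.differentiableAt.hasFDerivAt.comp_hasDerivAt θ h2

theorem continuous_polarDeriv (w : SchwartzMap R2 ℝ) (r : ℝ) : Continuous (polarDeriv w r) := by
  have h := (w.smooth 1).continuous_fderiv one_ne_zero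
  unfold polarDeriv
  exact (h.comp (toR2.continuous.comp (by fun_prop))).clm_apply
    (toR2.continuous.comp (by fun_prop))

theorem exists_toR2_polar (ξ : R2) : ∃ θ : ℝ, ξ = toR2 (‖ξ‖ * Complex.exp (θ * Complex.I)) := by
  refine ⟨Complex.arg (toR2.symm ξ), ?_⟩
  have := Complex.norm_mul_exp_arg_mul_I (toR2.symm ξ)
  rw [LinearIsometryEquiv.norm_map] at this
  rw [this, LinearIsometryEquiv.apply_symm_apply]

theorem pd_zero_Gv_polar {r : ℝ} (hr : 0 < r) (θ : ℝ) :
    pd 0 Gv (toR2 (r * Complex.exp (θ * Complex.I))) = -(8 * π)⁻¹ * (Real.cos θ * prof r) := by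
  rw [pd_zero_Gv, Gv_toR2, norm_mul, Complex.norm_exp_ofReal_mul_I, mul_one,
    Complex.norm_of_nonneg hr.le, Complex.re_ofReal_mul, Complex.exp_ofReal_mul_I_re, prof]
  have := Real.pi_ne_zero
  field_simp
  ring

theorem pd_one_Gv_polar {r : ℝ} (hr : 0 < r) (θ : ℝ) :
    pd 1 Gv (toR2 (r * Complex.exp (θ * Complex.I))) = -(8 * π)⁻¹ * (Real.sin θ * prof r) := by
  rw [pd_one_Gv, Gv_toR2, norm_mul, Complex.norm_exp_ofReal_mul_I, mul_one,
    Complex.norm_of_nonneg hr.le, Complex.im_ofReal_mul, Complex.exp_ofReal_mul_I_im, prof]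
  have := Real.pi_ne_zero
  field_simp
  ring

theorem exists_abs_polarRep_le (w : SchwartzMap R2 ℝ) :
    ∃ C, ∀ r, 0 ≤ r → ∀ θ, |polarRep w r θ| ≤ C * (1 + r) ^ (-3 : ℝ) := by
  obtain ⟨C, hC⟩ := w.exists_abs_le_one_add_norm_rpow
  refine ⟨C, fun r hr θ => ?_⟩
  have := hC (toR2 (r * Complex.exp (θ * Complex.I)))
  rwa [LinearIsometryEquiv.norm_map, norm_mul, Complex.norm_exp_ofReal_mul_I, mul_one,
    Complex.norm_of_nonneg hr] at this

/-- Kernel of `Λ`: for a Schwartz function `w`, `Λw = 0` iff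
`w - β₁ ∂₁G - β₂ ∂₂G` is radially symmetric for some `β₁, β₂ ∈ ℝ`. -/
theorem ker_Lam_characterization (w : SchwartzMap R2 ℝ) :
    (∀ ξ : R2, Lam (⇑w) ξ = 0) ↔
      ∃ β₁ β₂ : ℝ, ∀ ξ η : R2, ‖ξ‖ = ‖η‖ →
        w ξ - β₁ * pd 0 Gv ξ - β₂ * pd 1 Gv ξ =
          w η - β₁ * pd 0 Gv η - β₂ * pd 1 Gv η := by
  obtain ⟨C, hdec⟩ := exists_abs_polarRep_le w
  have hP := continuous_polarRep w
  have hpi := Real.pi_ne_zero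
  constructor
  · intro hL
    obtain ⟨A, c, d, h⟩ := exists_eq_radial_add_first_mode hP (periodic_polarRep w) hdec
      (hasDerivAt_polarRep w) (continuous_polarDeriv w) fun r hr θ => by
        have := Lam_polar w hr θ
        rw [hL, mul_zero] at this
        linarith
    have key : ∀ ξ : R2, ξ ≠ 0 →
        w ξ - (-8 * π * c) * pd 0 Gv ξ - (-8 * π * d) * pd 1 Gv ξ = A ‖ξ‖ := by
      intro ξ hξ
      have hr : 0 < ‖ξ‖ := norm_pos_iff.2 hξ
      obtain ⟨θ, hθ⟩ := exists_toR2_polar ξ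
      generalize ‖ξ‖ = r at *
      have hr' := h r hr θ
      rw [polarRep, ← hθ] at hr'
      rw [hr', hθ, pd_zero_Gv_polar hr, pd_one_Gv_polar hr]
      field_simp
      ring
    refine ⟨-8 * π * c, -8 * π * d, fun ξ η hn => ?_⟩
    rcases eq_or_ne ξ 0 with rfl | hξ
    · rw [norm_zero, eq_comm, norm_eq_zero] at hn
      rw [hn]
    · have hη : η ≠ 0 := by rwa [← norm_ne_zero_iff, ← hn, norm_ne_zero_iff]
      rw [key ξ hξ, key η hη, hn]
  · rintro ⟨β₁, β₂, hβ⟩ ξ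
    rcases eq_or_ne ξ 0 with rfl | hξ
    · exact Lam_zero w
    have h : ∃ A : ℝ → ℝ, ∀ r, 0 < r → ∀ θ, polarRep w r θ = A r
        + ((-(8 * π)⁻¹ * β₁) * Real.cos θ + (-(8 * π)⁻¹ * β₂) * Real.sin θ) * prof r := by
      refine ⟨fun r => w (toR2 r) - β₁ * pd 0 Gv (toR2 r) - β₂ * pd 1 Gv (toR2 r),
        fun r hr θ => ?_⟩
      have h1 := hβ (toR2 (r * Complex.exp (θ * Complex.I))) (toR2 r) (by simp)
      rw [pd_zero_Gv_polar hr, pd_one_Gv_polar hr] at h1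
      rw [polarRep]
      linear_combination h1
    obtain ⟨A, hA⟩ := h
    have hr : 0 < ‖ξ‖ := norm_pos_iff.2 hξ
    obtain ⟨θ, hθ⟩ := exists_toR2_polar ξ
    generalize ‖ξ‖ = r at *
    have hD : polarDeriv w r θ = ((-(8 * π)⁻¹ * β₂) * Real.cos θ
        - (-(8 * π)⁻¹ * β₁) * Real.sin θ) * prof r := by
      refine (hasDerivAt_polarRep w r θ).unique ?_
      rw [show polarRep w r = _ from funext (hA r hr)]
      convert! ((((Real.hasDerivAt_cos θ).const_mul (-(8 * π)⁻¹ * β₁)).add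
        ((Real.hasDerivAt_sin θ).const_mul (-(8 * π)⁻¹ * β₂))).mul_const (prof r)).const_add (A r)
        using 1
      ring
    have h2 := Lam_polar w hr θ
    rw [integral_kernel_of_radial_add_first_mode hP hdec hA hr, hD, ← hθ] at h2
    have h3 : 16 * π * r * Lam w ξ = 0 := by
      rw [h2]; field_simp; ring
    exact (mul_eq_zero.1 h3).resolve_left (by positivity)

end
end

section
/- Let α ∈ ℝ, λ ∈ ℂ, and let w : ℝ² → ℂ be a nonzero Schwartz function satisfying pointwise the eigenvalue equation (𝓛 − αΛ)w = λw, where 𝓛w = Δw + (1/2) ξ·∇w + w and Λ acts on w componentwise on its real and imaginary parts. Then Re(λ) ≤ 0. If moreover ∫_{ℝ²} w(ξ) dξ = 0, then Re(λ) ≤ −1/2; if additionally ∫_{ℝ²} ξ₁ w(ξ) dξ = ∫_{ℝ²} ξ₂ w(ξ) dξ = 0, then Re(λ) ≤ −1. -/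
open MeasureTheory Filter Real
open scoped ENNReal Topology

noncomputable section

/-- Partial derivative of a complex-valued function on `ℝ²`. -/
def pdC (i : Fin 2) (f : R2 → ℂ) (x : R2) : ℂ := fderiv ℝ f x (EuclideanSpace.single i 1)

/-- Laplacian of a complex-valued function on `ℝ²`. -/
def lapC (f : R2 → ℂ) (x : R2) : ℂ := pdC 0 (pdC 0 f) x + pdC 1 (pdC 1 f) x

/-- Components of the Biot–Savart velocity of a complex vorticity. -/
def biotSavartC (ω : R2 → ℂ) (x : R2) (i : Fin 2) : ℂ :=
  (2 * π : ℝ)⁻¹ * ∫ y : R2, ((perp (x - y) i / ‖x - y‖ ^ 2 : ℝ) : ℂ) * ω y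

/-- The operator `Λ` acting (componentwise on real and imaginary parts) on
complex-valued functions: `(Λw)(ξ) = v^G(ξ)·∇w(ξ) + (K*w)(ξ)·∇G(ξ)`. -/
def LamC (w : R2 → ℂ) (ξ : R2) : ℂ :=
  (vG ξ 0 : ℂ) * pdC 0 w ξ + (vG ξ 1 : ℂ) * pdC 1 w ξ +
    biotSavartC w ξ 0 * (pd 0 Gv ξ : ℂ) + biotSavartC w ξ 1 * (pd 1 Gv ξ : ℂ)

/-- The operator `𝓛w = Δw + (1/2) ξ·∇w + w` on complex-valued functions. -/
def Lop (w : R2 → ℂ) (ξ : R2) : ℂ :=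
  lapC w ξ + (1/2) * ((ξ 0 : ℂ) * pdC 0 w ξ + (ξ 1 : ℂ) * pdC 1 w ξ) + w ξ

open scoped SchwartzMap LineDeriv ContDiff

/-! ### Integration by parts for Schwartz functions -/

section IntegrationByParts

variable {E F : Type*} [NormedAddCommGroup E] [NormedSpace ℝ E] [NormedAddCommGroup F]
  [NormedSpace ℝ F] [FiniteDimensional ℝ E] [MeasurableSpace E] [BorelSpace E]
  {μ : Measure E} [μ.IsAddHaarMeasure]

theorem integral_lineDerivOp_eq_zero (f : 𝓢(E, F)) (v : E) : ∫ x, ∂_{v} f x ∂μ = 0 := by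
  have h := integral_smul_fderiv_eq_neg_fderiv_smul_of_integrable (μ := μ) (𝕜 := ℝ)
    (f := fun _ : E => (1 : ℝ)) (g := f) (v := v) (by simp)
    (by simpa using (∂_{v} f).integrable (μ := μ))
    (by simpa using f.integrable (μ := μ)) (by simp) (fun x _ => f.differentiableAt)
  simpa [SchwartzMap.lineDerivOp_apply_eq_fderiv] using h

theorem integrable_temperate_smul {P : E → ℝ} (hP : P.HasTemperateGrowth) (f : 𝓢(E, F)) :
    Integrable (fun x => P x • f x) μ := by
  have h := (SchwartzMap.smulLeftCLM F P f).integrable (μ := μ)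
  rwa [SchwartzMap.smulLeftCLM_apply hP] at h

theorem integral_temperate_smul_deriv {P P' : E → ℝ} {v : E} (hP : P.HasTemperateGrowth)
    (hP' : ∀ x, HasLineDerivAt ℝ P (P' x) x v) (f : 𝓢(E, F)) :
    Integrable (fun x => P' x • f x + P x • ∂_{v} f x) μ ∧
      ∫ x, (P' x • f x + P x • ∂_{v} f x) ∂μ = 0 := by
  have key : (fun x => P' x • f x + P x • ∂_{v} f x)
      = ∂_{v} (SchwartzMap.smulLeftCLM F P f : 𝓢(E, F)) := by
    ext x
    rw [SchwartzMap.lineDerivOp_apply v (SchwartzMap.smulLeftCLM F P f : 𝓢(E, F)) x]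
    refine (HasLineDerivAt.lineDeriv (𝕜 := ℝ) ?_).symm
    rw [SchwartzMap.smulLeftCLM_apply hP]
    have hf : HasLineDerivAt ℝ f (∂_{v} f x) x v := f.differentiableAt.hasFDerivAt.hasLineDerivAt v
    have h1 := hP' x
    unfold HasLineDerivAt at h1 hf ⊢
    have := h1.smul hf
    simp only [zero_smul, add_zero] at this
    rw [add_comm] at this
    exact this
  rw [key]
  exact ⟨(∂_{v} (SchwartzMap.smulLeftCLM F P f : 𝓢(E, F))).integrable,
    integral_lineDerivOp_eq_zero _ v⟩

theorem integral_temperate_inner_deriv {H : Type*} [NormedAddCommGroup H] [InnerProductSpace ℝ H]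
    {P P' : E → ℝ} {v : E} (hP : P.HasTemperateGrowth)
    (hP' : ∀ x, HasLineDerivAt ℝ P (P' x) x v) (f g : 𝓢(E, H)) :
    Integrable (fun x => P' x * inner ℝ (f x) (g x)
        + P x * (inner ℝ (∂_{v} f x) (g x) + inner ℝ (f x) (∂_{v} g x))) μ ∧
      ∫ x, (P' x * inner ℝ (f x) (g x)
        + P x * (inner ℝ (∂_{v} f x) (g x) + inner ℝ (f x) (∂_{v} g x))) ∂μ = 0 := by
  have h := integral_temperate_smul_deriv (μ := μ) hP hP' (SchwartzMap.pairing (innerSL ℝ) f g)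
  have key : ∀ x, ∂_{v} (SchwartzMap.pairing (innerSL ℝ) f g) x
      = inner ℝ (∂_{v} f x) (g x) + inner ℝ (f x) (∂_{v} g x) := by
    intro x
    rw [SchwartzMap.lineDerivOp_apply_eq_fderiv]
    have : HasFDerivAt (fun x => inner ℝ (f x) (g x)) _ x :=
      (f.hasFDerivAt x).inner ℝ (g.hasFDerivAt x)
    change fderiv ℝ (fun x => inner ℝ (f x) (g x)) x v = _
    rw [this.fderiv, SchwartzMap.lineDerivOp_apply_eq_fderiv,
      SchwartzMap.lineDerivOp_apply_eq_fderiv]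
    simp [add_comm]
  simp only [key, smul_eq_mul] at h
  exact h

theorem integrable_temperate_inner {H : Type*} [NormedAddCommGroup H] [InnerProductSpace ℝ H]
    {P : E → ℝ} (hP : P.HasTemperateGrowth) (f g : 𝓢(E, H)) :
    Integrable (fun x => P x * inner ℝ (f x) (g x)) μ :=
  integrable_temperate_smul hP (SchwartzMap.pairing (innerSL ℝ) f g)

end IntegrationByParts

/-! ### Gaussians as Schwartz functions -/

section Gaussian

variable {H : Type*} [NormedAddCommGroup H] [InnerProductSpace ℝ H]

theorem iteratedDeriv_exp_norm (n : ℕ) (y : ℝ) : ‖iteratedFDeriv ℝ n Real.exp y‖ = Real.exp y := by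
  rw [norm_iteratedFDeriv_eq_norm_iteratedDeriv, iteratedDeriv_eq_iterate, Real.iter_deriv_exp]
  exact abs_of_pos (Real.exp_pos y)

theorem exists_bound_pow_mul_gaussian (c : ℝ) (hc : 0 < c) (k : ℕ) :
    ∃ C : ℝ, ∀ r : ℝ, 0 ≤ r → (1 + r) ^ k * Real.exp (-c * r ^ 2) ≤ C := by
  obtain ⟨C, hC⟩ : ∃ C, ∀ t : ℝ, 0 ≤ t → t ^ k * Real.exp (-c * t) ≤ C := by
    refine ⟨k.factorial / c ^ k, fun t ht => ?_⟩
    have h := Real.pow_div_factorial_le_exp (c * t) (by positivity) k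
    rw [mul_pow, div_le_iff₀ (by positivity)] at h
    rw [le_div_iff₀ (by positivity), neg_mul, Real.exp_neg]
    rw [← div_eq_mul_inv, div_mul_eq_mul_div, div_le_iff₀ (Real.exp_pos _)]
    linarith
  refine ⟨C * Real.exp (2 * c), fun r hr => ?_⟩
  calc (1 + r) ^ k * Real.exp (-c * r ^ 2)
      ≤ (1 + r) ^ k * (Real.exp (-c * (1 + r)) * Real.exp (2 * c)) := by
        rw [← Real.exp_add]
        gcongr
        nlinarith [mul_nonneg hc.le (sq_nonneg (r - 1 / 2)), mul_pos hc hc]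
    _ ≤ C * Real.exp (2 * c) := by
        rw [← mul_assoc]
        gcongr
        exact hC _ (by positivity)

/-- The Gaussian `x ↦ exp (-c ‖x‖²)` as a Schwartz function. -/
def gaussianSchwartz (H : Type*) [NormedAddCommGroup H] [InnerProductSpace ℝ H] (c : ℝ)
    (hc : 0 < c) : 𝓢(H, ℝ) where
  toFun x := Real.exp (-c * ‖x‖ ^ 2)
  smooth' := by
    have := contDiff_norm_sq ℝ (E := H) (n := ∞)
    fun_prop
  decay' k n := by
    have hf : (fun x : H => -c * ‖x‖ ^ 2).HasTemperateGrowth := by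
      have := Function.hasTemperateGrowth_norm_sq (H := H)
      fun_prop
    obtain ⟨j, C, hC, h⟩ := hf.norm_iteratedFDeriv_le_uniform n
    obtain ⟨M, hM⟩ := exists_bound_pow_mul_gaussian c hc (k + j * n)
    refine ⟨n.factorial * (1 + C) ^ n * M, fun x => ?_⟩
    have hD : ∀ i, 1 ≤ i → i ≤ n →
        ‖iteratedFDeriv ℝ i (fun x : H => -c * ‖x‖ ^ 2) x‖ ≤ ((1 + C) * (1 + ‖x‖) ^ j) ^ i := by
      intro i hi hin
      calc _ ≤ C * (1 + ‖x‖) ^ j := h i hin x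
        _ ≤ (1 + C) * (1 + ‖x‖) ^ j := by gcongr; simp
        _ ≤ _ := le_self_pow₀ (one_le_mul_of_one_le_of_one_le (by simp [hC])
            (one_le_pow₀ (by simp))) (by omega)
    have h1 := norm_iteratedFDeriv_comp_le (g := Real.exp) (f := fun x : H => -c * ‖x‖ ^ 2)
      (n := n) (N := ∞) Real.contDiff_exp hf.1 (mod_cast le_top) x
      (C := Real.exp (-c * ‖x‖ ^ 2)) (fun i _ => (iteratedDeriv_exp_norm i _).le) hD
    calc ‖x‖ ^ k * ‖iteratedFDeriv ℝ n (fun x : H => Real.exp (-c * ‖x‖ ^ 2)) x‖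
        ≤ (1 + ‖x‖) ^ k * (n.factorial * Real.exp (-c * ‖x‖ ^ 2)
          * ((1 + C) * (1 + ‖x‖) ^ j) ^ n) := by
          gcongr
          · simp
          · exact h1
      _ = n.factorial * (1 + C) ^ n * ((1 + ‖x‖) ^ (k + j * n) * Real.exp (-c * ‖x‖ ^ 2)) := by
          rw [mul_pow, ← pow_mul, pow_add]; ring
      _ ≤ _ := by
          gcongr
          exact hM _ (norm_nonneg x)

@[simp] theorem gaussianSchwartz_apply (c : ℝ) (hc : 0 < c) (x : H) :
    gaussianSchwartz H c hc x = Real.exp (-c * ‖x‖ ^ 2) := rfl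

end Gaussian

/-! ### The Biot–Savart kernel -/

section BiotSavart

theorem norm_sq_eq_coord (x : R2) : ‖x‖ ^ 2 = x 0 ^ 2 + x 1 ^ 2 := by
  simp [EuclideanSpace.real_norm_sq_eq]

@[simp] theorem perp_zero (x : R2) : perp x 0 = -x 1 := rfl

@[simp] theorem perp_one (x : R2) : perp x 1 = x 0 := rfl

theorem norm_perp (x : R2) : ‖perp x‖ = ‖x‖ := by
  rw [← sq_eq_sq₀ (norm_nonneg _) (norm_nonneg _), norm_sq_eq_coord, norm_sq_eq_coord]
  simp [add_comm]

theorem abs_coord_le_norm (x : R2) (i : Fin 2) : |x i| ≤ ‖x‖ := by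
  simpa using PiLp.norm_apply_le x i

theorem abs_kernel_le (x : R2) (i : Fin 2) : |perp x i / ‖x‖ ^ 2| ≤ ‖x‖⁻¹ := by
  rcases eq_or_ne x 0 with rfl | hx
  · simp
  have hx' : 0 < ‖x‖ := norm_pos_iff.2 hx
  rw [abs_div, abs_of_pos (by positivity : 0 < ‖x‖ ^ 2), div_le_iff₀ (by positivity)]
  calc |perp x i| ≤ ‖perp x‖ := abs_coord_le_norm _ i
    _ = ‖x‖⁻¹ * ‖x‖ ^ 2 := by rw [norm_perp]; field_simp

/-- The singular part `1_{|z| < 1} / |z|` of the kernel `1 / |z|`. -/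
def nearKernel (z : R2) : ℝ := (Set.Iio (1 : ℝ)).indicator (fun r => r⁻¹) ‖z‖

theorem nearKernel_nonneg (z : R2) : 0 ≤ nearKernel z :=
  Set.indicator_apply_nonneg fun _ => by positivity

theorem integrable_nearKernel : Integrable nearKernel := by
  have h := (integrable_fun_norm_addHaar (volume : Measure R2)
    (f := (Set.Iio (1 : ℝ)).indicator (fun r => r⁻¹))).2
  apply h
  have h1 : IntegrableOn ((Set.Iio (1 : ℝ)).indicator (fun _ => (1 : ℝ))) (Set.Ioi 0) := by
    rw [integrableOn_indicator_iff measurableSet_Iio]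
    refine integrableOn_const ?_
    rw [Set.inter_comm, Set.Ioi_inter_Iio]
    simp
  refine h1.congr_fun (fun y hy => ?_) measurableSet_Ioi
  have hy' : (0 : ℝ) < y := hy
  by_cases hy1 : y < 1
  · simp [Set.indicator, hy1, hy'.ne']
  · simp [Set.indicator, hy1]

theorem inv_norm_le (z : R2) : ‖z‖⁻¹ ≤ 1 + nearKernel z := by
  by_cases h : ‖z‖ < 1
  · simp [nearKernel, Set.indicator, h]
  · have := nearKernel_nonneg z
    have : ‖z‖⁻¹ ≤ 1 := inv_le_one_of_one_le₀ (not_lt.1 h)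
    linarith

variable (w : 𝓢(R2, ℂ))

theorem exists_norm_bound : ∃ S : ℝ, 0 ≤ S ∧ ∀ x, ‖w x‖ ≤ S :=
  ⟨_, apply_nonneg _ _, SchwartzMap.norm_le_seminorm ℝ w⟩

theorem exists_kernel_integrand_bound : ∃ S : ℝ, 0 ≤ S ∧ ∀ x y : R2,
    ‖x - y‖⁻¹ * ‖w y‖ ≤ ‖w y‖ + S * nearKernel (x - y) := by
  obtain ⟨S, hS, h⟩ := exists_norm_bound w
  refine ⟨S, hS, fun x y => ?_⟩
  have h1 := mul_le_mul_of_nonneg_right (inv_norm_le (x - y)) (norm_nonneg (w y))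
  have h2 := mul_le_mul_of_nonneg_right (h y) (nearKernel_nonneg (x - y))
  linarith

theorem measurable_kernel (i : Fin 2) :
    Measurable (fun z : R2 => perp z i / ‖z‖ ^ 2) := by
  fin_cases i
  · change Measurable (fun z : R2 => -z 1 / ‖z‖ ^ 2)
    fun_prop
  · change Measurable (fun z : R2 => z 0 / ‖z‖ ^ 2)
    fun_prop

theorem integrable_nearKernel_sub (x : R2) : Integrable (fun y => nearKernel (x - y)) :=
  integrable_nearKernel.comp_sub_left x

theorem norm_kernel_mul_le (x y : R2) (i : Fin 2) :
    ‖((perp (x - y) i / ‖x - y‖ ^ 2 : ℝ) : ℂ) * w y‖ ≤ ‖x - y‖⁻¹ * ‖w y‖ := by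
  rw [norm_mul, Complex.norm_real]
  gcongr
  exact abs_kernel_le _ i

theorem integrable_kernel_mul (x : R2) (i : Fin 2) :
    Integrable (fun y => ((perp (x - y) i / ‖x - y‖ ^ 2 : ℝ) : ℂ) * w y) := by
  obtain ⟨S, hS, h⟩ := exists_kernel_integrand_bound w
  refine (w.integrable.norm.add ((integrable_nearKernel_sub x).const_mul S)).mono'
    (AEStronglyMeasurable.mul ?_ w.continuous.aestronglyMeasurable)
    (Eventually.of_forall fun y => (norm_kernel_mul_le w x y i).trans (h x y))
  exact (Complex.measurable_ofReal.comp
    ((measurable_kernel i).comp (measurable_const.sub measurable_id))).aestronglyMeasurable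

theorem exists_biotSavartC_bound : ∃ M : ℝ, 0 ≤ M ∧ ∀ x i, ‖biotSavartC w x i‖ ≤ M := by
  obtain ⟨S, hS, h⟩ := exists_kernel_integrand_bound w
  refine ⟨(2 * π)⁻¹ * ((∫ y, ‖w y‖) + S * ∫ z, nearKernel z), ?_, fun x i => ?_⟩
  · have h1 : 0 ≤ ∫ y, ‖w y‖ := integral_nonneg fun y => norm_nonneg _
    have h2 : 0 ≤ ∫ z, nearKernel z := integral_nonneg nearKernel_nonneg
    positivity
  unfold biotSavartC
  rw [norm_mul]
  have h0 : ‖(((2 * π : ℝ)⁻¹ : ℝ) : ℂ)‖ = (2 * π)⁻¹ := by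
    rw [Complex.norm_real, Real.norm_of_nonneg (by positivity)]
  rw [h0]
  gcongr
  calc _ ≤ ∫ y, (‖w y‖ + S * nearKernel (x - y)) :=
        norm_integral_le_of_norm_le
          (w.integrable.norm.add ((integrable_nearKernel_sub x).const_mul S))
          (Eventually.of_forall fun y => (norm_kernel_mul_le w x y i).trans (h x y))
    _ = _ := by
        rw [integral_add w.integrable.norm ((integrable_nearKernel_sub x).const_mul S),
          integral_const_mul, integral_sub_left_eq_self nearKernel]

theorem aestronglyMeasurable_biotSavartC (i : Fin 2) :
    AEStronglyMeasurable (fun x => biotSavartC w x i) := by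
  unfold biotSavartC
  refine AEStronglyMeasurable.const_mul ?_ _
  have : AEStronglyMeasurable (fun z : R2 × R2 =>
      ((perp (z.1 - z.2) i / ‖z.1 - z.2‖ ^ 2 : ℝ) : ℂ) * w z.2) (volume.prod volume) := by
    refine AEStronglyMeasurable.mul ?_
      (w.continuous.comp continuous_snd).aestronglyMeasurable
    exact (Complex.measurable_ofReal.comp
      ((measurable_kernel i).comp (measurable_fst.sub measurable_snd))).aestronglyMeasurable
  exact this.integral_prod_right'

/-- The antisymmetric kernel obtained by pairing `w` with `ξ · (K * w)`. -/
def torque (z : R2 × R2) : ℝ :=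
  (z.1 0 * z.2 1 - z.1 1 * z.2 0) / ‖z.1 - z.2‖ ^ 2 * inner ℝ (w z.1) (w z.2)

theorem torque_swap (z : R2 × R2) : torque w z.swap = -torque w z := by
  simp only [torque, Prod.fst_swap, Prod.snd_swap]
  rw [norm_sub_rev, real_inner_comm]
  ring

theorem torque_eq (x y : R2) : torque w (x, y) =
    x 0 * inner ℝ (w x) (((perp (x - y) 0 / ‖x - y‖ ^ 2 : ℝ) : ℂ) * w y) +
    x 1 * inner ℝ (w x) (((perp (x - y) 1 / ‖x - y‖ ^ 2 : ℝ) : ℂ) * w y) := by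
  simp only [torque, ← Complex.real_smul, real_inner_smul_right, perp_zero, perp_one,
    PiLp.sub_apply]
  ring

theorem integrable_torque : Integrable (torque w) (volume.prod volume) := by
  obtain ⟨S, hS, h⟩ := exists_kernel_integrand_bound w
  have hxw : Integrable (fun x : R2 => ‖x‖ * ‖w x‖) := by
    simpa using w.integrable_pow_mul volume 1
  have h1 : Integrable (fun z : R2 × R2 => (‖z.1‖ * ‖w z.1‖) * ‖w z.2‖) (volume.prod volume) :=
    hxw.mul_prod w.integrable.norm
  have h2 : Integrable (fun z : R2 × R2 => (‖z.1‖ * ‖w z.1‖) * nearKernel (z.1 - z.2))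
      (volume.prod volume) := by
    have h3 := hxw.convolution_integrand (ContinuousLinearMap.mul ℝ ℝ)
      (integrable_nearKernel.comp_neg) (μ := volume) (ν := volume)
    have h4 := h3.swap
    refine h4.congr (Eventually.of_forall fun z => ?_)
    simp [Prod.swap]
  refine (h1.add (h2.const_mul S)).mono' ?_ (Eventually.of_forall fun z => ?_)
  · refine AEStronglyMeasurable.mul ?_ (Continuous.aestronglyMeasurable ?_)
    · exact Measurable.aestronglyMeasurable (by fun_prop)
    · exact (w.continuous.comp continuous_fst).inner (w.continuous.comp continuous_snd)
  · obtain ⟨x, y⟩ := z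
    have hk : |(x 0 * y 1 - x 1 * y 0) / ‖x - y‖ ^ 2| ≤ ‖x‖ * ‖x - y‖⁻¹ := by
      have he : x 0 * y 1 - x 1 * y 0 = inner ℝ x (perp (x - y)) := by
        simp [PiLp.inner_apply, Fin.sum_univ_two]; ring
      rcases eq_or_ne (x - y) 0 with hxy | hxy
      · simp [hxy]
      have hp : 0 < ‖x - y‖ := norm_pos_iff.2 hxy
      rw [he, abs_div, abs_of_pos (by positivity : 0 < ‖x - y‖ ^ 2), div_le_iff₀ (by positivity)]
      calc |inner ℝ x (perp (x - y))| ≤ ‖x‖ * ‖perp (x - y)‖ := abs_real_inner_le_norm _ _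
        _ = _ := by rw [norm_perp]; field_simp
    calc ‖torque w (x, y)‖ ≤ (‖x‖ * ‖x - y‖⁻¹) * (‖w x‖ * ‖w y‖) := by
          rw [torque, norm_mul]
          gcongr
          · exact hk
          · exact abs_real_inner_le_norm _ _
      _ = ‖x‖ * ‖w x‖ * (‖x - y‖⁻¹ * ‖w y‖) := by ring
      _ ≤ ‖x‖ * ‖w x‖ * (‖w y‖ + S * nearKernel (x - y)) := by gcongr; exact h x y
      _ = _ := by simp only [Pi.add_apply]; ring

theorem inner_biotSavartC (x : R2) (i : Fin 2) : inner ℝ (w x) (biotSavartC w x i) =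
    (2 * π)⁻¹ * ∫ y, inner ℝ (w x) (((perp (x - y) i / ‖x - y‖ ^ 2 : ℝ) : ℂ) * w y) := by
  rw [integral_inner (integrable_kernel_mul w x i)]
  unfold biotSavartC
  rw [← Complex.real_smul, real_inner_smul_right]

/-- The velocity field generated by `w` exerts no radial force on `w`. -/
theorem integral_radial_biotSavartC :
    ∫ x : R2, (x 0 * inner ℝ (w x) (biotSavartC w x 0)
      + x 1 * inner ℝ (w x) (biotSavartC w x 1)) = 0 := by
  have h0 : ∫ z, torque w z ∂(volume.prod volume) = 0 := by
    have h := integral_prod_swap (μ := (volume : Measure R2)) (ν := (volume : Measure R2))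
      (torque w)
    simp only [torque_swap, integral_neg] at h
    linarith
  rw [integral_prod _ (integrable_torque w)] at h0
  have h1 : ∀ x : R2, x 0 * inner ℝ (w x) (biotSavartC w x 0)
      + x 1 * inner ℝ (w x) (biotSavartC w x 1) = (2 * π)⁻¹ * ∫ y, torque w (x, y) := by
    intro x
    simp only [torque_eq]
    rw [integral_add (((integrable_kernel_mul w x 0).const_inner (w x)).const_mul _)
      (((integrable_kernel_mul w x 1).const_inner (w x)).const_mul _), integral_const_mul,
      integral_const_mul, inner_biotSavartC, inner_biotSavartC]
    ring
  simp only [h1, integral_const_mul, h0, mul_zero]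

end BiotSavart

/-! ### Truncated exponential weights -/

section Weights

/-- The truncated exponential `∑_{k < N} (s/4)^k / k!`. -/
def truncExp (N : ℕ) (s : ℝ) : ℝ := ∑ k ∈ Finset.range N, (s / 4) ^ k / k.factorial

theorem truncExp_succ (N : ℕ) (s : ℝ) :
    truncExp (N + 1) s = truncExp N s + (s / 4) ^ N / N.factorial :=
  Finset.sum_range_succ _ _

theorem truncExp_nonneg (N : ℕ) {s : ℝ} (hs : 0 ≤ s) : 0 ≤ truncExp N s :=
  Finset.sum_nonneg fun _ _ => by positivity

theorem truncExp_le_succ (N : ℕ) {s : ℝ} (hs : 0 ≤ s) : truncExp N s ≤ truncExp (N + 1) s := by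
  rw [truncExp_succ]
  have : 0 ≤ (s / 4) ^ N / N.factorial := by positivity
  linarith

theorem truncExp_mono {s : ℝ} (hs : 0 ≤ s) : Monotone fun N => truncExp N s :=
  monotone_nat_of_le_succ fun N => truncExp_le_succ N hs

theorem hasSum_truncExp (s : ℝ) :
    HasSum (fun k : ℕ => (s / 4) ^ k / k.factorial) (Real.exp (s / 4)) := by
  rw [Real.exp_eq_exp_ℝ]
  exact NormedSpace.expSeries_div_hasSum_exp (s / 4)

theorem tendsto_truncExp (s : ℝ) :
    Tendsto (fun N => truncExp N s) atTop (𝓝 (Real.exp (s / 4))) :=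
  (hasSum_truncExp s).tendsto_sum_nat

theorem truncExp_le_exp (N : ℕ) {s : ℝ} (hs : 0 ≤ s) : truncExp N s ≤ Real.exp (s / 4) :=
  (truncExp_mono hs).ge_of_tendsto (tendsto_truncExp s) N

theorem truncExp_succ_le (R : ℕ) (hR : 0 < R) (N : ℕ) {s : ℝ} (hs : 0 ≤ s) :
    truncExp (N + 1) s ≤ truncExp R s + s / (4 * R) * truncExp N s := by
  induction N with
  | zero =>
    have h1 : truncExp (0 + 1) s ≤ truncExp R s := truncExp_mono hs hR
    simpa [truncExp] using h1
  | succ N ih =>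
    have h0 : 0 ≤ s / (4 * R) * truncExp (N + 1) s :=
      mul_nonneg (by positivity) (truncExp_nonneg _ hs)
    rcases le_total (N + 2) R with h | h
    · have h1 : truncExp (N + 1 + 1) s ≤ truncExp R s := truncExp_mono hs h
      linarith
    rcases h.eq_or_lt with h' | h'
    · have h1 : truncExp (N + 1 + 1) s ≤ truncExp R s := truncExp_mono hs h'.ge
      linarith
    rw [truncExp_succ (N + 1), truncExp_succ N, mul_add]
    rw [truncExp_succ N] at ih
    have hRN : (R : ℝ) ≤ N + 1 := by exact_mod_cast Nat.lt_succ_iff.1 h'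
    have : (s / 4) ^ (N + 1) / (N + 1).factorial
        ≤ s / (4 * R) * ((s / 4) ^ N / N.factorial) := by
      have hRpos : (0 : ℝ) < R := by exact_mod_cast hR
      calc (s / 4) ^ (N + 1) / (N + 1).factorial
          = s / (4 * (N + 1)) * ((s / 4) ^ N / N.factorial) := by
            rw [Nat.factorial_succ]; push_cast; field_simp; ring
        _ ≤ _ := by gcongr
    linarith

theorem hasDerivAt_truncExp (N : ℕ) (s : ℝ) :
    HasDerivAt (truncExp (N + 1)) (truncExp N s / 4) s := by
  induction N with
  | zero =>
    have : truncExp (0 + 1) = fun _ => 1 := by ext; simp [truncExp]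
    rw [this]
    simpa [truncExp] using hasDerivAt_const s (1 : ℝ)
  | succ N ih =>
    have h : truncExp (N + 1 + 1)
        = fun s => truncExp (N + 1) s + (s / 4) ^ (N + 1) / (N + 1).factorial := by
      ext; rw [truncExp_succ]
    rw [h]
    have h2 := (((hasDerivAt_id s).div_const 4).pow (N + 1)).div_const ((N + 1).factorial : ℝ)
    refine (ih.add h2).congr_deriv ?_
    rw [truncExp_succ N, Nat.factorial_succ]
    push_cast
    simp
    field_simp

theorem continuous_truncExp (N : ℕ) : Continuous (truncExp N) := by
  unfold truncExp
  fun_prop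

/-- The standard basis vectors of the plane. -/
abbrev basisVec (i : Fin 2) : R2 := EuclideanSpace.single i 1

theorem hasLineDerivAt_coord (i j : Fin 2) (x : R2) :
    HasLineDerivAt ℝ (fun x : R2 => x j) (if i = j then 1 else 0) x (basisVec i) := by
  have h := ((EuclideanSpace.proj j : R2 →L[ℝ] ℝ).hasFDerivAt (x := x)).hasLineDerivAt (basisVec i)
  have h0 : (EuclideanSpace.proj j : R2 →L[ℝ] ℝ) (basisVec i) = if i = j then 1 else 0 := by
    simp [eq_comm]
  rw [h0] at h
  exact h

theorem hasLineDerivAt_radial {φ : ℝ → ℝ} {φ' : ℝ} (x : R2) (i : Fin 2)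
    (h : HasDerivAt φ φ' (‖x‖ ^ 2)) :
    HasLineDerivAt ℝ (fun x : R2 => φ (‖x‖ ^ 2)) (2 * φ' * x i) x (basisVec i) := by
  have h1 := (h.comp_hasFDerivAt x (hasStrictFDerivAt_norm_sq x).hasFDerivAt).hasLineDerivAt
    (basisVec i)
  have h0 : (φ' • (2 • innerSL ℝ x)) (basisVec i) = 2 * φ' * x i := by
    simp [EuclideanSpace.inner_single_right]
    ring
  rw [h0] at h1
  exact h1

theorem HasLineDerivAt.mul_real {f g : R2 → ℝ} {f' g' : ℝ} {x v : R2}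
    (hf : HasLineDerivAt ℝ f f' x v) (hg : HasLineDerivAt ℝ g g' x v) :
    HasLineDerivAt ℝ (fun x => f x * g x) (f' * g x + f x * g') x v := by
  unfold HasLineDerivAt at *
  have h := hf.mul hg
  simp only [zero_smul, add_zero] at h
  exact h

theorem hasTemperateGrowth_coord (i : Fin 2) : (fun x : R2 => x i).HasTemperateGrowth :=
  (EuclideanSpace.proj i : R2 →L[ℝ] ℝ).hasTemperateGrowth

theorem hasTemperateGrowth_truncExp (N : ℕ) :
    (fun x : R2 => truncExp N (‖x‖ ^ 2)).HasTemperateGrowth := by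
  have := Function.hasTemperateGrowth_norm_sq (H := R2)
  unfold truncExp
  simp only [div_eq_mul_inv]
  fun_prop

variable (w : 𝓢(R2, ℂ))

/-- The partial derivative `∂ᵢ w` as a Schwartz function. -/
abbrev partialS (i : Fin 2) (w : 𝓢(R2, ℂ)) : 𝓢(R2, ℂ) := ∂_{basisVec i} w

theorem integral_laplacian_weight (N : ℕ) (i : Fin 2) :
    Integrable (fun x => truncExp N (‖x‖ ^ 2) / 2 * x i * inner ℝ (w x) (partialS i w x)
      + truncExp (N + 1) (‖x‖ ^ 2) * (inner ℝ (partialS i w x) (partialS i w x)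
        + inner ℝ (w x) (partialS i (partialS i w) x))) ∧
    ∫ x, (truncExp N (‖x‖ ^ 2) / 2 * x i * inner ℝ (w x) (partialS i w x)
      + truncExp (N + 1) (‖x‖ ^ 2) * (inner ℝ (partialS i w x) (partialS i w x)
        + inner ℝ (w x) (partialS i (partialS i w) x))) = 0 :=
  integral_temperate_inner_deriv (hasTemperateGrowth_truncExp (N + 1))
    (fun x => by
      have h := hasLineDerivAt_radial x i (hasDerivAt_truncExp N _)
      rwa [show 2 * (truncExp N (‖x‖ ^ 2) / 4) * x i = truncExp N (‖x‖ ^ 2) / 2 * x i by ring]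
        at h) w (partialS i w)

theorem integral_radial_weight (N : ℕ) (i : Fin 2) :
    Integrable (fun x => (truncExp (N + 1) (‖x‖ ^ 2) + x i ^ 2 / 2 * truncExp N (‖x‖ ^ 2))
        * inner ℝ (w x) (w x)
      + 2 * truncExp (N + 1) (‖x‖ ^ 2) * x i * inner ℝ (w x) (partialS i w x)) ∧
    ∫ x, ((truncExp (N + 1) (‖x‖ ^ 2) + x i ^ 2 / 2 * truncExp N (‖x‖ ^ 2))
        * inner ℝ (w x) (w x)
      + 2 * truncExp (N + 1) (‖x‖ ^ 2) * x i * inner ℝ (w x) (partialS i w x)) = 0 := by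
  have h := integral_temperate_inner_deriv (μ := volume)
    ((hasTemperateGrowth_coord i).mul (hasTemperateGrowth_truncExp (N + 1)))
    (fun x => (hasLineDerivAt_coord i i x).mul_real
      (hasLineDerivAt_radial x i (hasDerivAt_truncExp N _))) w w
  simp only [Pi.mul_apply, if_true, real_inner_comm (w _) (∂_{basisVec i} w _)] at h
  convert h using 4 <;> ring

/-- The rotational derivative `ξ^⊥ · ∇` is skew with respect to radial weights. -/
theorem integral_rotation_weight {φ : ℝ → ℝ}
    (hP : (fun x : R2 => φ (‖x‖ ^ 2)).HasTemperateGrowth)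
    (hφ : ∀ s, 0 ≤ s → DifferentiableAt ℝ φ s) :
    ∫ x : R2, φ (‖x‖ ^ 2) * (x 0 * inner ℝ (w x) (partialS 1 w x)
      - x 1 * inner ℝ (w x) (partialS 0 w x)) = 0 := by
  have h := fun i j : Fin 2 => integral_temperate_inner_deriv (μ := volume)
    ((hasTemperateGrowth_coord j).mul hP)
    (fun x => (hasLineDerivAt_coord i j x).mul_real
      (hasLineDerivAt_radial x i (hφ _ (by positivity)).hasDerivAt)) w w
  have h1 := h 1 0
  have h0 := h 0 1
  have h2 := integral_sub h1.1 h0.1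
  rw [h1.2, h0.2, sub_zero] at h2
  rw [← mul_eq_zero_iff_left (two_ne_zero (α := ℝ)), ← integral_const_mul, ← h2]
  congr 1
  ext x
  rw [real_inner_comm (w x) (∂_{basisVec 0} w x), real_inner_comm (w x) (∂_{basisVec 1} w x)]
  simp
  ring

end Weights

/-! ### The swirl term and the pointwise energy identity -/

section Energy

/-- The angular velocity of the Oseen vortex as a function of `s = ‖ξ‖²`. -/
def swirlRate (s : ℝ) : ℝ := (2 * π)⁻¹ * (1 - Real.exp (-s / 4)) / s

theorem vG_apply (ξ : R2) (i : Fin 2) : vG ξ i = swirlRate (‖ξ‖ ^ 2) * perp ξ i := rfl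

/-- The regularisation of `swirlRate` obtained by shifting the denominator. -/
def swirlRateReg (ε s : ℝ) : ℝ := (2 * π)⁻¹ * (1 - Real.exp (-s / 4)) * (s + ε)⁻¹

theorem hasTemperateGrowth_inv_norm_sq_add {ε : ℝ} (hε : 0 < ε) :
    (fun x : R2 => (‖x‖ ^ 2 + ε)⁻¹).HasTemperateGrowth := by
  have h1 := Function.hasTemperateGrowth_one_add_norm_sq_rpow R2 (-1)
  have h2 : (fun x : R2 => (√ε)⁻¹ • x).HasTemperateGrowth :=
    ((√ε)⁻¹ • ContinuousLinearMap.id ℝ R2).hasTemperateGrowth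
  have h3 := (Function.HasTemperateGrowth.const ε⁻¹ (E := R2)).mul (h1.comp h2)
  have h4 : (fun x : R2 => (‖x‖ ^ 2 + ε)⁻¹) = (fun _ => ε⁻¹) *
      ((fun x : R2 => (1 + ‖x‖ ^ 2) ^ (-1 : ℝ)) ∘ fun x : R2 => (√ε)⁻¹ • x) := by
    ext x
    simp only [Pi.mul_apply, Function.comp_apply, Real.rpow_neg_one, norm_smul, norm_inv, mul_pow,
      Real.norm_of_nonneg (Real.sqrt_nonneg ε), inv_pow, Real.sq_sqrt hε.le]
    rw [← mul_inv]
    congr 1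
    field_simp
    ring
  rw [h4]
  exact h3

theorem hasTemperateGrowth_swirlRateReg {ε : ℝ} (hε : 0 < ε) (N : ℕ) :
    (fun x : R2 => truncExp N (‖x‖ ^ 2) * swirlRateReg ε (‖x‖ ^ 2)).HasTemperateGrowth := by
  have h1 := hasTemperateGrowth_truncExp N
  have h2 := hasTemperateGrowth_inv_norm_sq_add hε
  have h3 : (fun x : R2 => Real.exp (-‖x‖ ^ 2 / 4)).HasTemperateGrowth := by
    have h := (gaussianSchwartz R2 4⁻¹ (by norm_num)).hasTemperateGrowth
    have h' : (fun x : R2 => Real.exp (-‖x‖ ^ 2 / 4)) = gaussianSchwartz R2 4⁻¹ (by norm_num) := by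
      ext x
      rw [gaussianSchwartz_apply]
      congr 1
      ring
    rwa [h']
  unfold swirlRateReg
  fun_prop

theorem one_sub_exp_bounds {s : ℝ} (hs : 0 ≤ s) :
    0 ≤ 1 - Real.exp (-s / 4) ∧ 1 - Real.exp (-s / 4) ≤ s / 4 := by
  constructor
  · have : Real.exp (-s / 4) ≤ 1 := Real.exp_le_one_iff.2 (by linarith)
    linarith
  · have := Real.add_one_le_exp (-s / 4)
    linarith

theorem abs_swirlRateReg_le {ε s : ℝ} (hε : 0 < ε) (hs : 0 ≤ s) : |swirlRateReg ε s| ≤ 1 := by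
  obtain ⟨h0, h1⟩ := one_sub_exp_bounds hs
  have h2 : (2 * π)⁻¹ ≤ 1 := inv_le_one_of_one_le₀ (by linarith [Real.pi_gt_three])
  have h3 : 0 ≤ (2 * π)⁻¹ := by positivity
  rw [swirlRateReg, abs_of_nonneg (by positivity), ← div_eq_mul_inv, div_le_one (by positivity)]
  nlinarith

theorem tendsto_swirlRateReg (s : ℝ) (hs : s ≠ 0) :
    Tendsto (fun k : ℕ => swirlRateReg (1 / ((k : ℝ) + 1)) s) atTop (𝓝 (swirlRate s)) := by
  have h : Tendsto (fun k : ℕ => s + 1 / ((k : ℝ) + 1)) atTop (𝓝 (s + 0)) :=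
    tendsto_const_nhds.add tendsto_one_div_add_atTop_nhds_zero_nat
  rw [add_zero] at h
  have h2 := (h.inv₀ hs).const_mul ((2 * π)⁻¹ * (1 - Real.exp (-s / 4)))
  rwa [← div_eq_mul_inv] at h2

variable (w : 𝓢(R2, ℂ))

/-- The density `⟪w, ξ^⊥ · ∇ w⟫`. -/
def rotDensity (x : R2) : ℝ :=
  x 0 * inner ℝ (w x) (partialS 1 w x) - x 1 * inner ℝ (w x) (partialS 0 w x)

theorem integrable_truncExp_coord_inner (N : ℕ) (i : Fin 2) (f g : 𝓢(R2, ℂ)) :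
    Integrable (fun x : R2 => truncExp N (‖x‖ ^ 2) * x i * inner ℝ (f x) (g x)) :=
  integrable_temperate_inner ((hasTemperateGrowth_truncExp N).mul (hasTemperateGrowth_coord i)) f g

theorem integrable_truncExp_inner (N : ℕ) (f g : 𝓢(R2, ℂ)) :
    Integrable (fun x : R2 => truncExp N (‖x‖ ^ 2) * inner ℝ (f x) (g x)) :=
  integrable_temperate_inner (hasTemperateGrowth_truncExp N) f g

theorem integrable_sq_truncExp_inner (N : ℕ) (f g : 𝓢(R2, ℂ)) :
    Integrable (fun x : R2 => ‖x‖ ^ 2 * truncExp N (‖x‖ ^ 2) * inner ℝ (f x) (g x)) :=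
  integrable_temperate_inner
    ((Function.hasTemperateGrowth_norm_sq (H := R2)).mul (hasTemperateGrowth_truncExp N)) f g

theorem integrable_truncExp_rotDensity (N : ℕ) :
    Integrable (fun x : R2 => truncExp N (‖x‖ ^ 2) * rotDensity w x) := by
  refine ((integrable_truncExp_coord_inner N 0 w (partialS 1 w)).sub
    (integrable_truncExp_coord_inner N 1 w (partialS 0 w))).congr (Eventually.of_forall fun x => ?_)
  simp only [rotDensity, Pi.sub_apply]
  ring

theorem continuous_rotDensity : Continuous (rotDensity w) := by
  have h0 := (partialS 0 w).continuous
  have h1 := (partialS 1 w).continuous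
  have h2 := w.continuous
  unfold rotDensity
  fun_prop

theorem integral_swirl (N : ℕ) :
    Integrable (fun x : R2 => truncExp N (‖x‖ ^ 2) * swirlRate (‖x‖ ^ 2) * rotDensity w x) ∧
    ∫ x : R2, truncExp N (‖x‖ ^ 2) * swirlRate (‖x‖ ^ 2) * rotDensity w x = 0 := by
  set F : ℕ → R2 → ℝ := fun k x =>
    truncExp N (‖x‖ ^ 2) * swirlRateReg (1 / ((k : ℝ) + 1)) (‖x‖ ^ 2) * rotDensity w x
  have hε : ∀ k : ℕ, (0 : ℝ) < 1 / ((k : ℝ) + 1) := fun k => by positivity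
  have hb : ∀ k x, ‖F k x‖ ≤ ‖truncExp N (‖x‖ ^ 2) * rotDensity w x‖ := by
    intro k x
    have h := abs_swirlRateReg_le (hε k) (sq_nonneg ‖x‖)
    simp only [F, norm_mul, Real.norm_eq_abs]
    calc _ ≤ |truncExp N (‖x‖ ^ 2)| * 1 * |rotDensity w x| := by gcongr
      _ = _ := by ring
  have hlim : ∀ x, Tendsto (fun k => F k x) atTop
      (𝓝 (truncExp N (‖x‖ ^ 2) * swirlRate (‖x‖ ^ 2) * rotDensity w x)) := by
    intro x
    rcases eq_or_ne x 0 with rfl | hx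
    · simp [F, rotDensity]
    · exact ((tendsto_swirlRateReg _ (by simpa using hx)).const_mul _).mul_const _
  have hint := integrable_truncExp_rotDensity w N
  have hmeas : ∀ k, AEStronglyMeasurable (F k) := fun k => by
    have h1 := (hasTemperateGrowth_swirlRateReg (hε k) N).1.continuous
    exact (h1.mul (continuous_rotDensity w)).aestronglyMeasurable
  have hzero : ∀ k, ∫ x, F k x = 0 := fun k =>
    integral_rotation_weight w (φ := fun s => truncExp N s * swirlRateReg (1 / ((k : ℝ) + 1)) s)
      (hasTemperateGrowth_swirlRateReg (hε k) N) (fun s hs => by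
        have h1 := hε k
        have h2 : s + 1 / ((k : ℝ) + 1) ≠ 0 := by positivity
        unfold truncExp swirlRateReg
        fun_prop (disch := assumption))
  have hae : AEStronglyMeasurable
      (fun x : R2 => truncExp N (‖x‖ ^ 2) * swirlRate (‖x‖ ^ 2) * rotDensity w x) :=
    aestronglyMeasurable_of_tendsto_ae atTop hmeas (Eventually.of_forall hlim)
  constructor
  · exact hint.norm.mono' hae (Eventually.of_forall fun x =>
      le_of_tendsto (hlim x).norm (Eventually.of_forall fun k => hb k x))
  · have h := tendsto_integral_of_dominated_convergence _ hmeas hint.norm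
      (fun k => Eventually.of_forall (hb k)) (Eventually.of_forall hlim)
    simp only [hzero] at h
    exact tendsto_nhds_unique h tendsto_const_nhds |>.symm ▸ rfl

theorem pd_Gv (i : Fin 2) (ξ : R2) : pd i Gv ξ = -(ξ i / 2) * Gv ξ := by
  have h0 : HasDerivAt (fun s : ℝ => (4 * π)⁻¹ * Real.exp (-s / 4))
      ((4 * π)⁻¹ * (Real.exp (-‖ξ‖ ^ 2 / 4) * (-1 / 4))) (‖ξ‖ ^ 2) :=
    (((hasDerivAt_id _).neg.div_const 4).exp).const_mul _
  have h1 := h0.comp_hasFDerivAt ξ (hasStrictFDerivAt_norm_sq ξ).hasFDerivAt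
  have h2 : HasFDerivAt Gv _ ξ := h1
  rw [pd, h2.fderiv]
  have h3 : inner ℝ ξ (EuclideanSpace.single i (1 : ℝ)) = ξ i := by
    simp [EuclideanSpace.inner_single_right]
  simp [Gv, h3]
  ring

/-- The radial component `⟪w, ξ · (K * w)⟫` of the nonlocal velocity. -/
def radialForce (x : R2) : ℝ :=
  x 0 * inner ℝ (w x) (biotSavartC w x 0) + x 1 * inner ℝ (w x) (biotSavartC w x 1)

theorem eigen_pointwise {w : 𝓢(R2, ℂ)} {α : ℝ} {l : ℂ}
    (heig : ∀ ξ : R2, Lop (⇑w) ξ - (α : ℂ) * LamC (⇑w) ξ = l * w ξ) (x : R2) :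
    inner ℝ (w x) (partialS 0 (partialS 0 w) x) + inner ℝ (w x) (partialS 1 (partialS 1 w) x)
      + (x 0 * inner ℝ (w x) (partialS 0 w x) + x 1 * inner ℝ (w x) (partialS 1 w x)) / 2
      + inner ℝ (w x) (w x) - α * (swirlRate (‖x‖ ^ 2) * rotDensity w x)
      + α / 2 * (Gv x * radialForce w x) = l.re * inner ℝ (w x) (w x) := by
  have h := heig x
  have e1 : ∀ i x, pdC i (⇑w) x = partialS i w x := fun i x => rfl
  have e2 : ∀ i x, pdC i (pdC i (⇑w)) x = partialS i (partialS i w) x := fun i x => rfl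
  simp only [Lop, LamC, lapC, e1, e2, pd_Gv, vG_apply, perp_zero, perp_one] at h
  have hre := congrArg Complex.re h
  have him := congrArg Complex.im h
  simp [-one_div] at hre him
  simp only [rotDensity, radialForce, Complex.inner, Complex.mul_re, Complex.conj_re,
    Complex.conj_im]
  linear_combination (w x).re * hre + (w x).im * him

end Energy

/-! ### Integrated energy inequalities -/

section EnergyInequalities

variable (w : 𝓢(R2, ℂ))

/-- The twisted gradient `∂ᵢ w + (ξᵢ / 2) w = G ∂ᵢ (w / G)`. -/
def twistedGrad (i : Fin 2) (x : R2) : ℂ := partialS i w x + (x i / 2 : ℝ) • w x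

/-- The exact divergence terms appearing in the weighted energy balance. -/
def divergenceTerms (α c d : ℝ) (N : ℕ) (x : R2) : ℝ :=
  (∑ i, (truncExp (N + 1) (‖x‖ ^ 2) / 2 * x i * inner ℝ (w x) (partialS i w x)
      + truncExp (N + 1 + 1) (‖x‖ ^ 2) * (inner ℝ (partialS i w x) (partialS i w x)
        + inner ℝ (w x) (partialS i (partialS i w) x))))
  + c * (∑ i, ((truncExp (N + 1 + 1) (‖x‖ ^ 2) + x i ^ 2 / 2 * truncExp (N + 1) (‖x‖ ^ 2))
        * inner ℝ (w x) (w x)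
      + 2 * truncExp (N + 1 + 1) (‖x‖ ^ 2) * x i * inner ℝ (w x) (partialS i w x)))
  + d * (∑ i, ((truncExp (N + 1) (‖x‖ ^ 2) + x i ^ 2 / 2 * truncExp N (‖x‖ ^ 2))
        * inner ℝ (w x) (w x)
      + 2 * truncExp (N + 1) (‖x‖ ^ 2) * x i * inner ℝ (w x) (partialS i w x)))
  - α * (truncExp (N + 1 + 1) (‖x‖ ^ 2) * swirlRate (‖x‖ ^ 2) * rotDensity w x)

theorem integral_divergenceTerms (α c d : ℝ) (N : ℕ) :
    Integrable (divergenceTerms w α c d N) ∧ ∫ x, divergenceTerms w α c d N x = 0 := by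
  have h1 := integral_laplacian_weight w (N + 1)
  have h2 := integral_radial_weight w (N + 1)
  have h3 := integral_radial_weight w N
  have h4 := integral_swirl w (N + 1 + 1)
  have i1 := integrable_finsetSum Finset.univ fun i _ => (h1 i).1
  have i2 := (integrable_finsetSum Finset.univ fun i _ => (h2 i).1).const_mul c
  have i3 := (integrable_finsetSum Finset.univ fun i _ => (h3 i).1).const_mul d
  have i4 := h4.1.const_mul α
  refine ⟨((i1.add i2).add i3).sub i4, ?_⟩
  have h := integral_sub' ((i1.add i2).add i3) i4
  rw [integral_add' (i1.add i2) i3, integral_add' i1 i2,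
    integral_const_mul, integral_const_mul, integral_const_mul, h4.2,
    integral_finsetSum _ fun i _ => (h1 i).1, integral_finsetSum _ fun i _ => (h2 i).1,
    integral_finsetSum _ fun i _ => (h3 i).1] at h
  simp only [(h1 _).2, (h2 _).2, (h3 _).2, Finset.sum_const_zero, mul_zero, add_zero,
    sub_zero] at h
  exact h

theorem truncExp_mul_Gv_le (N : ℕ) (x : R2) :
    0 ≤ truncExp N (‖x‖ ^ 2) * Gv x ∧ truncExp N (‖x‖ ^ 2) * Gv x ≤ 1 := by
  have h0 := truncExp_nonneg N (sq_nonneg ‖x‖)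
  have hG : 0 ≤ Gv x := by unfold Gv; positivity
  refine ⟨mul_nonneg h0 hG, ?_⟩
  have h2 : (4 * π)⁻¹ ≤ 1 := inv_le_one_of_one_le₀ (by linarith [Real.pi_gt_three])
  calc _ ≤ Real.exp (‖x‖ ^ 2 / 4) * Gv x :=
        mul_le_mul_of_nonneg_right (truncExp_le_exp N (sq_nonneg ‖x‖)) hG
    _ = (4 * π)⁻¹ := by
        rw [Gv, mul_left_comm, ← Real.exp_add, neg_div, add_neg_cancel, Real.exp_zero, mul_one]
    _ ≤ 1 := h2

theorem exp_mul_Gv (x : R2) : Real.exp (‖x‖ ^ 2 / 4) * Gv x = (4 * π)⁻¹ := by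
  rw [Gv, mul_left_comm, ← Real.exp_add, neg_div, add_neg_cancel, Real.exp_zero, mul_one]

theorem integrable_radialForce : Integrable (radialForce w) := by
  obtain ⟨M, hM, h⟩ := exists_biotSavartC_bound w
  have hxw : Integrable (fun x : R2 => ‖x‖ * ‖w x‖) := by
    simpa using w.integrable_pow_mul volume 1
  have hc : ∀ i : Fin 2, AEStronglyMeasurable (fun x : R2 => x i) := fun i =>
    (EuclideanSpace.proj i : R2 →L[ℝ] ℝ).continuous.aestronglyMeasurable
  have hi : ∀ i, AEStronglyMeasurable (fun x => inner ℝ (w x) (biotSavartC w x i)) := fun i =>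
    w.continuous.aestronglyMeasurable.inner (aestronglyMeasurable_biotSavartC w i)
  refine (hxw.const_mul (2 * M)).mono' (((hc 0).mul (hi 0)).add ((hc 1).mul (hi 1)))
    (Eventually.of_forall fun x => ?_)
  have hb : ∀ i, |x i * inner ℝ (w x) (biotSavartC w x i)| ≤ ‖x‖ * (‖w x‖ * M) := fun i => by
    rw [abs_mul]
    gcongr
    · exact abs_coord_le_norm x i
    · exact (abs_real_inner_le_norm _ _).trans (by gcongr; exact h x i)
  calc ‖radialForce w x‖ ≤ ‖x‖ * (‖w x‖ * M) + ‖x‖ * (‖w x‖ * M) :=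
        (abs_add_le _ _).trans (add_le_add (hb 0) (hb 1))
    _ = _ := by ring

theorem norm_truncExp_mul_Gv_mul_radialForce_le (N : ℕ) (x : R2) :
    ‖truncExp N (‖x‖ ^ 2) * Gv x * radialForce w x‖ ≤ ‖radialForce w x‖ := by
  obtain ⟨h0, h1⟩ := truncExp_mul_Gv_le N x
  rw [norm_mul, Real.norm_of_nonneg h0]
  exact mul_le_of_le_one_left (norm_nonneg _) h1

theorem continuous_Gv : Continuous Gv := by
  unfold Gv
  fun_prop

theorem aestronglyMeasurable_truncExp_mul_Gv_mul_radialForce (N : ℕ) :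
    AEStronglyMeasurable (fun x => truncExp N (‖x‖ ^ 2) * Gv x * radialForce w x) :=
  (((continuous_truncExp N).comp (by fun_prop)).mul continuous_Gv).aestronglyMeasurable.mul
    (integrable_radialForce w).1

theorem integrable_truncExp_mul_Gv_mul_radialForce (N : ℕ) :
    Integrable (fun x => truncExp N (‖x‖ ^ 2) * Gv x * radialForce w x) :=
  (integrable_radialForce w).norm.mono'
    (aestronglyMeasurable_truncExp_mul_Gv_mul_radialForce w N)
    (Eventually.of_forall fun x => norm_truncExp_mul_Gv_mul_radialForce_le w N x)

theorem tendsto_integral_radialForce :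
    Tendsto (fun N => ∫ x, truncExp N (‖x‖ ^ 2) * Gv x * radialForce w x) atTop (𝓝 0) := by
  have h := tendsto_integral_of_dominated_convergence (fun x => ‖radialForce w x‖)
    (F := fun N x => truncExp N (‖x‖ ^ 2) * Gv x * radialForce w x)
    (f := fun x => Real.exp (‖x‖ ^ 2 / 4) * Gv x * radialForce w x)
    (aestronglyMeasurable_truncExp_mul_Gv_mul_radialForce w) (integrable_radialForce w).norm
    (fun N => Eventually.of_forall (norm_truncExp_mul_Gv_mul_radialForce_le w N))
    (Eventually.of_forall fun x => ((tendsto_truncExp _).mul_const _).mul_const _)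
  simp only [exp_mul_Gv, integral_const_mul] at h
  rwa [show ∫ x, radialForce w x = 0 from integral_radial_biotSavartC w, mul_zero] at h

theorem inner_twistedGrad (i : Fin 2) (x : R2) :
    inner ℝ (twistedGrad w i x) (twistedGrad w i x) = inner ℝ (partialS i w x) (partialS i w x)
      + x i * inner ℝ (w x) (partialS i w x) + x i ^ 2 / 4 * inner ℝ (w x) (w x) := by
  simp only [twistedGrad, inner_add_left, inner_add_right, real_inner_smul_left,
    real_inner_smul_right, real_inner_comm (w x) (partialS i w x)]
  ring

theorem inner_add_smul_self_nonneg (i : Fin 2) (x : R2) :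
    0 ≤ inner ℝ (partialS i w x) (partialS i w x)
      + x i / 2 * inner ℝ (w x) (partialS i w x) + x i ^ 2 / 16 * inner ℝ (w x) (w x) := by
  have h : 0 ≤ inner ℝ (partialS i w x + (x i / 4) • w x) (partialS i w x + (x i / 4) • w x) :=
    real_inner_self_nonneg
  simp only [inner_add_left, inner_add_right, real_inner_smul_left, real_inner_smul_right,
    real_inner_comm (w x) (partialS i w x)] at h
  linarith

variable {w} {α : ℝ} {l : ℂ}

theorem weighted_energy_bound
    (heig : ∀ ξ : R2, Lop (⇑w) ξ - (α : ℂ) * LamC (⇑w) ξ = l * w ξ) (N : ℕ) :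
    l.re * (∫ x, truncExp (N + 2) (‖x‖ ^ 2) * inner ℝ (w x) (w x))
      + 16⁻¹ * ∫ x, ‖x‖ ^ 2 * truncExp (N + 1) (‖x‖ ^ 2) * inner ℝ (w x) (w x)
      ≤ 2⁻¹ * (∫ x, truncExp (N + 2) (‖x‖ ^ 2) * inner ℝ (w x) (w x))
      + α / 2 * ∫ x, truncExp (N + 2) (‖x‖ ^ 2) * Gv x * radialForce w x := by
  have hD := integral_divergenceTerms w α 4⁻¹ 0 N
  have i1 := integrable_truncExp_inner (N + 2) w w
  have i2 := integrable_sq_truncExp_inner (N + 1) w w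
  have i3 := integrable_truncExp_mul_Gv_mul_radialForce w (N + 2)
  have hle : ∀ x, (l.re - 2⁻¹) * (truncExp (N + 2) (‖x‖ ^ 2) * inner ℝ (w x) (w x))
      + 16⁻¹ * (‖x‖ ^ 2 * truncExp (N + 1) (‖x‖ ^ 2) * inner ℝ (w x) (w x))
      - α / 2 * (truncExp (N + 2) (‖x‖ ^ 2) * Gv x * radialForce w x)
      ≤ divergenceTerms w α 4⁻¹ 0 N x := by
    intro x
    have he := congrArg (truncExp (N + 2) (‖x‖ ^ 2) * ·) (eigen_pointwise heig x)
    have hr := truncExp_nonneg (N + 1) (sq_nonneg ‖x‖)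
    have hp : truncExp (N + 1) (‖x‖ ^ 2) ≤ truncExp (N + 2) (‖x‖ ^ 2) :=
      truncExp_le_succ _ (sq_nonneg ‖x‖)
    have h0 := mul_nonneg hr (inner_add_smul_self_nonneg w 0 x)
    have h1 := mul_nonneg hr (inner_add_smul_self_nonneg w 1 x)
    have h2 := mul_nonneg (sub_nonneg.2 hp)
      (real_inner_self_nonneg (x := partialS 0 w x))
    have h3 := mul_nonneg (sub_nonneg.2 hp)
      (real_inner_self_nonneg (x := partialS 1 w x))
    simp only [divergenceTerms, Fin.sum_univ_two]
    rw [norm_sq_eq_coord x] at *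
    linarith
  have h := integral_mono (((i1.const_mul _).add (i2.const_mul _)).sub (i3.const_mul _)) hD.1 hle
  rw [hD.2] at h
  rw [integral_sub' ((i1.const_mul _).add (i2.const_mul _)) (i3.const_mul _),
    integral_add' (i1.const_mul _) (i2.const_mul _), integral_const_mul, integral_const_mul,
    integral_const_mul] at h
  linarith

theorem integrable_truncExp_twistedGrad (N : ℕ) :
    Integrable (fun x => truncExp N (‖x‖ ^ 2) * (inner ℝ (twistedGrad w 0 x) (twistedGrad w 0 x)
      + inner ℝ (twistedGrad w 1 x) (twistedGrad w 1 x))) := by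
  have h := (((integrable_truncExp_inner N (partialS 0 w) (partialS 0 w)).add
    (integrable_truncExp_inner N (partialS 1 w) (partialS 1 w))).add
    ((integrable_truncExp_coord_inner N 0 w (partialS 0 w)).add
    (integrable_truncExp_coord_inner N 1 w (partialS 1 w)))).add
    ((integrable_sq_truncExp_inner N w w).const_mul 4⁻¹)
  refine h.congr (Eventually.of_forall fun x => ?_)
  simp only [Pi.add_apply, inner_twistedGrad, norm_sq_eq_coord]
  ring

theorem integrable_sq_term_inner (N : ℕ) :
    Integrable (fun x => ‖x‖ ^ 2 / 4 * ((‖x‖ ^ 2 / 4) ^ N / N.factorial)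
      * inner ℝ (w x) (w x)) := by
  refine (((integrable_sq_truncExp_inner (N + 1) w w).sub
    (integrable_sq_truncExp_inner N w w)).const_mul 4⁻¹).congr (Eventually.of_forall fun x => ?_)
  simp only [Pi.sub_apply, truncExp_succ N]
  ring

theorem weighted_energy_inequality
    (heig : ∀ ξ : R2, Lop (⇑w) ξ - (α : ℂ) * LamC (⇑w) ξ = l * w ξ) (N : ℕ) :
    l.re * (∫ x, truncExp (N + 2) (‖x‖ ^ 2) * inner ℝ (w x) (w x))
      + ∫ x, truncExp (N + 2) (‖x‖ ^ 2) * (inner ℝ (twistedGrad w 0 x) (twistedGrad w 0 x)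
        + inner ℝ (twistedGrad w 1 x) (twistedGrad w 1 x))
      ≤ (∫ x, ‖x‖ ^ 2 / 4 * ((‖x‖ ^ 2 / 4) ^ (N + 1) / (N + 1).factorial) * inner ℝ (w x) (w x))
      + α / 2 * ∫ x, truncExp (N + 2) (‖x‖ ^ 2) * Gv x * radialForce w x := by
  have hD := integral_divergenceTerms w α (3 / 4) (-(1 / 4)) N
  have i1 := integrable_truncExp_inner (N + 2) w w
  have i2 := integrable_truncExp_twistedGrad (w := w) (N + 2)
  have i3 := integrable_truncExp_mul_Gv_mul_radialForce w (N + 2)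
  have i4 := integrable_sq_term_inner (w := w) (N + 1)
  have hle : ∀ x, l.re * (truncExp (N + 2) (‖x‖ ^ 2) * inner ℝ (w x) (w x))
      + truncExp (N + 2) (‖x‖ ^ 2) * (inner ℝ (twistedGrad w 0 x) (twistedGrad w 0 x)
        + inner ℝ (twistedGrad w 1 x) (twistedGrad w 1 x))
      - ‖x‖ ^ 2 / 4 * ((‖x‖ ^ 2 / 4) ^ (N + 1) / (N + 1).factorial) * inner ℝ (w x) (w x)
      - α / 2 * (truncExp (N + 2) (‖x‖ ^ 2) * Gv x * radialForce w x)
      ≤ divergenceTerms w α (3 / 4) (-(1 / 4)) N x := by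
    intro x
    have he := congrArg (truncExp (N + 2) (‖x‖ ^ 2) * ·) (eigen_pointwise heig x)
    have hr : truncExp N (‖x‖ ^ 2) ≤ truncExp (N + 1) (‖x‖ ^ 2) :=
      truncExp_le_succ _ (sq_nonneg ‖x‖)
    have ht : (‖x‖ ^ 2 / 4) ^ (N + 1) / (N + 1).factorial
        = truncExp (N + 2) (‖x‖ ^ 2) - truncExp (N + 1) (‖x‖ ^ 2) := by
      rw [truncExp_succ (N + 1)]; ring
    have hn := mul_nonneg (mul_nonneg (sq_nonneg ‖x‖) (sub_nonneg.2 hr))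
      (real_inner_self_nonneg (x := w x))
    have hn' : 0 ≤ (truncExp (N + 2) (‖x‖ ^ 2) - truncExp (N + 1) (‖x‖ ^ 2))
      * inner ℝ (w x) (w x) := mul_nonneg (sub_nonneg.2 (truncExp_le_succ _ (sq_nonneg ‖x‖)))
      (real_inner_self_nonneg (x := w x))
    simp only [divergenceTerms, Fin.sum_univ_two, inner_twistedGrad, ht]
    rw [norm_sq_eq_coord x] at *
    linarith
  have h := integral_mono ((((i1.const_mul _).add i2).sub i4).sub (i3.const_mul _)) hD.1 hle
  rw [hD.2] at h
  rw [integral_sub' (((i1.const_mul _).add i2).sub i4) (i3.const_mul _),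
    integral_sub' ((i1.const_mul _).add i2) i4, integral_add' (i1.const_mul _) i2,
    integral_const_mul, integral_const_mul] at h
  linarith

end EnergyInequalities

/-! ### Passage to the full Gaussian weight -/

section GaussianWeight

theorem integrable_exp_mul_of_bounded {f : R2 → ℝ} (hf : ∀ x, 0 ≤ f x)
    (hint : ∀ N, Integrable fun x => truncExp N (‖x‖ ^ 2) * f x) {B : ℝ} {N₀ : ℕ}
    (hB : ∀ N, N₀ ≤ N → ∫ x, truncExp N (‖x‖ ^ 2) * f x ≤ B) :
    Integrable fun x => Real.exp (‖x‖ ^ 2 / 4) * f x := by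
  have hlim : ∀ x : R2, Tendsto (fun N => truncExp N (‖x‖ ^ 2) * f x) atTop
      (𝓝 (Real.exp (‖x‖ ^ 2 / 4) * f x)) := fun x =>
    (tendsto_truncExp (‖x‖ ^ 2)).mul_const (f x)
  refine ⟨aestronglyMeasurable_of_tendsto_ae atTop (fun N => (hint N).1)
    (Eventually.of_forall hlim), lt_of_le_of_lt ?_ (ENNReal.ofReal_lt_top (r := B))⟩
  refine (lintegral_congr fun x => (hlim x).enorm.liminf_eq.symm).trans_le
    ((lintegral_liminf_le' fun N => (hint N).1.aemeasurable.enorm).trans ?_)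
  refine liminf_le_of_frequently_le' (Eventually.frequently ?_)
  filter_upwards [eventually_ge_atTop N₀] with N hN
  have h0 : ∀ x, 0 ≤ truncExp N (‖x‖ ^ 2) * f x := fun x =>
    mul_nonneg (truncExp_nonneg N (sq_nonneg _)) (hf x)
  simp only [Real.enorm_of_nonneg (h0 _)]
  rw [← ofReal_integral_eq_lintegral_ofReal (hint N) (Eventually.of_forall h0)]
  exact ENNReal.ofReal_le_ofReal (hB N hN)

theorem tendsto_integral_truncExp {f : R2 → ℝ} (hf : ∀ x, 0 ≤ f x)
    (hint : ∀ N, Integrable fun x => truncExp N (‖x‖ ^ 2) * f x)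
    (he : Integrable fun x => Real.exp (‖x‖ ^ 2 / 4) * f x) :
    Tendsto (fun N => ∫ x, truncExp N (‖x‖ ^ 2) * f x) atTop
      (𝓝 (∫ x, Real.exp (‖x‖ ^ 2 / 4) * f x)) := by
  refine tendsto_integral_of_dominated_convergence _ (fun N => (hint N).1) he
    (fun N => Eventually.of_forall fun x => ?_)
    (Eventually.of_forall fun x => (tendsto_truncExp (‖x‖ ^ 2)).mul_const (f x))
  rw [Real.norm_of_nonneg (mul_nonneg (truncExp_nonneg N (sq_nonneg _)) (hf x))]
  exact mul_le_mul_of_nonneg_right (truncExp_le_exp N (sq_nonneg _)) (hf x)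

variable {w : 𝓢(R2, ℂ)} {α : ℝ} {l : ℂ}

theorem exists_sq_truncExp_bound
    (heig : ∀ ξ : R2, Lop (⇑w) ξ - (α : ℂ) * LamC (⇑w) ξ = l * w ξ) :
    ∃ B : ℝ, ∀ N, 1 ≤ N →
      ∫ x, truncExp N (‖x‖ ^ 2) * (‖x‖ ^ 2 * inner ℝ (w x) (w x)) ≤ B := by
  obtain ⟨R, hR⟩ := exists_nat_gt (8 * |2⁻¹ - l.re| )
  have hRpos : (0 : ℝ) < R := lt_of_le_of_lt (by positivity) hR
  set K := |2⁻¹ - l.re| with hK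
  refine ⟨32 * (K * (∫ x, truncExp R (‖x‖ ^ 2) * inner ℝ (w x) (w x))
    + |α / 2| * ∫ x, ‖radialForce w x‖), fun N hN => ?_⟩
  obtain ⟨N, rfl⟩ := Nat.exists_eq_add_of_le' hN
  have h1 := weighted_energy_bound heig N
  have iN := integrable_sq_truncExp_inner (N + 1) w w
  have iR := integrable_truncExp_inner R w w
  have iP := integrable_truncExp_inner (N + 2) w w
  have h2 : ∫ x, truncExp (N + 2) (‖x‖ ^ 2) * inner ℝ (w x) (w x)
      ≤ (∫ x, truncExp R (‖x‖ ^ 2) * inner ℝ (w x) (w x))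
      + (4 * R : ℝ)⁻¹ * ∫ x, ‖x‖ ^ 2 * truncExp (N + 1) (‖x‖ ^ 2) * inner ℝ (w x) (w x) := by
    rw [← integral_const_mul, ← integral_add iR (iN.const_mul _)]
    refine integral_mono iP (iR.add (iN.const_mul _)) fun x => ?_
    have h := mul_le_mul_of_nonneg_right
      (truncExp_succ_le R (by exact_mod_cast hRpos) (N + 1) (sq_nonneg ‖x‖))
      (real_inner_self_nonneg (x := w x))
    calc _ ≤ _ := h
      _ = _ := by ring
  have h3 : |∫ x, truncExp (N + 2) (‖x‖ ^ 2) * Gv x * radialForce w x|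
      ≤ ∫ x, ‖radialForce w x‖ :=
    norm_integral_le_of_norm_le (integrable_radialForce w).norm
      (Eventually.of_forall (norm_truncExp_mul_Gv_mul_radialForce_le w (N + 2)))
  have h4 : α / 2 * ∫ x, truncExp (N + 2) (‖x‖ ^ 2) * Gv x * radialForce w x
      ≤ |α / 2| * ∫ x, ‖radialForce w x‖ := by
    refine (le_abs_self _).trans ?_
    rw [abs_mul]
    gcongr
  have hP0 : 0 ≤ ∫ x, truncExp (N + 2) (‖x‖ ^ 2) * inner ℝ (w x) (w x) :=
    integral_nonneg fun x => mul_nonneg (truncExp_nonneg _ (sq_nonneg _)) real_inner_self_nonneg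
  have hS0 : 0 ≤ ∫ x, ‖x‖ ^ 2 * truncExp (N + 1) (‖x‖ ^ 2) * inner ℝ (w x) (w x) :=
    integral_nonneg fun x => mul_nonneg (mul_nonneg (sq_nonneg _)
      (truncExp_nonneg _ (sq_nonneg _))) real_inner_self_nonneg
  have hrew : ∫ x, truncExp (N + 1) (‖x‖ ^ 2) * (‖x‖ ^ 2 * inner ℝ (w x) (w x))
      = ∫ x, ‖x‖ ^ 2 * truncExp (N + 1) (‖x‖ ^ 2) * inner ℝ (w x) (w x) := by
    congr 1
    ext x
    ring
  rw [hrew]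
  set S := ∫ x, ‖x‖ ^ 2 * truncExp (N + 1) (‖x‖ ^ 2) * inner ℝ (w x) (w x)
  set P := ∫ x, truncExp (N + 2) (‖x‖ ^ 2) * inner ℝ (w x) (w x)
  have h5 : (2⁻¹ - l.re) * P ≤ K * P := mul_le_mul_of_nonneg_right (le_abs_self _) hP0
  have h6 := mul_le_mul_of_nonneg_left h2 (abs_nonneg (2⁻¹ - l.re))
  rw [← hK] at h6
  have h7 : K * ((4 * R : ℝ)⁻¹ * S) ≤ 32⁻¹ * S := by
    rw [← mul_assoc]
    refine mul_le_mul_of_nonneg_right ?_ hS0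
    rw [← div_eq_mul_inv, div_le_iff₀ (by positivity)]
    linarith
  linarith

theorem integrable_exp_sq_inner
    (heig : ∀ ξ : R2, Lop (⇑w) ξ - (α : ℂ) * LamC (⇑w) ξ = l * w ξ) :
    Integrable fun x => Real.exp (‖x‖ ^ 2 / 4) * (‖x‖ ^ 2 * inner ℝ (w x) (w x)) := by
  obtain ⟨B, hB⟩ := exists_sq_truncExp_bound heig
  refine integrable_exp_mul_of_bounded
    (fun x => mul_nonneg (sq_nonneg _) real_inner_self_nonneg) (fun N => ?_) hB
  refine (integrable_sq_truncExp_inner N w w).congr (Eventually.of_forall fun x => ?_)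
  ring

theorem integrable_exp_inner
    (heig : ∀ ξ : R2, Lop (⇑w) ξ - (α : ℂ) * LamC (⇑w) ξ = l * w ξ) :
    Integrable fun x => Real.exp (‖x‖ ^ 2 / 4) * inner ℝ (w x) (w x) := by
  have hw : Integrable fun x => inner ℝ (w x) (w x) := by
    have := integrable_truncExp_inner 1 w w
    simpa [truncExp] using this
  have hc := w.continuous
  refine ((hw.const_mul (Real.exp 4⁻¹)).add (integrable_exp_sq_inner heig)).mono'
    (Continuous.aestronglyMeasurable (by fun_prop)) (Eventually.of_forall fun x => ?_)
  have hn : 0 ≤ inner ℝ (w x) (w x) := real_inner_self_nonneg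
  rw [Real.norm_of_nonneg (by positivity)]
  simp only [Pi.add_apply]
  rcases le_total (‖x‖ ^ 2) 1 with h | h
  · have : Real.exp (‖x‖ ^ 2 / 4) ≤ Real.exp 4⁻¹ := Real.exp_le_exp.2 (by linarith)
    have h1 := mul_le_mul_of_nonneg_right this hn
    have : 0 ≤ Real.exp (‖x‖ ^ 2 / 4) * (‖x‖ ^ 2 * inner ℝ (w x) (w x)) := by positivity
    linarith
  · have h1 : inner ℝ (w x) (w x) ≤ ‖x‖ ^ 2 * inner ℝ (w x) (w x) := le_mul_of_one_le_left hn h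
    have h2 := mul_le_mul_of_nonneg_left h1 (Real.exp_pos (‖x‖ ^ 2 / 4)).le
    have : 0 ≤ Real.exp 4⁻¹ * inner ℝ (w x) (w x) := by positivity
    linarith

theorem tendsto_integral_top_term
    (heig : ∀ ξ : R2, Lop (⇑w) ξ - (α : ℂ) * LamC (⇑w) ξ = l * w ξ) :
    Tendsto (fun N : ℕ => ∫ x, ‖x‖ ^ 2 / 4 * ((‖x‖ ^ 2 / 4) ^ (N + 1) / (N + 1).factorial)
      * inner ℝ (w x) (w x)) atTop (𝓝 0) := by
  have h := tendsto_integral_of_dominated_convergence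
    (F := fun (N : ℕ) (x : R2) => ‖x‖ ^ 2 / 4 * ((‖x‖ ^ 2 / 4) ^ (N + 1) / (N + 1).factorial)
      * inner ℝ (w x) (w x)) (f := fun _ => 0) _
    (fun N => (integrable_sq_term_inner (w := w) (N + 1)).1) (integrable_exp_sq_inner heig)
    (fun N => Eventually.of_forall fun x => ?_) (Eventually.of_forall fun x => ?_)
  · simpa using h
  · have hn : 0 ≤ inner ℝ (w x) (w x) := real_inner_self_nonneg
    rw [Real.norm_of_nonneg (by positivity)]
    have h1 : (‖x‖ ^ 2 / 4) ^ (N + 1) / (N + 1).factorial ≤ Real.exp (‖x‖ ^ 2 / 4) :=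
      Real.pow_div_factorial_le_exp _ (by positivity) _
    calc _ ≤ ‖x‖ ^ 2 / 1 * Real.exp (‖x‖ ^ 2 / 4) * inner ℝ (w x) (w x) := by
          gcongr
          norm_num
      _ = _ := by ring
  · have h1 := (FloorSemiring.tendsto_pow_div_factorial_atTop (‖x‖ ^ 2 / 4)).comp
      (tendsto_add_atTop_nat 1)
    simpa using (h1.const_mul (‖x‖ ^ 2 / 4)).mul_const (inner ℝ (w x) (w x))

theorem gaussian_energy_inequality
    (heig : ∀ ξ : R2, Lop (⇑w) ξ - (α : ℂ) * LamC (⇑w) ξ = l * w ξ) :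
    Integrable (fun x => Real.exp (‖x‖ ^ 2 / 4) *
      (inner ℝ (twistedGrad w 0 x) (twistedGrad w 0 x)
        + inner ℝ (twistedGrad w 1 x) (twistedGrad w 1 x))) ∧
    l.re * (∫ x, Real.exp (‖x‖ ^ 2 / 4) * inner ℝ (w x) (w x))
      + ∫ x, Real.exp (‖x‖ ^ 2 / 4) * (inner ℝ (twistedGrad w 0 x) (twistedGrad w 0 x)
        + inner ℝ (twistedGrad w 1 x) (twistedGrad w 1 x)) ≤ 0 := by
  have hn : ∀ x, 0 ≤ inner ℝ (w x) (w x) := fun x => real_inner_self_nonneg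
  have hF : ∀ x, 0 ≤ inner ℝ (twistedGrad w 0 x) (twistedGrad w 0 x)
      + inner ℝ (twistedGrad w 1 x) (twistedGrad w 1 x) := fun x =>
    add_nonneg real_inner_self_nonneg real_inner_self_nonneg
  have t1 := (tendsto_integral_truncExp hn (fun N => integrable_truncExp_inner N w w)
    (integrable_exp_inner heig)).comp (tendsto_add_atTop_nat 2)
  have t2 := (tendsto_integral_radialForce w).comp (tendsto_add_atTop_nat 2)
  have t3 := (tendsto_integral_top_term heig).add (t2.const_mul (α / 2))
  have t4 := t3.sub (t1.const_mul l.re)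
  have hineq := weighted_energy_inequality heig
  have hint : Integrable (fun x => Real.exp (‖x‖ ^ 2 / 4) *
      (inner ℝ (twistedGrad w 0 x) (twistedGrad w 0 x)
        + inner ℝ (twistedGrad w 1 x) (twistedGrad w 1 x))) := by
    obtain ⟨B, hB⟩ := t4.bddAbove_range
    refine integrable_exp_mul_of_bounded hF (fun N => integrable_truncExp_twistedGrad N)
      (B := B) (N₀ := 2) fun N hN => ?_
    obtain ⟨N, rfl⟩ := Nat.exists_eq_add_of_le' hN
    have h := hB ⟨N, rfl⟩
    have h1 := hineq N
    simp only [Function.comp_apply] at h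
    linarith
  refine ⟨hint, ?_⟩
  have t5 := (tendsto_integral_truncExp hF (fun N => integrable_truncExp_twistedGrad N)
    hint).comp (tendsto_add_atTop_nat 2)
  have h := le_of_tendsto_of_tendsto' ((t1.const_mul l.re).add t5) t3 hineq
  simpa using h

end GaussianWeight

/-! ### Hermite functions on the plane -/

section Hermite

/-- Hermite polynomials orthogonal with respect to `e^{-x²/4}`. -/
def hermiteFn : ℕ → ℝ → ℝ
  | 0, _ => 1
  | 1, x => x / 2
  | n + 2, x => x / 2 * hermiteFn (n + 1) x - (n + 1) / 2 * hermiteFn n x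

theorem hermiteFn_succ (n : ℕ) (x : ℝ) :
    hermiteFn (n + 1) x = x / 2 * hermiteFn n x - n / 2 * hermiteFn (n - 1) x := by
  cases n with
  | zero => simp [hermiteFn]
  | succ n => simp [hermiteFn]

theorem hasDerivAt_hermiteFn (n : ℕ) (x : ℝ) :
    HasDerivAt (hermiteFn n) (n / 2 * hermiteFn (n - 1) x) x := by
  induction n using Nat.strong_induction_on with
  | _ n ih =>
    match n with
    | 0 =>
      have : hermiteFn 0 = fun _ => 1 := by ext; simp [hermiteFn]
      rw [this]
      simpa using hasDerivAt_const x (1 : ℝ)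
    | 1 =>
      have : hermiteFn 1 = fun x => x / 2 := by ext; simp [hermiteFn]
      rw [this]
      simpa [hermiteFn] using (hasDerivAt_id x).div_const 2
    | n + 2 =>
      have : hermiteFn (n + 2)
          = fun x => x / 2 * hermiteFn (n + 1) x - (n + 1) / 2 * hermiteFn n x := by
        ext; simp [hermiteFn]
      rw [this]
      have h1 := ih (n + 1) (by omega)
      have h0 := ih n (by omega)
      refine ((((hasDerivAt_id x).div_const 2).mul h1).sub (h0.const_mul _)).congr_deriv ?_
      have h2 := hermiteFn_succ n x
      simp only [Nat.add_sub_cancel, show n + 2 - 1 = n + 1 by omega, id]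
      rw [h2]
      push_cast
      ring

theorem hasTemperateGrowth_hermiteFn (n : ℕ) (i : Fin 2) :
    (fun x : R2 => hermiteFn n (x i)).HasTemperateGrowth := by
  have hc := hasTemperateGrowth_coord i
  induction n using Nat.strong_induction_on with
  | _ n ih =>
    match n with
    | 0 => simp [hermiteFn]
    | 1 =>
      simp only [hermiteFn, div_eq_mul_inv]
      fun_prop
    | n + 2 =>
      have h1 := ih (n + 1) (by omega)
      have h0 := ih n (by omega)
      simp only [hermiteFn, div_eq_mul_inv]
      fun_prop

/-- Products of Hermite polynomials in the two coordinates. -/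
def hermite2 (β : Fin 2 → ℕ) (x : R2) : ℝ := hermiteFn (β 0) (x 0) * hermiteFn (β 1) (x 1)

theorem hasTemperateGrowth_hermite2 (β : Fin 2 → ℕ) : (hermite2 β).HasTemperateGrowth :=
  (hasTemperateGrowth_hermiteFn (β 0) 0).mul (hasTemperateGrowth_hermiteFn (β 1) 1)

@[simp] theorem hermite2_zero (x : R2) : hermite2 0 x = 1 := by simp [hermite2, hermiteFn]

theorem hermite2_succ (β : Fin 2 → ℕ) (i : Fin 2) (x : R2) :
    hermite2 (β + Pi.single i 1) x
      = x i / 2 * hermite2 β x - β i / 2 * hermite2 (β - Pi.single i 1) x := by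
  fin_cases i <;> simp [hermite2, hermiteFn_succ] <;> ring

theorem hasLineDerivAt_hermite2 (β : Fin 2 → ℕ) (i : Fin 2) (x : R2) :
    HasLineDerivAt ℝ (hermite2 β) (β i / 2 * hermite2 (β - Pi.single i 1) x) x (basisVec i) := by
  have h : ∀ j, HasLineDerivAt ℝ (fun x : R2 => hermiteFn (β j) (x j))
      ((β j / 2 * hermiteFn (β j - 1) (x j)) * (if i = j then 1 else 0)) x (basisVec i) := by
    intro j
    have h1 := hasLineDerivAt_coord i j x
    unfold HasLineDerivAt at h1 ⊢
    have h2 : HasDerivAt (hermiteFn (β j)) (β j / 2 * hermiteFn (β j - 1) (x j))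
        ((x + (0 : ℝ) • basisVec i) j) := by
      simpa using hasDerivAt_hermiteFn (β j) (x j)
    exact h2.comp (0 : ℝ) h1
  have h3 := (h 0).mul_real (h 1)
  have h4 : β i / 2 * hermite2 (β - Pi.single i 1) x
      = (β 0 / 2 * hermiteFn (β 0 - 1) (x 0)) * (if i = 0 then 1 else 0) * hermiteFn (β 1) (x 1)
      + hermiteFn (β 0) (x 0) *
        ((β 1 / 2 * hermiteFn (β 1 - 1) (x 1)) * (if i = 1 then 1 else 0)) := by
    fin_cases i <;> simp [hermite2] <;> ring
  rw [h4]
  exact h3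

/-- Raising a Hermite index against `f` amounts to pairing with `∂ᵢ f + (xᵢ / 2) f`. -/
theorem integral_hermite2_succ {F : Type*} [NormedAddCommGroup F] [NormedSpace ℝ F]
    (β : Fin 2 → ℕ) (i : Fin 2) (f : 𝓢(R2, F)) :
    ∫ x, hermite2 (β + Pi.single i 1) x • f x
      = ∫ x, hermite2 β x • (∂_{basisVec i} f x + (x i / 2) • f x) := by
  have h := integral_temperate_smul_deriv (μ := volume) (hasTemperateGrowth_hermite2 β)
    (hasLineDerivAt_hermite2 β i) f
  have i1 : Integrable fun x => hermite2 (β + Pi.single i 1) x • f x :=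
    integrable_temperate_smul (hasTemperateGrowth_hermite2 _) f
  have h2 := integral_add' i1 h.1
  rw [h.2, add_zero] at h2
  rw [← h2]
  congr 1
  ext x
  simp only [Pi.add_apply, hermite2_succ]
  module

theorem integral_hermite2_succ_mul (β γ : Fin 2 → ℕ) (i : Fin 2) :
    ∫ x : R2, hermite2 (β + Pi.single i 1) x * (hermite2 γ x * Real.exp (-4⁻¹ * ‖x‖ ^ 2))
      = γ i / 2 * ∫ x : R2, hermite2 β x *
        (hermite2 (γ - Pi.single i 1) x * Real.exp (-4⁻¹ * ‖x‖ ^ 2)) := by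
  set g := gaussianSchwartz R2 4⁻¹ (by norm_num) with hg
  set f : 𝓢(R2, ℝ) := SchwartzMap.smulLeftCLM ℝ (hermite2 γ) g with hf
  have hfx : ∀ x, f x = hermite2 γ x * Real.exp (-4⁻¹ * ‖x‖ ^ 2) := fun x => by
    rw [hf, SchwartzMap.smulLeftCLM_apply (hasTemperateGrowth_hermite2 γ)]
    rfl
  have hd : ∀ x, ∂_{basisVec i} f x + (x i / 2) • f x
      = γ i / 2 * (hermite2 (γ - Pi.single i 1) x * Real.exp (-4⁻¹ * ‖x‖ ^ 2)) := by
    intro x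
    have h1 : HasLineDerivAt ℝ (fun x : R2 => Real.exp (-4⁻¹ * ‖x‖ ^ 2))
        (2 * (Real.exp (-4⁻¹ * ‖x‖ ^ 2) * (-4⁻¹)) * x i) x (basisVec i) :=
      hasLineDerivAt_radial (φ := fun s => Real.exp (-4⁻¹ * s)) x i
        (by simpa using ((hasDerivAt_id (‖x‖ ^ 2)).const_mul (-4⁻¹ : ℝ)).exp)
    have h2 := (hasLineDerivAt_hermite2 γ i x).mul_real h1
    have h3 : (∂_{basisVec i} f : 𝓢(R2, ℝ)) x = _ := (SchwartzMap.lineDerivOp_apply _ f x).trans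
      ((congrArg (fun F => lineDeriv ℝ F x (basisVec i)) (funext hfx)).trans h2.lineDeriv)
    rw [h3, hfx, smul_eq_mul]
    ring
  have h := integral_hermite2_succ β i f
  simp only [hd] at h
  simp only [hfx, smul_eq_mul] at h
  rw [h, ← integral_const_mul]
  congr 1
  ext x
  ring

/-- The squared norm of `hermite2 β` with respect to the weight `e^{-|x|²/4}`. -/
def hermiteNormSq (β : Fin 2 → ℕ) : ℝ :=
  4 * π * ((β 0).factorial / 2 ^ β 0 * ((β 1).factorial / 2 ^ β 1))

theorem hermiteNormSq_pos (β : Fin 2 → ℕ) : 0 < hermiteNormSq β := by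
  unfold hermiteNormSq
  positivity

theorem hermiteNormSq_succ (β : Fin 2 → ℕ) (i : Fin 2) :
    hermiteNormSq (β + Pi.single i 1) = (β i + 1) / 2 * hermiteNormSq β := by
  fin_cases i <;> simp [hermiteNormSq, Nat.factorial_succ, pow_succ] <;> field_simp

theorem exists_eq_add_single {β : Fin 2 → ℕ} {i : Fin 2} (h : β i ≠ 0) :
    ∃ γ : Fin 2 → ℕ, β = γ + Pi.single i 1 := by
  refine ⟨β - Pi.single i 1, ?_⟩
  ext j
  rcases eq_or_ne j i with rfl | hj
  · simp; omega
  · simp [hj]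

theorem integral_hermite2_mul (β γ : Fin 2 → ℕ) :
    ∫ x : R2, hermite2 β x * (hermite2 γ x * Real.exp (-4⁻¹ * ‖x‖ ^ 2))
      = if β = γ then hermiteNormSq β else 0 := by
  have hsymm : ∀ β γ : Fin 2 → ℕ,
      ∫ x : R2, hermite2 β x * (hermite2 γ x * Real.exp (-4⁻¹ * ‖x‖ ^ 2))
      = ∫ x : R2, hermite2 γ x * (hermite2 β x * Real.exp (-4⁻¹ * ‖x‖ ^ 2)) := by
    intro β γ
    congr 1
    ext x
    ring
  induction hk : β 0 + β 1 generalizing β γ with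
  | zero =>
    have hβ : β = 0 := by ext i; fin_cases i <;> simp <;> omega
    subst hβ
    by_cases hγ : γ = 0
    · subst hγ
      have h := GaussianFourier.integral_rexp_neg_mul_sq_norm (V := R2)
        (b := 4⁻¹) (by norm_num)
      simp only [hermite2_zero, one_mul, h, if_true, hermiteNormSq]
      simp
      ring
    · obtain ⟨i, hi⟩ := Function.ne_iff.1 hγ
      obtain ⟨γ, rfl⟩ := exists_eq_add_single hi
      rw [hsymm, integral_hermite2_succ_mul]
      rw [if_neg (Ne.symm hγ)]
      simp
  | succ k ih =>
    obtain ⟨i, hi⟩ : ∃ i, β i ≠ 0 := by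
      by_contra! h
      simp [h] at hk
    obtain ⟨β, rfl⟩ := exists_eq_add_single hi
    have hk' : β 0 + β 1 = k := by
      fin_cases i <;> simp at hk <;> omega
    rw [integral_hermite2_succ_mul]
    by_cases hγ : γ i = 0
    · rw [hγ, if_neg]
      · simp
      · rintro rfl
        exact hi hγ
    · obtain ⟨γ, rfl⟩ := exists_eq_add_single hγ
      rw [add_tsub_cancel_right, ih β γ hk', hermiteNormSq_succ]
      by_cases h : β = γ
      · subst h
        simp
      · simp [h]

end Hermite

/-! ### Functions determined by their moments -/

section Moments

open scoped FourierTransform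

variable {E : Type*} [NormedAddCommGroup E] [InnerProductSpace ℝ E] [FiniteDimensional ℝ E]
  [MeasurableSpace E] [BorelSpace E]

/-- An integrable function with vanishing Fourier transform vanishes almost everywhere. -/
theorem ae_eq_zero_of_fourier_eq_zero {f : E → ℂ} (hf : Integrable f) (h : ∀ y, 𝓕 f y = 0) :
    ∀ᵐ x, f x = 0 := by
  refine ae_eq_zero_of_integral_contDiff_smul_eq_zero hf.locallyIntegrable fun g hg hgs => ?_
  have hg' : ContDiff ℝ ∞ (fun x => (g x : ℂ)) := Complex.ofRealCLM.contDiff.comp hg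
  have hgs' : HasCompactSupport (fun x => (g x : ℂ)) :=
    hgs.comp_left (g := fun t : ℝ => (t : ℂ)) Complex.ofReal_zero
  set G : 𝓢(E, ℂ) := hgs'.toSchwartzMap hg' with hG
  have key : ∫ ξ, 𝓕 f ξ • (𝓕⁻ G : 𝓢(E, ℂ)) ξ = ∫ x, f x • 𝓕 (⇑(𝓕⁻ G : 𝓢(E, ℂ))) x := by
    simpa using! VectorFourier.integral_fourierIntegral_smul_eq_flip (L := innerₗ E)
      Real.continuous_fourierChar continuous_inner hf (𝓕⁻ G : 𝓢(E, ℂ)).integrable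
  rw [← SchwartzMap.fourier_coe, FourierTransform.fourier_fourierInv_eq] at key
  simp only [h, zero_smul, integral_zero] at key
  rw [key]
  refine integral_congr_ae (Eventually.of_forall fun x => ?_)
  simp [hG, mul_comm]

/-- A function with exponential decay whose moments vanish is zero almost everywhere. -/
theorem ae_eq_zero_of_moments_eq_zero {f : E → ℂ} (hf : AEStronglyMeasurable f)
    (hexp : ∀ R : ℝ, Integrable fun x => Real.exp (R * ‖x‖) * ‖f x‖)
    (h : ∀ (y : E) (n : ℕ), ∫ x, ((inner ℝ x y : ℝ) : ℂ) ^ n * f x = 0) :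
    ∀ᵐ x, f x = 0 := by
  have hint : Integrable f := by
    rw [← integrable_norm_iff hf]
    simpa using hexp 0
  refine ae_eq_zero_of_fourier_eq_zero hint fun y => ?_
  set c : E → ℂ := fun x => ((-2 * π * inner ℝ x y : ℝ) : ℂ) * Complex.I with hc
  have hcn : ∀ x, ‖c x‖ ≤ 2 * π * ‖y‖ * ‖x‖ := fun x => by
    simp only [hc, norm_mul, Complex.norm_real, Complex.norm_I, mul_one, norm_neg, Real.norm_eq_abs]
    have := abs_real_inner_le_norm x y
    rw [abs_two, abs_of_pos pi_pos]
    nlinarith [pi_pos]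
  have hs := hasSum_integral_of_dominated_convergence (μ := volume)
    (F := fun (n : ℕ) x => (c x ^ n / n.factorial) * f x) (f := fun x => Complex.exp (c x) * f x)
    (fun n x => (2 * π * ‖y‖ * ‖x‖) ^ n / n.factorial * ‖f x‖)
    (fun n => by
      refine AEStronglyMeasurable.mul (Continuous.aestronglyMeasurable ?_) hf
      fun_prop)
    (fun n => Eventually.of_forall fun x => by
      rw [norm_mul, norm_div, norm_pow, Complex.norm_natCast]
      gcongr
      exact hcn x)
    (Eventually.of_forall fun x => (Real.summable_pow_div_factorial _).mul_right _)
    (by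
      refine (hexp (2 * π * ‖y‖)).congr (Eventually.of_forall fun x => ?_)
      simp only [tsum_mul_right, Real.exp_eq_exp_ℝ, NormedSpace.exp_eq_tsum_div])
    (Eventually.of_forall fun x => by
      have := NormedSpace.expSeries_div_hasSum_exp (c x)
      rw [← Complex.exp_eq_exp_ℂ] at this
      exact this.mul_right _)
  have hz : ∀ n : ℕ, ∫ x, (c x ^ n / n.factorial) * f x = 0 := fun n => by
    have : ∀ x, (c x ^ n / n.factorial) * f x
        = ((-2 * π * Complex.I) ^ n / n.factorial) * (((inner ℝ x y : ℝ) : ℂ) ^ n * f x) := by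
      intro x
      simp only [hc]
      push_cast
      ring
    simp only [this, integral_const_mul, h, mul_zero]
  simp only [hz] at hs
  have h0 := hs.unique hasSum_zero
  rw [Real.fourier_eq', ← h0]
  refine integral_congr_ae (Eventually.of_forall fun x => ?_)
  simp [hc]

end Moments

/-! ### The Hermite basis -/

section HermiteBasis

theorem mul_coord_mem_span_hermite2 {P : R2 → ℝ} (i : Fin 2)
    (hP : P ∈ Submodule.span ℝ (Set.range hermite2)) :
    (fun x => x i * P x) ∈ Submodule.span ℝ (Set.range hermite2) := by
  induction hP using Submodule.span_induction with
  | mem P h =>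
    obtain ⟨β, rfl⟩ := h
    have : (fun x : R2 => x i * hermite2 β x) = (2 : ℝ) • hermite2 (β + Pi.single i 1)
        + (β i : ℝ) • hermite2 (β - Pi.single i 1) := by
      ext x
      simp only [Pi.add_apply, Pi.smul_apply, smul_eq_mul, hermite2_succ]
      ring
    rw [this]
    exact Submodule.add_mem _ (Submodule.smul_mem _ _ (Submodule.subset_span ⟨_, rfl⟩))
      (Submodule.smul_mem _ _ (Submodule.subset_span ⟨_, rfl⟩))
  | zero =>
    convert! Submodule.zero_mem (Submodule.span ℝ (Set.range hermite2)) using 1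
    ext x
    simp
  | add P Q _ _ hP hQ =>
    convert! Submodule.add_mem _ hP hQ using 1
    ext x
    simp [mul_add]
  | smul c P _ hP =>
    convert! Submodule.smul_mem _ c hP using 1
    ext x
    simp [mul_left_comm]

theorem inner_pow_mem_span_hermite2 (y : R2) (n : ℕ) :
    (fun x : R2 => (inner ℝ x y : ℝ) ^ n) ∈ Submodule.span ℝ (Set.range hermite2) := by
  induction n with
  | zero =>
    refine Submodule.subset_span ⟨0, ?_⟩
    ext x
    simp
  | succ n ih =>
    convert! Submodule.add_mem _
      (Submodule.smul_mem _ (y 0) (mul_coord_mem_span_hermite2 0 ih))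
      (Submodule.smul_mem _ (y 1) (mul_coord_mem_span_hermite2 1 ih)) using 1
    ext x
    simp only [Pi.add_apply, Pi.smul_apply, smul_eq_mul, pow_succ]
    simp only [PiLp.inner_apply, Fin.sum_univ_two, RCLike.inner_apply, conj_trivial]
    ring

/-- The normalised Hermite functions. -/
def hermiteSchwartz (β : Fin 2 → ℕ) : 𝓢(R2, ℝ) :=
  (√(hermiteNormSq β))⁻¹ •
    SchwartzMap.smulLeftCLM ℝ (hermite2 β) (gaussianSchwartz R2 8⁻¹ (by norm_num))

theorem hermiteSchwartz_apply (β : Fin 2 → ℕ) (x : R2) : hermiteSchwartz β x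
    = (√(hermiteNormSq β))⁻¹ * (hermite2 β x * Real.exp (-8⁻¹ * ‖x‖ ^ 2)) := by
  simp [hermiteSchwartz, SchwartzMap.smulLeftCLM_apply (hasTemperateGrowth_hermite2 β)]

theorem memLp_hermiteSchwartz (β : Fin 2 → ℕ) :
    MemLp (fun x => (hermiteSchwartz β x : ℂ)) 2 :=
  ((hermiteSchwartz β).memLp 2).ofReal

/-- The normalised Hermite functions as elements of `L²`. -/
def hermiteLp (β : Fin 2 → ℕ) : Lp ℂ 2 (volume : Measure R2) := (memLp_hermiteSchwartz β).toLp _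

theorem inner_hermiteLp (β : Fin 2 → ℕ) (W : Lp ℂ 2 (volume : Measure R2)) :
    inner ℂ (hermiteLp β) W = ∫ x, (hermiteSchwartz β x : ℂ) * W x := by
  rw [L2.inner_def]
  refine integral_congr_ae ?_
  filter_upwards [(memLp_hermiteSchwartz β).coeFn_toLp] with x hx
  simp only [hermiteLp, hx]
  simp [mul_comm]

theorem orthonormal_hermiteLp : Orthonormal ℂ hermiteLp := by
  rw [orthonormal_iff_ite]
  intro β γ
  have h : inner ℂ (hermiteLp β) (hermiteLp γ)
      = ((∫ x, (√(hermiteNormSq β))⁻¹ * (√(hermiteNormSq γ))⁻¹ *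
        (hermite2 β x * (hermite2 γ x * Real.exp (-4⁻¹ * ‖x‖ ^ 2))) : ℝ) : ℂ) := by
    rw [inner_hermiteLp, ← integral_complex_ofReal]
    refine integral_congr_ae ?_
    filter_upwards [(memLp_hermiteSchwartz γ).coeFn_toLp] with x hx
    simp only [hermiteLp, hx]
    rw [hermiteSchwartz_apply, hermiteSchwartz_apply,
      show -4⁻¹ * ‖x‖ ^ 2 = -8⁻¹ * ‖x‖ ^ 2 + -8⁻¹ * ‖x‖ ^ 2 by ring, Real.exp_add]
    push_cast
    ring
  rw [h, integral_const_mul, integral_hermite2_mul]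
  split_ifs with hβ
  · subst hβ
    have h0 := hermiteNormSq_pos β
    rw [← mul_inv, Real.mul_self_sqrt h0.le, inv_mul_cancel₀ h0.ne', Complex.ofReal_one]
  · simp

theorem memLp_exp_norm_mul_gaussian (R : ℝ) :
    MemLp (fun x : R2 => Real.exp (R * ‖x‖) * Real.exp (-8⁻¹ * ‖x‖ ^ 2)) 2 := by
  refine ((gaussianSchwartz R2 16⁻¹ (by norm_num)).memLp 2).of_le_mul (c := Real.exp (4 * R ^ 2))
    (Continuous.aestronglyMeasurable (by fun_prop)) (Eventually.of_forall fun x => ?_)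
  rw [gaussianSchwartz_apply, ← Real.exp_add, Real.norm_of_nonneg (Real.exp_pos _).le,
    Real.norm_of_nonneg (Real.exp_pos _).le, ← Real.exp_add]
  refine Real.exp_le_exp.2 ?_
  nlinarith [sq_nonneg (2 * R - ‖x‖ / 4)]

theorem orthogonal_span_hermiteLp : (Submodule.span ℂ (Set.range hermiteLp))ᗮ = ⊥ := by
  rw [Submodule.eq_bot_iff]
  intro W hW
  have hW0 : ∀ β, ∫ x, (hermiteSchwartz β x : ℂ) * W x = 0 := fun β => by
    rw [← inner_hermiteLp]
    exact hW _ (Submodule.subset_span ⟨β, rfl⟩)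
  have hWm : MemLp W 2 volume := Lp.memLp W
  set f : R2 → ℂ := fun x => (Real.exp (-8⁻¹ * ‖x‖ ^ 2) : ℂ) * W x with hf
  have hfm : AEStronglyMeasurable f :=
    (Continuous.aestronglyMeasurable (by fun_prop)).mul hWm.1
  have hspan : ∀ P ∈ Submodule.span ℝ (Set.range hermite2),
      Integrable (fun x => P x • f x) ∧ ∫ x, P x • f x = 0 := by
    intro P hP
    induction hP using Submodule.span_induction with
    | mem P h =>
      obtain ⟨β, rfl⟩ := h
      have hN : √(hermiteNormSq β) ≠ 0 := (Real.sqrt_pos.2 (hermiteNormSq_pos β)).ne'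
      have h1 : ∀ x, hermite2 β x • f x
          = (√(hermiteNormSq β) : ℂ) * ((hermiteSchwartz β x : ℂ) * W x) := fun x => by
        rw [hermiteSchwartz_apply, Complex.real_smul]
        have : (√(hermiteNormSq β) : ℂ) ≠ 0 := by exact_mod_cast hN
        push_cast
        rw [hf]
        field_simp
        push_cast
        ring
      simp only [h1]
      refine ⟨((memLp_hermiteSchwartz β).integrable_mul hWm).const_mul _, ?_⟩
      rw [integral_const_mul, hW0, mul_zero]
    | zero => simp
    | add P Q _ _ hP hQ =>
      simp only [Pi.add_apply, add_smul]
      exact ⟨hP.1.add hQ.1, by rw [integral_add hP.1 hQ.1, hP.2, hQ.2, add_zero]⟩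
    | smul c P _ hP =>
      simp only [Pi.smul_apply, smul_assoc]
      exact ⟨hP.1.smul c, by rw [integral_smul, hP.2, smul_zero]⟩
  have hf0 : ∀ᵐ x, f x = 0 := by
    refine ae_eq_zero_of_moments_eq_zero hfm (fun R => ?_) fun y n => ?_
    · refine ((memLp_exp_norm_mul_gaussian R).integrable_mul hWm.norm).congr
        (Eventually.of_forall fun x => ?_)
      simp only [hf, Pi.mul_apply, norm_mul, Complex.norm_real, Real.norm_eq_abs, Real.abs_exp]
      ring
    · have := (hspan _ (inner_pow_mem_span_hermite2 y n)).2
      simpa only [Complex.real_smul, Complex.ofReal_pow] using this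
  rw [Lp.eq_zero_iff_ae_eq_zero]
  filter_upwards [hf0] with x hx
  simpa [hf] using hx

/-- The Hermite functions as a Hilbert basis of `L²`. -/
def hermiteBasis : HilbertBasis (Fin 2 → ℕ) ℂ (Lp ℂ 2 (volume : Measure R2)) :=
  HilbertBasis.mkOfOrthogonalEqBot orthonormal_hermiteLp orthogonal_span_hermiteLp

/-- Parseval's identity in the Gaussian-weighted `L²` space. -/
theorem hasSum_hermite_coeff {f : R2 → ℂ}
    (hf : MemLp (fun x => Real.exp (‖x‖ ^ 2 / 8) • f x) 2) :
    HasSum (fun β : Fin 2 → ℕ => ‖∫ x, hermite2 β x • f x‖ ^ 2 / hermiteNormSq β)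
      (∫ x, Real.exp (‖x‖ ^ 2 / 4) * inner ℝ (f x) (f x)) := by
  set W := hf.toLp _ with hW
  have h := Complex.reCLM.hasSum (hermiteBasis.hasSum_inner_mul_inner W W)
  have hb : ∀ β, hermiteBasis β = hermiteLp β := fun β => by
    simp [hermiteBasis]
  have hβ : ∀ β, inner ℂ (hermiteBasis β) W
      = ((√(hermiteNormSq β))⁻¹ : ℝ) • ∫ x, hermite2 β x • f x := fun β => by
    rw [hb, inner_hermiteLp, ← integral_smul]
    refine integral_congr_ae ?_
    filter_upwards [hf.coeFn_toLp] with x hx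
    rw [hW, hx, hermiteSchwartz_apply]
    have he : Real.exp (-8⁻¹ * ‖x‖ ^ 2) * Real.exp (‖x‖ ^ 2 / 8) = 1 := by
      rw [← Real.exp_add, ← Real.exp_zero]
      congr 1
      ring
    rw [← Complex.real_smul, smul_smul, smul_smul]
    congr 1
    linear_combination (√(hermiteNormSq β))⁻¹ * hermite2 β x * he
  have hWW : inner ℂ W W
      = ((∫ x, Real.exp (‖x‖ ^ 2 / 4) * inner ℝ (f x) (f x) : ℝ) : ℂ) := by
    rw [L2.inner_def, ← integral_complex_ofReal]
    refine integral_congr_ae ?_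
    filter_upwards [hf.coeFn_toLp] with x hx
    rw [hW, hx, show ‖x‖ ^ 2 / 4 = ‖x‖ ^ 2 / 8 + ‖x‖ ^ 2 / 8 by ring, Real.exp_add,
      inner_self_eq_norm_sq_to_K, norm_smul, Real.norm_of_nonneg (Real.exp_pos _).le,
      real_inner_self_eq_norm_sq, ← RCLike.ofReal_pow]
    refine congrArg Complex.ofReal ?_
    rw [Algebra.algebraMap_self_apply]
    ring
  rw [hWW] at h
  convert! h using 1
  ext β
  rw [← inner_conj_symm W, hβ, Complex.reCLM_apply, ← Complex.normSq_eq_conj_mul_self,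
    Complex.ofReal_re, Complex.normSq_eq_norm_sq, norm_smul, mul_pow,
    Real.norm_of_nonneg (by positivity), inv_pow, Real.sq_sqrt (hermiteNormSq_pos β).le]
  ring

end HermiteBasis

/-! ### Spectral gap of the Gaussian energy -/

section SpectralGap

variable {α : ℝ} {l : ℂ} {w : 𝓢(R2, ℂ)}

/-- The Hermite coefficients of `w`. -/
def hermiteCoeff (w : 𝓢(R2, ℂ)) (β : Fin 2 → ℕ) : ℂ := ∫ x, hermite2 β x • w x

/-- The Gaussian-weighted Dirichlet energy of `w`. -/
def gaussianEnergy (w : 𝓢(R2, ℂ)) : ℝ :=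
  ∫ x, Real.exp (‖x‖ ^ 2 / 4) * (inner ℝ (twistedGrad w 0 x) (twistedGrad w 0 x)
    + inner ℝ (twistedGrad w 1 x) (twistedGrad w 1 x))

theorem memLp_exp_smul {f : R2 → ℂ} (hf : Continuous f)
    (h : Integrable fun x => Real.exp (‖x‖ ^ 2 / 4) * inner ℝ (f x) (f x)) :
    MemLp (fun x => Real.exp (‖x‖ ^ 2 / 8) • f x) 2 := by
  rw [memLp_two_iff_integrable_sq_norm (Continuous.aestronglyMeasurable (by fun_prop))]
  refine h.congr (Eventually.of_forall fun x => ?_)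
  simp only [norm_smul, Real.norm_of_nonneg (Real.exp_pos _).le, real_inner_self_eq_norm_sq,
    show ‖x‖ ^ 2 / 4 = ‖x‖ ^ 2 / 8 + ‖x‖ ^ 2 / 8 by ring, Real.exp_add]
  ring

theorem continuous_twistedGrad (i : Fin 2) : Continuous (twistedGrad w i) := by
  have h1 := (partialS i w).continuous
  have h2 := w.continuous
  unfold twistedGrad
  fun_prop

theorem integrable_exp_twistedGrad
    (heig : ∀ ξ : R2, Lop (⇑w) ξ - (α : ℂ) * LamC (⇑w) ξ = l * w ξ) (i : Fin 2) :
    Integrable fun x => Real.exp (‖x‖ ^ 2 / 4)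
      * inner ℝ (twistedGrad w i x) (twistedGrad w i x) := by
  have hc := continuous_twistedGrad (w := w) i
  refine (gaussian_energy_inequality heig).1.mono'
    (Continuous.aestronglyMeasurable (by fun_prop)) (Eventually.of_forall fun x => ?_)
  rw [Real.norm_of_nonneg (mul_nonneg (Real.exp_pos _).le real_inner_self_nonneg)]
  gcongr
  fin_cases i <;> simp

theorem hasSum_hermiteCoeff
    (heig : ∀ ξ : R2, Lop (⇑w) ξ - (α : ℂ) * LamC (⇑w) ξ = l * w ξ) :
    HasSum (fun β => ‖hermiteCoeff w β‖ ^ 2 / hermiteNormSq β)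
      (∫ x, Real.exp (‖x‖ ^ 2 / 4) * inner ℝ (w x) (w x)) :=
  hasSum_hermite_coeff (memLp_exp_smul w.continuous (integrable_exp_inner heig))

theorem hasSum_hermiteCoeff_twistedGrad
    (heig : ∀ ξ : R2, Lop (⇑w) ξ - (α : ℂ) * LamC (⇑w) ξ = l * w ξ) (i : Fin 2) :
    HasSum (fun β => (β i : ℝ) / 2 * (‖hermiteCoeff w β‖ ^ 2 / hermiteNormSq β))
      (∫ x, Real.exp (‖x‖ ^ 2 / 4) * inner ℝ (twistedGrad w i x) (twistedGrad w i x)) := by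
  have h := hasSum_hermite_coeff
    (memLp_exp_smul (continuous_twistedGrad (w := w) i) (integrable_exp_twistedGrad heig i))
  have hinj : Function.Injective fun β : Fin 2 → ℕ => β + Pi.single i 1 :=
    add_left_injective _
  rw [← hinj.hasSum_iff]
  · convert! h using 1
    ext β
    have h1 : ∫ x, hermite2 β x • twistedGrad w i x = hermiteCoeff w (β + Pi.single i 1) :=
      (integral_hermite2_succ β i w).symm
    have h2 := (hermiteNormSq_pos β).ne'
    have h3 : (β i : ℝ) + 1 ≠ 0 := by positivity
    simp only [Function.comp_apply, h1, hermiteNormSq_succ, Pi.add_apply, Pi.single_eq_same]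
    push_cast
    field_simp
  · intro β hβ
    have : β i = 0 := by
      by_contra h0
      obtain ⟨γ, rfl⟩ := exists_eq_add_single h0
      exact hβ ⟨γ, rfl⟩
    simp [this]

theorem hasSum_gaussianEnergy
    (heig : ∀ ξ : R2, Lop (⇑w) ξ - (α : ℂ) * LamC (⇑w) ξ = l * w ξ) :
    HasSum (fun β => ((β 0 + β 1 : ℕ) : ℝ) / 2 * (‖hermiteCoeff w β‖ ^ 2 / hermiteNormSq β))
      (gaussianEnergy w) := by
  have h := (hasSum_hermiteCoeff_twistedGrad heig 0).add (hasSum_hermiteCoeff_twistedGrad heig 1)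
  rw [← integral_add (integrable_exp_twistedGrad heig 0) (integrable_exp_twistedGrad heig 1)] at h
  convert! h using 1
  · ext β
    push_cast
    ring
  · simp only [gaussianEnergy, mul_add]

/-- If the Hermite coefficients of degree below `k` vanish, the energy is at least `k / 2` times
the weighted mass. -/
theorem mass_le_gaussianEnergy
    (heig : ∀ ξ : R2, Lop (⇑w) ξ - (α : ℂ) * LamC (⇑w) ξ = l * w ξ) (k : ℕ)
    (hk : ∀ β : Fin 2 → ℕ, β 0 + β 1 < k → hermiteCoeff w β = 0) :
    (k / 2 : ℝ) * (∫ x, Real.exp (‖x‖ ^ 2 / 4) * inner ℝ (w x) (w x)) ≤ gaussianEnergy w := by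
  refine hasSum_le (fun β => ?_) ((hasSum_hermiteCoeff heig).mul_left _)
    (hasSum_gaussianEnergy heig)
  rcases lt_or_ge (β 0 + β 1) k with h | h
  · simp [hk β h]
  · have := (hermiteNormSq_pos β).le
    gcongr

theorem integral_exp_inner_pos (hw : w ≠ 0)
    (heig : ∀ ξ : R2, Lop (⇑w) ξ - (α : ℂ) * LamC (⇑w) ξ = l * w ξ) :
    0 < ∫ x, Real.exp (‖x‖ ^ 2 / 4) * inner ℝ (w x) (w x) := by
  obtain ⟨x, hx⟩ : ∃ x, w x ≠ 0 := by
    by_contra! h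
    exact hw (SchwartzMap.ext h)
  have hc := w.continuous
  have hcont : Continuous fun x => Real.exp (‖x‖ ^ 2 / 4) * inner ℝ (w x) (w x) := by fun_prop
  have hpos : ∀ y, 0 ≤ Real.exp (‖y‖ ^ 2 / 4) * inner ℝ (w y) (w y) := fun y =>
    mul_nonneg (Real.exp_pos _).le real_inner_self_nonneg
  rw [integral_pos_iff_support_of_nonneg hpos (integrable_exp_inner heig)]
  exact hcont.isOpen_support.measure_pos _
    ⟨x, mul_ne_zero (Real.exp_pos _).ne' (inner_self_ne_zero.2 hx)⟩

theorem re_le_of_hermiteCoeff_eq_zero (hw : w ≠ 0)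
    (heig : ∀ ξ : R2, Lop (⇑w) ξ - (α : ℂ) * LamC (⇑w) ξ = l * w ξ) (k : ℕ)
    (hk : ∀ β : Fin 2 → ℕ, β 0 + β 1 < k → hermiteCoeff w β = 0) : l.re ≤ -(k / 2) := by
  have h1 := mass_le_gaussianEnergy heig k hk
  have h2 := (gaussian_energy_inequality heig).2
  have h3 := integral_exp_inner_pos hw heig
  unfold gaussianEnergy at h1
  nlinarith

theorem hermiteCoeff_zero : hermiteCoeff w 0 = ∫ x, w x := by simp [hermiteCoeff]

theorem hermiteCoeff_single (i : Fin 2) :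
    hermiteCoeff w (Pi.single i 1) = 2⁻¹ * ∫ x, (x i : ℂ) * w x := by
  rw [hermiteCoeff, ← integral_const_mul]
  congr 1
  ext x
  have h := hermite2_succ 0 i x
  simp only [zero_add, Pi.zero_apply, CharP.cast_eq_zero, hermite2_zero] at h
  rw [h, Complex.real_smul]
  push_cast
  ring

end SpectralGap

/-- Spectral stability of Oseen vortices: any eigenvalue `λ` of
`𝓛 - αΛ` with Schwartz eigenfunction satisfies `Re λ ≤ 0`; `Re λ ≤ -1/2` on the
subspace of zero mean, and `Re λ ≤ -1` if in addition the first moments vanish. -/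
theorem eigenvalue_bounds (α : ℝ) (l : ℂ) (w : SchwartzMap R2 ℂ) (hw : w ≠ 0)
    (heig : ∀ ξ : R2, Lop (⇑w) ξ - (α : ℂ) * LamC (⇑w) ξ = l * w ξ) :
    l.re ≤ 0 ∧
    ((∫ ξ : R2, w ξ) = 0 →
      l.re ≤ -(1/2) ∧
      (((∫ ξ : R2, (ξ 0 : ℂ) * w ξ) = 0 ∧ (∫ ξ : R2, (ξ 1 : ℂ) * w ξ) = 0) →
        l.re ≤ -1)) := by
  refine ⟨?_, fun h0 => ?_⟩
  · simpa using re_le_of_hermiteCoeff_eq_zero hw heig 0 (by simp)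
  have hc0 : ∀ β : Fin 2 → ℕ, β 0 + β 1 = 0 → hermiteCoeff w β = 0 := fun β hβ => by
    have : β = 0 := by ext i; fin_cases i <;> simp <;> omega
    rw [this, hermiteCoeff_zero, h0]
  refine ⟨?_, fun ⟨h1, h2⟩ => ?_⟩
  · simpa using re_le_of_hermiteCoeff_eq_zero hw heig 1 fun β hβ => hc0 β (by omega)
  · have := re_le_of_hermiteCoeff_eq_zero hw heig 2 fun β hβ => by
      rcases (show β 0 + β 1 = 0 ∨ (β 0 = 1 ∧ β 1 = 0) ∨ (β 0 = 0 ∧ β 1 = 1) by omega)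
        with h | h | h
      · exact hc0 β h
      · have : β = Pi.single 0 1 := by ext i; fin_cases i <;> simp [h]
        rw [this, hermiteCoeff_single, h1, mul_zero]
      · have : β = Pi.single 1 1 := by ext i; fin_cases i <;> simp [h]
        rw [this, hermiteCoeff_single, h2, mul_zero]
    norm_num at this
    exact this

end
end
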